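/- arXiv:2604.11330 — 4 statements merged into one kernel-verified Lean document; each statement's English description precedes it below -/
import Mathlib

section
/- Let ℓ be a prime and let O be an order in an imaginary quadratic field K whose conductor c is coprime to ℓ, with discriminant D_O = c²·D_K. Suppose ℓO = L² where L is a prime ideal of O that is principal. Then |D_O| ≤ 4ℓ, and more precisely the pair (D_K, c) belongs to {(−4ℓ, 1)} if ℓ ≡ 1 (mod 4), to {(−ℓ, 1), (−ℓ, 2)} if ℓ ≡ 3 (mod 4), and to {(−8, 1), (−4, 1)} if ℓ = 2. -/
open NumberField Matrix

theorem quad_rel {K : Type*} [Field K] [NumberField K] (b : Module.Basis (Fin 2) ℤ (𝓞 K)) (z : 𝓞 K) :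
    z ^ 2 = (Algebra.trace ℤ (𝓞 K) z : ℤ) * z - (Algebra.norm ℤ z : ℤ) := by
  apply Algebra.leftMulMatrix_injective b
  rw [Algebra.trace_eq_matrix_trace b, Algebra.norm_eq_matrix_det b]
  generalize hA : Algebra.leftMulMatrix b z = A
  have e1 : ∀ m : ℤ, Algebra.leftMulMatrix b (m : 𝓞 K) = algebraMap ℤ _ m := fun m => by
    rw [← AlgHom.commutes (Algebra.leftMulMatrix b) m]; simp
  rw [map_sub, map_mul, map_pow, hA, e1, e1, Matrix.algebraMap_eq_diagonal,
    Matrix.algebraMap_eq_diagonal, Matrix.trace_fin_two, Matrix.det_fin_two, sq]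
  ext i j
  fin_cases i <;> fin_cases j <;> simp [Matrix.mul_apply, Fin.sum_univ_two] <;> ring

theorem exists_phi {K : Type*} [Field K] [NumberField K] (hdeg : Module.finrank ℚ K = 2) :
    ∃ φ : 𝓞 K →+ ℤ, Function.Surjective φ ∧ φ 1 = 0 ∧ (∀ z, φ z = 0 → ∃ m : ℤ, z = m) ∧
      (∀ z, (Algebra.trace ℤ (𝓞 K) z) ^ 2 - 4 * Algebra.norm ℤ z = φ z ^ 2 * discr K) ∧
      (∀ z : 𝓞 K, z ^ 2 = (Algebra.trace ℤ (𝓞 K) z : ℤ) * z - (Algebra.norm ℤ z : ℤ)) ∧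
      (∀ m : ℤ, Algebra.norm ℤ (m : 𝓞 K) = m ^ 2) := by
  have hr : Module.finrank ℤ (𝓞 K) = 2 := by rw [RingOfIntegers.rank, hdeg]
  let b : Module.Basis (Fin 2) ℤ (𝓞 K) := Module.finBasisOfFinrankEq ℤ (𝓞 K) hr
  have hn : ∀ m : ℤ, Algebra.norm ℤ (m : 𝓞 K) = m ^ 2 := fun m => by
    have := Algebra.norm_algebraMap_of_basis b m
    simpa using this
  have hz : ∀ z, z = (b.repr z 0 : 𝓞 K) * b 0 + (b.repr z 1 : 𝓞 K) * b 1 := fun z => by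
    have := b.sum_repr z
    rw [Fin.sum_univ_two] at this
    simpa using this.symm
  set x := b.repr 1 0 with hx
  set y := b.repr 1 1 with hy
  have h1 : (1 : 𝓞 K) = x * b 0 + y * b 1 := hz 1
  have hg : IsCoprime x y := by
    rw [Int.isCoprime_iff_gcd_eq_one]
    obtain ⟨p, hp⟩ := Int.gcd_dvd_left x y
    obtain ⟨q, hq⟩ := Int.gcd_dvd_right x y
    have h2 : (1 : 𝓞 K) = ((Int.gcd x y : ℤ) : 𝓞 K) * (p * b 0 + q * b 1) := by
      rw [h1]
      nth_rewrite 1 [hp]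
      nth_rewrite 2 [hq]
      push_cast; ring
    have h3 := congrArg (Algebra.norm ℤ) h2
    rw [map_mul, hn, map_one] at h3
    have h4 : ((Int.gcd x y : ℕ) : ℤ) ∣ 1 := ⟨_, by rw [h3, sq, mul_assoc]⟩
    exact Nat.dvd_one.1 (by exact_mod_cast h4)
  obtain ⟨u, v, huv⟩ := hg
  let φ : 𝓞 K →ₗ[ℤ] ℤ := x • b.coord 1 - y • b.coord 0
  have hφ : ∀ z, φ z = x * b.repr z 1 - y * b.repr z 0 := fun z => by simp [φ]
  refine ⟨φ.toAddMonoidHom, ?_, ?_, ?_, ?_, quad_rel b, hn⟩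
  · intro m
    refine ⟨m • (- v • b 0 + u • b 1), ?_⟩
    show φ _ = m
    rw [map_smul, hφ, map_add, map_smul, map_smul]
    simp [-zsmul_eq_mul]
    linear_combination m * huv
  · show φ 1 = 0
    rw [hφ]; ring
  · intro z h
    change φ z = 0 at h
    rw [hφ] at h
    refine ⟨u * b.repr z 0 + v * b.repr z 1, ?_⟩
    have e0 : b.repr z 0 = (u * b.repr z 0 + v * b.repr z 1) * x := by
      linear_combination (-b.repr z 0) * huv - v * h
    have e1 : b.repr z 1 = (u * b.repr z 0 + v * b.repr z 1) * y := by
      linear_combination (-b.repr z 1) * huv + u * h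
    generalize u * b.repr z 0 + v * b.repr z 1 = m at *
    rw [hz z, e0, e1]
    push_cast
    linear_combination (-(m : 𝓞 K)) * h1
  · intro z
    show _ = φ z ^ 2 * _
    let P : Matrix (Fin 2) (Fin 2) ℤ := !![x, y; b.repr z 0, b.repr z 1]
    have hP : P.map (algebraMap ℤ (𝓞 K)) *ᵥ b = ![1, z] := by
      ext i
      fin_cases i
      · simp [P, Matrix.mulVec, dotProduct, Fin.sum_univ_two, ← h1]
      · simp [P, Matrix.mulVec, dotProduct, Fin.sum_univ_two, ← hz z]
    have hd := Algebra.discr_of_matrix_mulVec b P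
    rw [hP, NumberField.discr_eq_discr K b] at hd
    have hPd : P.det = φ z := by rw [hφ]; simp [P, Matrix.det_fin_two]
    have ht1 : Algebra.trace ℤ (𝓞 K) 1 = 2 := by
      simpa [hr] using Algebra.trace_algebraMap_of_basis b 1
    rw [hPd] at hd
    rw [← hd, Algebra.discr_def, Matrix.det_fin_two]
    have hq := congrArg (Algebra.trace ℤ (𝓞 K)) (quad_rel b z)
    have hcm : ∀ (m : ℤ) (w : 𝓞 K), Algebra.trace ℤ (𝓞 K) ((m : 𝓞 K) * w) = m * Algebra.trace ℤ (𝓞 K) w := by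
      intro m w
      rw [← zsmul_eq_mul, map_zsmul, smul_eq_mul]
    have hcn : ∀ (m : ℤ), Algebra.trace ℤ (𝓞 K) ((m : 𝓞 K)) = m * 2 := by
      intro m
      rw [← ht1, ← hcm, mul_one]
    rw [map_sub, hcm, hcn, sq] at hq
    simp [Algebra.traceMatrix_apply, Algebra.traceForm_apply, ht1, hq]
    ring

theorem index_dvd_phi {R : Type*} [CommRing R] (φ : R →+ ℤ) (hs : Function.Surjective φ)
    (hk : ∀ z, φ z = 0 → ∃ m : ℤ, z = m) (O : Subring R) (a : R) (ha : a ∈ O) :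
    (O.toAddSubgroup.index : ℤ) ∣ φ a := by
  have h1 : O.toAddSubgroup = (O.toAddSubgroup.map φ).comap φ := by
    rw [AddSubgroup.comap_map_eq]
    refine (sup_eq_left.2 ?_).symm
    intro z hz
    obtain ⟨m, rfl⟩ := hk z hz
    exact intCast_mem O m
  obtain ⟨g, hg⟩ := Int.subgroup_cyclic (O.toAddSubgroup.map φ)
  have h2 : φ a ∈ O.toAddSubgroup.map φ := ⟨a, ha, rfl⟩
  rw [h1, AddSubgroup.index_comap_of_surjective _ hs]
  rw [hg, ← AddSubgroup.zmultiples_eq_closure] at *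
  rw [Int.index_zmultiples]
  rw [Int.mem_zmultiples_iff] at h2
  exact Int.natAbs_dvd.2 h2

theorem exists_half {K : Type*} [Field K] [NumberField K] (p : 𝓞 K) (ℓ : ℕ) (h3 : ℓ % 4 = 3)
    (hp : p ^ 2 = -(ℓ : 𝓞 K)) : ∃ y : 𝓞 K, y + y = 1 + p := by
  obtain ⟨k, hk⟩ : ∃ k : ℕ, ℓ + 1 = 4 * k := ⟨(ℓ + 1) / 4, by omega⟩
  have hp' : (p : K) ^ 2 = -(ℓ : K) := by
    have := congrArg (algebraMap (𝓞 K) K) hp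
    simpa using this
  have hk' : (ℓ : K) + 1 = 4 * k := by exact_mod_cast hk
  have hi : IsIntegral ℤ ((1 + (p : K)) / 2) := by
    refine ⟨Polynomial.X ^ 2 - Polynomial.X + Polynomial.C (k : ℤ), ?_, ?_⟩
    · monicity!
    · simp
      linear_combination hp' / 4 - hk' / 4
  refine ⟨⟨_, hi⟩, ?_⟩
  apply RingOfIntegers.ext
  show (1 + (p : K)) / 2 + (1 + (p : K)) / 2 = 1 + (p : K)
  ring

theorem final_arith (ℓ : ℕ) (hℓ : ℓ.Prime) (c : ℕ) (hc0 : 0 < c) (n D t : ℤ) (hneg : D < 0)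
    (hD : t ^ 2 - 4 * ℓ = n ^ 2 * D) (hlt : (ℓ : ℤ) ∣ t) (hcn : (c : ℤ) ∣ n)
    (hmod : D % 4 = 0 ∨ D % 4 = 1) (hhalf : t = 0 → ℓ % 4 = 3 → (2 : ℤ) ∣ n) :
    |(c : ℤ) ^ 2 * D| ≤ 4 * (ℓ : ℤ) ∧
    (ℓ % 4 = 1 → D = -(4 * (ℓ : ℤ)) ∧ c = 1) ∧
    (ℓ % 4 = 3 → D = -(ℓ : ℤ) ∧ (c = 1 ∨ c = 2)) ∧
    (ℓ = 2 → ((D = -8 ∧ c = 1) ∨ (D = -4 ∧ c = 1))) := by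
  have hl2 := hℓ.two_le
  have hlp : Prime (ℓ : ℤ) := Nat.prime_iff_prime_int.1 hℓ
  -- pass to the absolute value of `n`
  obtain ⟨m, hm⟩ : ∃ m : ℕ, m = n.natAbs := ⟨_, rfl⟩
  have hnm : n ^ 2 = (m : ℤ) ^ 2 := by rw [hm, Int.natAbs_sq]
  have hcm : c ∣ m := by rw [hm]; exact Int.natCast_dvd.1 hcn
  have h2m : t = 0 → ℓ % 4 = 3 → 2 ∣ m := fun h h' => by
    rw [hm]; exact Int.natCast_dvd.1 (hhalf h h')
  rw [hnm] at hD
  clear hhalf hcn hnm hm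
  have hodd : ℓ = 2 ∨ ℓ % 2 = 1 := hℓ.eq_two_or_odd
  rw [abs_of_nonpos (by nlinarith [sq_nonneg (c : ℤ)])]
  obtain ⟨s, rfl⟩ := hlt
  have key : (m = 1 ∨ m = 2) ∧
      ((s = 0 ∧ (m : ℤ) ^ 2 * D = -(4 * ℓ)) ∨ (ℓ = 2 ∧ (m : ℤ) ^ 2 * D = -4) ∨
        (ℓ = 3 ∧ (m : ℤ) ^ 2 * D = -3)) := by
    have hl : (2 : ℤ) ≤ ℓ := by exact_mod_cast hl2
    have hle : (ℓ : ℤ) * s ^ 2 ≤ 4 := by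
      have : (ℓ : ℤ) * (ℓ * s ^ 2 - 4) ≤ 0 := by nlinarith [sq_nonneg (m : ℤ)]
      nlinarith
    have hs1 : s ^ 2 ≤ 2 := by nlinarith
    have hs2 : s ≤ 1 := by nlinarith
    have hs3 : -1 ≤ s := by nlinarith
    have small : ∀ k : ℤ, k < 9 → 0 < k → (m : ℤ) ^ 2 * D = - k → m = 1 ∨ m = 2 := by
      intro k hk hk0 h
      have h0 : m ≠ 0 := by rintro rfl; simp at h; omega
      have h3 : (m : ℤ) < 3 := by nlinarith [sq_nonneg (m : ℤ)]
      omega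
    have hs0 : s ≠ 0 → (ℓ = 2 ∧ (m : ℤ) ^ 2 * D = -4) ∨ (ℓ = 3 ∧ (m : ℤ) ^ 2 * D = -3) := by
      intro hs0
      have hs4 : s ^ 2 = 1 := by
        have : s = 1 ∨ s = -1 := by omega
        rcases this with h | h <;> rw [h] <;> norm_num
      rw [hs4] at hle
      have hD' : (ℓ : ℤ) ^ 2 - 4 * ℓ = m ^ 2 * D := by
        rw [← hD]; linear_combination (-(ℓ : ℤ) ^ 2) * hs4
      have : ℓ = 2 ∨ ℓ = 3 := by
        have h4 : ℓ ≠ 4 := by rintro rfl; revert hℓ; decide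
        omega
      rcases this with rfl | rfl
      · left; exact ⟨rfl, by rw [← hD']; norm_num⟩
      · right; exact ⟨rfl, by rw [← hD']; norm_num⟩
    by_cases h0 : s = 0
    · have hD' : (m : ℤ) ^ 2 * D = -(4 * ℓ) := by rw [← hD, h0]; ring
      refine ⟨?_, Or.inl ⟨h0, hD'⟩⟩
      rcases hodd with h | hodd
      · exact small 8 (by norm_num) (by norm_num) (by rw [hD', h]; norm_num)
      · have hdvd : m ^ 2 ∣ 4 * ℓ := by
          have : (m : ℤ) ^ 2 ∣ 4 * ℓ := ⟨-D, by linear_combination hD'⟩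
          exact_mod_cast this
        have hnd : ¬ ℓ ∣ m := by
          intro h
          have h1 : ℓ * ℓ ∣ 4 * ℓ := by
            rw [← sq]; exact (pow_dvd_pow_of_dvd h 2).trans hdvd
          have h2 : ℓ ∣ 2 ^ 2 := Nat.dvd_of_mul_dvd_mul_right hℓ.pos h1
          have h3 := Nat.le_of_dvd (by norm_num) (hℓ.dvd_of_dvd_pow h2)
          omega
        have hcop : Nat.Coprime (m ^ 2) ℓ := ((hℓ.coprime_iff_not_dvd.2 hnd).symm).pow_left 2
        have h4 := Nat.le_of_dvd (by norm_num) (hcop.dvd_of_dvd_mul_right hdvd)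
        have hm0 : m ≠ 0 := by rintro rfl; simp at hdvd; omega
        have : m < 3 := by nlinarith
        omega
    · refine ⟨?_, Or.inr (hs0 h0)⟩
      rcases hs0 h0 with ⟨_, h⟩ | ⟨_, h⟩
      · exact small 4 (by norm_num) (by norm_num) h
      · exact small 3 (by norm_num) (by norm_num) h
  obtain ⟨hm12, hcases⟩ := key
  have hcle : c ≤ m := Nat.le_of_dvd (by omega) hcm
  have hc12 : c = 1 ∨ c = 2 := by omega
  rcases hm12 with rfl | rfl <;> rcases hc12 with rfl | rfl <;>
    rcases hcases with ⟨rfl, h⟩ | ⟨rfl, h⟩ | ⟨rfl, h⟩ <;> norm_num at h h2m ⊢ <;> omega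

theorem disc_of_principally_ramified
    {K : Type*} [Field K] [NumberField K]
    (hdeg : Module.finrank ℚ K = 2) (hneg : NumberField.discr K < 0)
    (ℓ : ℕ) (hℓ : ℓ.Prime)
    (O : Subring (𝓞 K)) (c : ℕ) (hc : O.toAddSubgroup.index = c) (hc0 : 0 < c)
    (hcop : Nat.Coprime c ℓ)
    (L : Ideal ↥O) (hL : L.IsPrime) (hprin : L.IsPrincipal)
    (hfact : Ideal.span {(ℓ : ↥O)} = L ^ 2) :
    |(c : ℤ) ^ 2 * NumberField.discr K| ≤ 4 * (ℓ : ℤ) ∧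
    (ℓ % 4 = 1 → NumberField.discr K = -(4 * (ℓ : ℤ)) ∧ c = 1) ∧
    (ℓ % 4 = 3 → NumberField.discr K = -(ℓ : ℤ) ∧ (c = 1 ∨ c = 2)) ∧
    (ℓ = 2 → ((NumberField.discr K = -8 ∧ c = 1) ∨ (NumberField.discr K = -4 ∧ c = 1))) := by
  obtain ⟨φ, hs, hφ1, hk, hD, hq, hn⟩ := exists_phi hdeg
  obtain ⟨a, ha⟩ := hprin.principal
  change L = Ideal.span {a} at ha
  rw [ha, Ideal.span_singleton_pow, Ideal.span_singleton_eq_span_singleton] at hfact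
  obtain ⟨u, hu⟩ := hfact
  set p : 𝓞 K := (a : 𝓞 K) with hp
  have hu' : p ^ 2 = (ℓ : 𝓞 K) * ((u : O) : 𝓞 K) := by
    have := congrArg (Subtype.val) hu
    simpa using this.symm
  have huu : IsUnit (((u : O) : 𝓞 K)) := u.isUnit.map O.subtype
  set w : 𝓞 K := ((u : O) : 𝓞 K)
  have hcp : (c : ℤ) ∣ φ p := hc ▸ index_dvd_phi φ hs hk O p a.2
  have hDp := hD p
  have hqp := hq p
  have hl0 : 0 < (ℓ : ℤ) := by exact_mod_cast hℓ.pos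
  have hlp : Prime (ℓ : ℤ) := Nat.prime_iff_prime_int.1 hℓ
  -- norm of `p`
  have hNl : Algebra.norm ℤ (ℓ : 𝓞 K) = (ℓ : ℤ) ^ 2 := by exact_mod_cast hn ℓ
  have hNp : Algebra.norm ℤ p = ℓ := by
    have h1 := congrArg (Algebra.norm ℤ) hu'
    rw [map_mul, map_pow, hNl] at h1
    have h2 : IsUnit (Algebra.norm ℤ w) := huu.map _
    have h3 : Algebra.norm ℤ w = 1 := by
      rcases Int.isUnit_iff.1 h2 with h | h
      · exact h
      · rw [h] at h1
        nlinarith [sq_nonneg (Algebra.norm ℤ p)]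
    rw [h3, mul_one] at h1
    rcases sq_eq_sq_iff_eq_or_eq_neg.1 h1 with h | h
    · exact h
    · rw [h] at hDp
      nlinarith [sq_nonneg (Algebra.trace ℤ (𝓞 K) p), sq_nonneg (φ p)]
  rw [hNp] at hDp hqp
  -- `ℓ` divides the trace
  set t : ℤ := Algebra.trace ℤ (𝓞 K) p
  have hlt : (ℓ : ℤ) ∣ t := by
    have h1 : (t : 𝓞 K) * p = (ℓ : 𝓞 K) * (w + 1) := by
      push_cast at hqp
      linear_combination hu' - hqp
    have h2 := congrArg (Algebra.norm ℤ) h1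
    rw [map_mul, map_mul, hn, hNp, hNl] at h2
    have h3 : t ^ 2 = ℓ * Algebra.norm ℤ (w + 1) := by
      apply mul_right_cancel₀ hl0.ne'
      linear_combination h2
    exact hlp.dvd_of_dvd_pow ⟨_, h3⟩
  -- discriminant mod 4
  obtain ⟨ω, hω⟩ := hs 1
  have hDω := hD ω
  rw [hω] at hDω
  have hmod : discr K % 4 = 0 ∨ discr K % 4 = 1 := by
    generalize Algebra.trace ℤ (𝓞 K) ω = T at hDω
    rcases Int.even_or_odd' T with ⟨r, h | h⟩
    · left
      have : discr K = 4 * (r ^ 2 - Algebra.norm ℤ ω) := by rw [h] at hDω; linear_combination -hDω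
      omega
    · right
      have : discr K = 4 * (r ^ 2 + r - Algebra.norm ℤ ω) + 1 := by
        rw [h] at hDω; linear_combination -hDω
      omega
  have hhalf : t = 0 → ℓ % 4 = 3 → (2 : ℤ) ∣ φ p := by
    intro ht h3
    obtain ⟨y, hy⟩ := exists_half p ℓ h3 (by rw [hqp, ht]; simp)
    have := congrArg φ hy
    rw [map_add, map_add, hφ1] at this
    exact ⟨φ y, by linarith⟩
  exact final_arith ℓ hℓ c hc0 (φ p) (discr K) t hneg hDp hlt hcp hmod hhalf
end

section
/- Let K be an imaginary quadratic field with discriminant D_K < −4 and class number h. Define C = 2 if D_K ≡ 1 (mod 8), C = 4 if D_K ≡ 0 (mod 4), and C = 6 if D_K ≡ 5 (mod 8). Then h ≤ (1/(C·π)) · √|D_K| · (log|D_K| + 4.2). -/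
open NumberField Real

lemma summable_gauss {a : ℝ} (ha : 0 < a) : Summable (fun n : ℤ => rexp (-(a * (n:ℝ)^2))) := by
  have h : Summable (fun n : ℕ => rexp (-(a * (n:ℝ)^2))) := by
    have := Real.summable_exp_nat_mul_of_ge (c := -a) (by linarith) (f := fun n => (n:ℝ)^2)
      (fun i => by
        rcases Nat.eq_zero_or_pos i with h | h
        · simp [h]
        · have : (1:ℝ) ≤ i := by exact_mod_cast h
          nlinarith)
    refine this.congr fun n => ?_
    congr 1; ring
  refine Summable.of_nat_of_neg ?_ ?_ <;> simpa using h

lemma summable_gauss2 {a b : ℝ} (ha : 0 < a) (hb : 0 < b) :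
    Summable (fun p : ℤ × ℤ => rexp (-(a * (p.1:ℝ)^2 + b * (p.2:ℝ)^2))) := by
  have := (summable_gauss ha).mul_of_nonneg (summable_gauss hb)
    (fun _ => (exp_pos _).le) (fun _ => (exp_pos _).le)
  refine this.congr fun p => ?_
  rw [← Real.exp_add]; congr 1; ring

lemma summable_form {A B C s : ℝ} (hA : 0 < A) (hC : 0 < C) (hΔ : 0 < 4*A*C - B^2) (hs : 0 < s) :
    Summable (fun p : ℤ × ℤ => rexp (-(s * (A * (p.1:ℝ)^2 + B * p.1 * p.2 + C * (p.2:ℝ)^2)))) := by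
  refine Summable.of_nonneg_of_le (fun _ => (exp_pos _).le) (fun p => ?_)
    (summable_gauss2 (a := s * ((4*A*C - B^2) / (8 * C))) (b := s * ((4*A*C - B^2) / (8 * A)))
      (by positivity) (by positivity))
  apply Real.exp_le_exp.mpr
  have h1 : (4*A*C - B^2) / (8 * C) * (p.1:ℝ)^2 ≤
      (A * (p.1:ℝ)^2 + B * p.1 * p.2 + C * (p.2:ℝ)^2) / 2 := by
    rw [div_mul_eq_mul_div, div_le_iff₀ (by positivity)]
    nlinarith [sq_nonneg (2 * C * (p.2:ℝ) + B * p.1)]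
  have h2 : (4*A*C - B^2) / (8 * A) * (p.2:ℝ)^2 ≤
      (A * (p.1:ℝ)^2 + B * p.1 * p.2 + C * (p.2:ℝ)^2) / 2 := by
    rw [div_mul_eq_mul_div, div_le_iff₀ (by positivity)]
    nlinarith [sq_nonneg (2 * A * (p.1:ℝ) + B * p.2)]
  nlinarith

/-- The auxiliary double series appearing after one Poisson summation. -/
noncomputable def auxF (κ β t : ℝ) (p : ℤ × ℤ) : ℂ :=
  Complex.exp (-π * κ * ((p.1:ℂ)^2 / t + t * (p.2:ℂ)^2) + π * Complex.I * β * p.1 * p.2)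

lemma summable_auxF {κ β t : ℝ} (hκ : 0 < κ) (ht : 0 < t) : Summable (auxF κ β t) := by
  apply Summable.of_norm
  refine (summable_gauss2 (a := π * κ / t) (b := π * κ * t) (by positivity) (by positivity)).congr
    fun p => ?_
  rw [auxF, Complex.norm_exp]
  congr 1
  have : (-π * κ * ((p.1:ℂ)^2 / t + t * (p.2:ℂ)^2) + π * Complex.I * β * p.1 * p.2) =
    ((-(π * κ / t * (p.1:ℝ)^2 + π * κ * t * (p.2:ℝ)^2) : ℝ) : ℂ) +
      ((π * β * p.1 * p.2 : ℝ) : ℂ) * Complex.I := by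
    push_cast; ring
  rw [this, Complex.add_re, Complex.ofReal_re, Complex.re_ofReal_mul, Complex.I_re]; ring

lemma theta_aux {A B C t : ℝ} (hA : 0 < A) (hC : 0 < C) (hΔ : 0 < 4*A*C - B^2) (ht : 0 < t) :
    ((∑' p : ℤ × ℤ, rexp (-(2 * π * t / √(4*A*C - B^2) *
      (A * (p.1:ℝ)^2 + B * p.1 * p.2 + C * (p.2:ℝ)^2))) : ℝ) : ℂ) =
    ((1 / √(t / (√(4*A*C - B^2) / (2 * A))) : ℝ) : ℂ) *
      ∑' p, auxF (√(4*A*C - B^2) / (2 * A)) (B / A) t p := by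
  set Δ := 4*A*C - B^2 with hΔd
  set κ := √Δ / (2 * A) with hκd
  have hsΔ : 0 < √Δ := Real.sqrt_pos.mpr hΔ
  have hκ : 0 < κ := by positivity
  have hs := summable_form hA hC hΔ (s := 2 * π * t / √Δ) (by positivity)
  rw [Complex.ofReal_tsum]
  have hs' := Complex.ofRealCLM.summable hs
  simp only [Complex.ofRealCLM_apply] at hs'
  rw [← (Equiv.prodComm ℤ ℤ).tsum_eq, ← (Equiv.prodComm ℤ ℤ).tsum_eq (auxF κ (B / A) t)]
  simp only [Equiv.prodComm_apply]
  rw [Summable.tsum_prod hs'.prod_symm, Summable.tsum_prod (summable_auxF hκ ht).prod_symm,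
    ← tsum_mul_left]
  refine tsum_congr fun y => ?_
  have hAc : (A : ℂ) ≠ 0 := by exact_mod_cast hA.ne'
  have htc : (t : ℂ) ≠ 0 := by exact_mod_cast ht.ne'
  have hΔc : ((√Δ : ℝ) : ℂ) ≠ 0 := by exact_mod_cast hsΔ.ne'
  have hsq : ((√Δ : ℝ) : ℂ) ^ 2 = 4 * A * C - B ^ 2 := by
    rw [← Complex.ofReal_pow, Real.sq_sqrt hΔ.le, hΔd]; push_cast; ring
  have key := Complex.tsum_exp_neg_quadratic (a := ((t / κ : ℝ) : ℂ))
    (by rw [Complex.ofReal_re]; positivity) (-(t / √Δ * B * y : ℝ))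
  have e1 : ∀ x : ℤ, ((rexp (-(2 * π * t / √Δ * (A * (x:ℝ)^2 + B * x * y + C * (y:ℝ)^2))) : ℝ) : ℂ)
      = Complex.exp (-(2 * π * t / √Δ * (C * (y:ℝ)^2)) : ℝ) *
        Complex.exp (-π * ((t / κ : ℝ) : ℂ) * (x:ℂ) ^ 2 + 2 * π * (-(t / √Δ * B * y : ℝ)) * x) := by
    intro x
    rw [← Complex.exp_add, Complex.ofReal_exp]
    congr 1
    rw [hκd]; push_cast
    field_simp
    ring
  have e2 : ∀ m : ℤ, auxF κ (B / A) t (m, y) = Complex.exp (-(2 * π * t / √Δ * (C * (y:ℝ)^2)) : ℝ) *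
      Complex.exp (-π / ((t / κ : ℝ) : ℂ) * (m + Complex.I * (-(t / √Δ * B * y : ℝ))) ^ 2) := by
    intro m
    rw [← Complex.exp_add, auxF]
    congr 1
    rw [hκd]; push_cast
    field_simp
    linear_combination (-(t:ℂ)^2 * y^2) * hsq + ((t:ℂ)^2 * y^2 * B^2) * Complex.I_sq
  simp only [Prod.swap]
  simp only [e1, e2, tsum_mul_left]
  rw [key]
  have : (((t / κ : ℝ) : ℂ) ^ (1 / 2 : ℂ)) = ((√(t / κ) : ℝ) : ℂ) := by
    rw [Real.sqrt_eq_rpow, Complex.ofReal_cpow (by positivity)]; norm_num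
  rw [this]
  push_cast
  ring

/-- The self-duality of the theta series of a positive definite binary quadratic form. -/
lemma theta_inv {A B C t : ℝ} (hA : 0 < A) (hC : 0 < C) (hΔ : 0 < 4*A*C - B^2) (ht : 0 < t) :
    (∑' p : ℤ × ℤ, rexp (-(2 * π * t⁻¹ / √(4*A*C - B^2) *
      (A * (p.1:ℝ)^2 + B * p.1 * p.2 + C * (p.2:ℝ)^2)))) =
    t * (∑' p : ℤ × ℤ, rexp (-(2 * π * t / √(4*A*C - B^2) *
      (A * (p.1:ℝ)^2 + B * p.1 * p.2 + C * (p.2:ℝ)^2)))) := by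
  apply Complex.ofReal_injective
  rw [Complex.ofReal_mul, theta_aux hA hC hΔ ht, theta_aux hA hC hΔ (inv_pos.mpr ht)]
  set Δ := 4*A*C - B^2 with hΔd
  set κ := √Δ / (2 * A) with hκd
  have hsΔ : 0 < √Δ := Real.sqrt_pos.mpr hΔ
  have hκ : 0 < κ := by positivity
  rw [← (Equiv.prodComm ℤ ℤ).tsum_eq (auxF κ (B / A) t⁻¹)]
  have : ∀ p, auxF κ (B / A) t⁻¹ (Equiv.prodComm ℤ ℤ p) = auxF κ (B / A) t p := by
    intro p
    simp only [auxF, Equiv.prodComm_apply, Prod.fst_swap, Prod.snd_swap]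
    congr 1; push_cast; field_simp; ring
  simp only [this]
  rw [← mul_assoc, ← Complex.ofReal_mul]
  congr 2
  rw [Real.sqrt_div ht.le, Real.sqrt_div (by positivity), Real.sqrt_inv]
  have := Real.sq_sqrt ht.le
  have h2 : 0 < √t := Real.sqrt_pos.mpr ht
  field_simp
  exact this

section Emb
variable {K : Type*} [Field K] [NumberField K]

lemma exists_emb (hdeg : Module.finrank ℚ K = 2) (hneg : NumberField.discr K < 0) :
    ∃ σ : K →+* ℂ, (∀ x : K, ((Algebra.trace ℚ K x : ℚ) : ℂ) = σ x + starRingEnd ℂ (σ x)) ∧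
      (∀ x : K, ((Algebra.norm ℚ x : ℚ) : ℂ) = σ x * starRingEnd ℂ (σ x)) := by
  classical
  have hs := sign_discr K
  have hpos : 0 < InfinitePlace.nrComplexPlaces K := by
    by_contra h
    have h0 : InfinitePlace.nrComplexPlaces K = 0 := by omega
    rw [h0, pow_zero, Int.sign_eq_neg_one_of_neg hneg] at hs
    omega
  obtain ⟨w, hw⟩ := Fintype.card_pos_iff.mp hpos
  rw [InfinitePlace.isComplex_iff] at hw
  let σ : K →+* ℂ := w.embedding
  let τ : K →+* ℂ := ComplexEmbedding.conjugate σ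
  have hne : σ ≠ τ := fun h => hw (by rw [ComplexEmbedding.isReal_iff]; exact h.symm)
  let f : (K →+* ℂ) ≃ (K →ₐ[ℚ] ℂ) := RingHom.equivRatAlgHom K ℂ
  have huniv : (Finset.univ : Finset (K →ₐ[ℚ] ℂ)) = {f σ, f τ} := by
    symm
    apply Finset.eq_univ_of_card
    rw [Finset.card_pair (fun h => hne (f.injective h)), AlgHom.card, hdeg]
  refine ⟨σ, fun x => ?_, fun x => ?_⟩
  · have := trace_eq_sum_embeddings (K := ℚ) (L := K) ℂ (x := x)
    rw [huniv, Finset.sum_pair (fun h => hne (f.injective h))] at this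
    simpa [f, τ] using this
  · have := Algebra.norm_eq_prod_embeddings ℚ ℂ x
    rw [huniv, Finset.prod_pair (fun h => hne (f.injective h))] at this
    simpa [f, τ] using this

lemma norm_int {σ : K →+* ℂ}
    (hN : ∀ x : K, ((Algebra.norm ℚ x : ℚ) : ℂ) = σ x * starRingEnd ℂ (σ x)) (x : 𝓞 K) :
    ((Algebra.norm ℤ x : ℤ) : ℝ) = Complex.normSq (σ x) := by
  have h := hN x
  rw [Complex.mul_conj, ← Algebra.coe_norm_int] at h
  exact_mod_cast h

lemma trace_int {σ : K →+* ℂ}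
    (hT : ∀ x : K, ((Algebra.trace ℚ K x : ℚ) : ℂ) = σ x + starRingEnd ℂ (σ x)) (x : 𝓞 K) :
    ((Algebra.trace ℤ (𝓞 K) x : ℤ) : ℝ) = 2 * (σ x).re := by
  have h := hT x
  rw [Complex.add_conj, ← Algebra.coe_trace_int] at h
  exact_mod_cast h

lemma discr_im {σ : K →+* ℂ}
    (hT : ∀ x : K, ((Algebra.trace ℚ K x : ℚ) : ℂ) = σ x + starRingEnd ℂ (σ x))
    (b : Module.Basis (Fin 2) ℤ (𝓞 K)) :
    (discr K : ℝ) = - 4 * ((σ (b 0)).im * (σ (b 1)).re - (σ (b 0)).re * (σ (b 1)).im)^2 := by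
  rw [← discr_eq_discr K b, Algebra.discr_def, Matrix.det_fin_two]
  simp only [Algebra.traceMatrix_apply, Algebra.traceForm_apply]
  push_cast
  simp only [trace_int hT]
  simp only [map_mul, Complex.mul_re]
  ring

lemma finrank_int (hdeg : Module.finrank ℚ K = 2) : Module.finrank ℤ (𝓞 K) = 2 := by
  rw [RingOfIntegers.rank, hdeg]

/-- An integral basis indexed by `Fin 2`. -/
lemma exists_basis (hdeg : Module.finrank ℚ K = 2) : Nonempty (Module.Basis (Fin 2) ℤ (𝓞 K)) :=
  ⟨Module.finBasisOfFinrankEq ℤ (𝓞 K) (finrank_int hdeg)⟩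

/-- The theta identity for an ideal lattice. -/
lemma ideal_form (hdeg : Module.finrank ℚ K = 2) (hneg : NumberField.discr K < 0)
    (J : Ideal (𝓞 K)) (hJ : J ≠ ⊥) :
    ∃ (e : J ≃ ℤ × ℤ) (A B C : ℝ), 0 < A ∧ 0 < C ∧
      4 * A * C - B^2 = (Ideal.absNorm J : ℝ)^2 * |(discr K : ℝ)| ∧
      ∀ α : J, ((Ideal.absNorm (Ideal.span {(α : 𝓞 K)}) : ℕ) : ℝ) =
        A * ((e α).1:ℝ)^2 + B * (e α).1 * (e α).2 + C * ((e α).2:ℝ)^2 := by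
  obtain ⟨σ, hT, hN⟩ := exists_emb hdeg hneg
  obtain ⟨b⟩ := exists_basis hdeg
  let bJ : Module.Basis (Fin 2) ℤ J := J.selfBasis b hJ
  have hdet := Ideal.natAbs_det_basis_change b J bJ
  have hD := discr_im hT b
  set u := σ (bJ 0 : 𝓞 K) with hu
  set v := σ (bJ 1 : 𝓞 K) with hv
  let e : J ≃ ℤ × ℤ := bJ.equivFun.toEquiv.trans (finTwoArrowEquiv ℤ)
  have him : u.im * v.re - u.re * v.im = (b.det ((↑) ∘ bJ) : ℤ) *
      ((σ (b 0)).im * (σ (b 1)).re - (σ (b 0)).re * (σ (b 1)).im) := by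
    have h0 := b.sum_repr (bJ 0 : 𝓞 K)
    have h1 := b.sum_repr (bJ 1 : 𝓞 K)
    rw [Fin.sum_univ_two] at h0 h1
    rw [hu, hv, ← h0, ← h1, Module.Basis.det_apply, Matrix.det_fin_two]
    simp only [Module.Basis.toMatrix_apply, Function.comp, zsmul_eq_mul, map_add, map_mul, map_intCast,
      Complex.add_re, Complex.add_im, Complex.mul_re, Complex.mul_im, Complex.intCast_re,
      Complex.intCast_im]
    push_cast
    ring
  have hDis : 4 * Complex.normSq u * Complex.normSq v - (2 * (u.re * v.re + u.im * v.im))^2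
      = (Ideal.absNorm J : ℝ)^2 * |(discr K : ℝ)| := by
    have h1 : (Ideal.absNorm J : ℝ)^2 = ((b.det ((↑) ∘ bJ) : ℤ) : ℝ)^2 := by
      rw [← hdet, Nat.cast_natAbs, Int.cast_abs, sq_abs]
    have hneg' : (discr K : ℝ) < 0 := by exact_mod_cast hneg
    rw [h1, abs_of_neg hneg', hD, Complex.normSq_apply, Complex.normSq_apply]
    have : 4 * (_ : ℝ)^2 = 4 * (_ : ℝ)^2 := congrArg (fun x => 4 * x^2) him
    linear_combination this
  have hu0 : u ≠ 0 := by
    rw [hu]; simpa using bJ.ne_zero 0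
  have hv0 : v ≠ 0 := by
    rw [hv]; simpa using bJ.ne_zero 1
  refine ⟨e, Complex.normSq u, 2 * (u.re * v.re + u.im * v.im), Complex.normSq v,
    Complex.normSq_pos.mpr hu0, Complex.normSq_pos.mpr hv0, hDis, fun α => ?_⟩
  have hn : ((Ideal.absNorm (Ideal.span {(α : 𝓞 K)}) : ℕ) : ℝ) = Complex.normSq (σ (α : 𝓞 K)) := by
    rw [Ideal.absNorm_span_singleton, ← norm_int hN, Nat.cast_natAbs, Int.cast_abs, abs_of_nonneg]
    rw [norm_int hN]; exact Complex.normSq_nonneg _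
  have hα : σ (α : 𝓞 K) = (e α).1 * u + (e α).2 * v := by
    have h0 := bJ.sum_repr α
    rw [Fin.sum_univ_two] at h0
    rw [← h0]
    simp [e, hu, hv]
  rw [hn, hα]
  simp only [Complex.normSq_apply, Complex.add_re, Complex.add_im, Complex.mul_re, Complex.mul_im,
    Complex.intCast_re, Complex.intCast_im]
  ring

/-- Units are `±1` once the discriminant is below `-4`. -/
lemma unit_eq (hdeg : Module.finrank ℚ K = 2) (hneg : NumberField.discr K < -4) (u : (𝓞 K)ˣ) :
    u = 1 ∨ u = -1 := by
  obtain ⟨σ, hT, hN⟩ := exists_emb hdeg (by omega)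
  obtain ⟨b⟩ := exists_basis hdeg
  have hD := discr_im hT b
  have hn : Complex.normSq (σ (u : 𝓞 K)) = 1 := by
    rw [← norm_int hN]
    have h1 : IsUnit (Algebra.norm ℤ (u : 𝓞 K)) := u.isUnit.map _
    have h2 : (0:ℝ) ≤ (Algebra.norm ℤ (u : 𝓞 K) : ℤ) := by
      rw [norm_int hN]; exact Complex.normSq_nonneg _
    rcases Int.isUnit_iff.mp h1 with h | h <;> rw [h] at h2 ⊢ <;> norm_num at *
  have h0 := b.sum_repr (u : 𝓞 K)
  have h1 := b.sum_repr (1 : 𝓞 K)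
  rw [Fin.sum_univ_two] at h0 h1
  have h0' := congrArg (fun x : 𝓞 K => σ x) h0
  have h1' := congrArg (fun x : 𝓞 K => σ x) h1
  simp only [zsmul_eq_mul, map_add, map_mul, map_intCast, map_one] at h0' h1'
  set p := b.repr (u : 𝓞 K) 0
  set q := b.repr (u : 𝓞 K) 1
  set r := b.repr (1 : 𝓞 K) 0
  set s := b.repr (1 : 𝓞 K) 1
  have him : (σ (u : 𝓞 K)).im = ((p * s - q * r : ℤ) : ℝ) *
     ((σ (b 0)).im * (σ (b 1)).re - (σ (b 0)).re * (σ (b 1)).im) := by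
    have a1 := congrArg Complex.re h0'
    have a2 := congrArg Complex.im h0'
    have a3 := congrArg Complex.re h1'
    have a4 := congrArg Complex.im h1'
    simp at a1 a2 a3 a4
    push_cast
    linear_combination -(σ (u : 𝓞 K)).im * a3 + (σ (u : 𝓞 K)).re * a4
      - a2 * (r * (σ (b 0)).re + s * (σ (b 1)).re) + a1 * (r * (σ (b 0)).im + s * (σ (b 1)).im)
  have hDl : (discr K : ℝ) ≤ -5 := by exact_mod_cast (by omega : discr K ≤ -5)
  have hk : p * s - q * r = 0 := by
    by_contra hk
    have : (1:ℝ) ≤ ((p * s - q * r : ℤ) : ℝ)^2 := by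
      have := Int.one_le_abs hk
      have h2 : (1:ℤ) ≤ (p * s - q * r)^2 := by rw [← sq_abs]; nlinarith
      exact_mod_cast h2
    have h3 : (σ (u : 𝓞 K)).im ^ 2 ≤ 1 := by
      rw [← hn, Complex.normSq_apply]; nlinarith [sq_nonneg (σ (u : 𝓞 K)).re]
    rw [him, mul_pow] at h3
    nlinarith
  rw [hk, Int.cast_zero, zero_mul] at him
  have hre : (σ (u : 𝓞 K)).re = 1 ∨ (σ (u : 𝓞 K)).re = -1 := by
    rw [Complex.normSq_apply, him] at hn
    have : ((σ (u : 𝓞 K)).re - 1) * ((σ (u : 𝓞 K)).re + 1) = 0 := by linarith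
    rcases mul_eq_zero.mp this with h | h
    · left; linarith
    · right; linarith
  have hinj : Function.Injective (fun x : 𝓞 K => σ (x : K)) :=
    σ.injective.comp RingOfIntegers.coe_injective
  rcases hre with h | h
  · left
    apply Units.ext
    apply hinj
    apply Complex.ext <;> simp [h, him]
  · right
    apply Units.ext
    apply hinj
    apply Complex.ext <;> simp [h, him]
end Emb

section ClassSum
open nonZeroDivisors
variable {K : Type*} [Field K] [NumberField K]

lemma theta_ideal (hdeg : Module.finrank ℚ K = 2) (hneg : NumberField.discr K < 0)
    (J : Ideal (𝓞 K)) (hJ : J ≠ ⊥) :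
    (∀ c : ℝ, 0 < c → Summable (fun α : J =>
      rexp (-(c * ((Ideal.absNorm (Ideal.span {(α : 𝓞 K)}) : ℝ) / Ideal.absNorm J))))) ∧
    (∀ t : ℝ, 0 < t →
      ∑' α : J, rexp (-(2 * π * t⁻¹ / √|(discr K : ℝ)| *
        ((Ideal.absNorm (Ideal.span {(α : 𝓞 K)}) : ℝ) / Ideal.absNorm J))) =
      t * ∑' α : J, rexp (-(2 * π * t / √|(discr K : ℝ)| *
        ((Ideal.absNorm (Ideal.span {(α : 𝓞 K)}) : ℝ) / Ideal.absNorm J)))) := by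
  obtain ⟨e, A, B, C, hA, hC, hΔ, hQ⟩ := ideal_form hdeg hneg J hJ
  have hNJ : (0:ℝ) < Ideal.absNorm J := by
    have : Ideal.absNorm J ≠ 0 := fun h => hJ (Ideal.absNorm_eq_zero_iff.mp h)
    exact_mod_cast Nat.pos_of_ne_zero this
  have hD : (0:ℝ) < |(discr K : ℝ)| := by
    rw [abs_pos]; exact_mod_cast hneg.ne
  have hΔ0 : 0 < 4 * A * C - B^2 := by rw [hΔ]; positivity
  have hsq : √(4 * A * C - B^2) = Ideal.absNorm J * √|(discr K : ℝ)| := by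
    rw [hΔ, Real.sqrt_mul (by positivity), Real.sqrt_sq hNJ.le]
  constructor
  · intro c hc
    have := summable_form hA hC hΔ0 (s := c / Ideal.absNorm J) (by positivity)
    rw [← e.summable_iff] at this
    refine this.congr fun α => ?_
    simp only [Function.comp]
    rw [hQ]; congr 1; ring
  · intro t ht
    have := theta_inv hA hC hΔ0 ht
    rw [← e.tsum_eq, ← e.tsum_eq (fun p : ℤ × ℤ => rexp (-(2 * π * t / √(4*A*C - B^2) *
      (A * (p.1:ℝ)^2 + B * p.1 * p.2 + C * (p.2:ℝ)^2)))), hsq] at this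
    have h2 : 0 < √|(discr K : ℝ)| := Real.sqrt_pos.mpr hD
    convert this using 4 with α _ α
    · rw [hQ]; field_simp
    · rw [hQ]; field_simp

lemma class_equiv (hdeg : Module.finrank ℚ K = 2) (hneg : NumberField.discr K < -4)
    (C : ClassGroup (𝓞 K)) (J : Ideal (𝓞 K)) (hJ0 : J ∈ (Ideal (𝓞 K))⁰)
    (hJ : ClassGroup.mk0 ⟨J, hJ0⟩ = C⁻¹) :
    ∃ f : ({I : (Ideal (𝓞 K))⁰ // ClassGroup.mk0 I = C} × Bool) ≃ {α : J // α ≠ 0},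
      ∀ p, Ideal.span {((f p : J) : 𝓞 K)} = (p.1.1 : Ideal (𝓞 K)) * J := by
  have hex : ∀ I : {I : (Ideal (𝓞 K))⁰ // ClassGroup.mk0 I = C},
      ∃ g : 𝓞 K, Ideal.span {g} = (I.1 : Ideal (𝓞 K)) * J := by
    intro I
    have h1 : ClassGroup.mk0 (I.1 * (⟨J, hJ0⟩ : (Ideal (𝓞 K))⁰)) = C * C⁻¹ := by
      rw [map_mul, I.2, hJ]
    have h1' : C * C⁻¹ = 1 := mul_inv_cancel C
    rw [h1'] at h1
    have h2 : ((I.1 : Ideal (𝓞 K)) * J).IsPrincipal :=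
      (ClassGroup.mk0_eq_one_iff (mul_mem I.1.2 hJ0)).mp h1
    obtain ⟨x, hx⟩ := h2
    exact ⟨x, hx.symm⟩
  choose g hg using hex
  have hne : ∀ I, g I ≠ 0 := by
    intro I h
    have := hg I
    rw [h, Ideal.span_singleton_zero, eq_comm, Ideal.mul_eq_bot] at this
    rcases this with h1 | h1
    · exact nonZeroDivisors.coe_ne_zero I.1 h1
    · exact nonZeroDivisors.ne_zero hJ0 h1
  have hmem : ∀ I, g I ∈ J := by
    intro I
    have : g I ∈ Ideal.span {g I} := Ideal.mem_span_singleton_self _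
    rw [hg I] at this
    exact (Ideal.mul_le_right : (I.1 : Ideal (𝓞 K)) * J ≤ J) this
  have hFex : ∀ p : ({I : (Ideal (𝓞 K))⁰ // ClassGroup.mk0 I = C} × Bool),
      ∃ a : {α : J // α ≠ 0}, ((a : J) : 𝓞 K) = if p.2 then g p.1 else - g p.1 := by
    rintro ⟨I, b⟩
    cases b
    · exact ⟨⟨⟨-g I, neg_mem (hmem I)⟩, fun h => hne I (neg_eq_zero.mp (congrArg Subtype.val h))⟩, by simp⟩
    · exact ⟨⟨⟨g I, hmem I⟩, fun h => hne I (congrArg Subtype.val h)⟩, by simp⟩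
  choose F hFv using hFex
  have hFs : ∀ p, Ideal.span {((F p : J) : 𝓞 K)} = (p.1.1 : Ideal (𝓞 K)) * J := by
    rintro ⟨I, b⟩
    rw [hFv]
    cases b
    · simp [Ideal.span_singleton_neg, hg]
    · simp [hg]
  have hbij : Function.Bijective F := by
    constructor
    · rintro ⟨I, b⟩ ⟨I', b'⟩ h
      have h1 := hFs (I, b)
      rw [h, hFs] at h1
      have hI : I = I' := by
        have h2 : (I'.1 : Ideal (𝓞 K)) = I.1 := mul_right_cancel₀ (nonZeroDivisors.ne_zero hJ0) h1
        exact Subtype.ext (Subtype.ext h2.symm)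
      subst hI
      have h3 := hFv (I, b)
      rw [h, hFv] at h3
      have hself : g I ≠ - g I := fun h => hne I (self_eq_neg.mp h)
      cases b <;> cases b'
      · rfl
      · exact absurd h3 (by simpa using hself)
      · exact absurd h3.symm (by simpa using hself)
      · rfl
    · rintro ⟨α, hα⟩
      have hα0 : (α : 𝓞 K) ≠ 0 := fun h => hα (Subtype.ext h)
      have hdvd : J ∣ Ideal.span {(α : 𝓞 K)} := by
        rw [Ideal.dvd_span_singleton]; exact α.2
      obtain ⟨I, hI⟩ := hdvd
      have hI0 : I ∈ (Ideal (𝓞 K))⁰ := by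
        rw [mem_nonZeroDivisors_iff_ne_zero]
        rintro rfl
        rw [mul_zero, Ideal.zero_eq_bot, Ideal.span_singleton_eq_bot] at hI
        exact hα0 hI
      have hIC : ClassGroup.mk0 ⟨I, hI0⟩ = C := by
        have : ClassGroup.mk0 (⟨J, hJ0⟩ * ⟨I, hI0⟩) = 1 := by
          refine (ClassGroup.mk0_eq_one_iff (mul_mem hJ0 hI0)).mpr ?_
          rw [← hI]
          exact ⟨α, rfl⟩
        rw [map_mul, hJ, inv_mul_eq_one] at this
        exact this.symm
      let I' : {I : (Ideal (𝓞 K))⁰ // ClassGroup.mk0 I = C} := ⟨⟨I, hI0⟩, hIC⟩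
      have hass : Associated (g I') (α : 𝓞 K) := by
        rw [← Ideal.span_singleton_eq_span_singleton, hg, hI, mul_comm]
      obtain ⟨u, hu⟩ := hass
      rcases unit_eq hdeg hneg u with h | h
      · refine ⟨(I', true), Subtype.ext (Subtype.ext ?_)⟩
        rw [hFv]; simp [← hu, h]
      · refine ⟨(I', false), Subtype.ext (Subtype.ext ?_)⟩
        rw [hFv]; simp [← hu, h]
  exact ⟨Equiv.ofBijective F hbij, hFs⟩

lemma class_sum (hdeg : Module.finrank ℚ K = 2) (hneg : NumberField.discr K < -4)
    (C : ClassGroup (𝓞 K)) (J : Ideal (𝓞 K)) (hJ0 : J ∈ (Ideal (𝓞 K))⁰)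
    (hJ : ClassGroup.mk0 ⟨J, hJ0⟩ = C⁻¹) {c : ℝ} (hc : 0 < c) :
    Summable (fun I : {I : (Ideal (𝓞 K))⁰ // ClassGroup.mk0 I = C} =>
      rexp (-(c * (Ideal.absNorm (I.1 : Ideal (𝓞 K)) : ℝ)))) ∧
    ∑' α : J, rexp (-(c * ((Ideal.absNorm (Ideal.span {(α : 𝓞 K)}) : ℝ) /
        Ideal.absNorm J))) =
      1 + 2 * ∑' I : {I : (Ideal (𝓞 K))⁰ // ClassGroup.mk0 I = C},
        rexp (-(c * (Ideal.absNorm (I.1 : Ideal (𝓞 K)) : ℝ))) := by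
  obtain ⟨f, hf⟩ := class_equiv hdeg hneg C J hJ0 hJ
  have hJb : J ≠ ⊥ := nonZeroDivisors.ne_zero hJ0
  have hNJ : (0:ℝ) < Ideal.absNorm J := by
    exact_mod_cast Ideal.absNorm_pos_of_nonZeroDivisors ⟨J, hJ0⟩
  have hs := (theta_ideal hdeg (by omega) J hJb).1 c hc
  set G : J → ℝ := fun α => rexp (-(c * ((Ideal.absNorm (Ideal.span {(α : 𝓞 K)}) : ℝ) /
        Ideal.absNorm J))) with hG
  have hGf : ∀ p, G (f p) = rexp (-(c * (Ideal.absNorm (p.1.1 : Ideal (𝓞 K)) : ℝ))) := by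
    intro p
    rw [hG]; simp only
    rw [hf, map_mul]; push_cast
    congr 3
    field_simp
  have hs1 : Summable (fun α : {α : J // α ≠ 0} => G α) := hs.subtype _
  have hs2 : Summable (fun p => G (f p)) := hs1.comp_injective f.injective
  simp only [hGf] at hs2
  have hs3 : Summable (fun I : {I : (Ideal (𝓞 K))⁰ // ClassGroup.mk0 I = C} =>
      rexp (-(c * (Ideal.absNorm (I.1 : Ideal (𝓞 K)) : ℝ)))) :=
    hs2.comp_injective (i := fun I => (I, true)) (fun a b h => by simpa using h)
  refine ⟨hs3, ?_⟩
  have h1 : ∑' α, G α = G 0 + ∑' α : {α : J // α ≠ 0}, G α := by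
    have := hs.sum_add_tsum_subtype_compl {0}
    rw [← this]
    simp only [Finset.sum_singleton]
    congr 1
    exact (Equiv.subtypeEquivRight (fun x => by simp)).tsum_eq (fun α : {α : J // α ≠ 0} => G α)
  rw [h1, ← f.tsum_eq]
  congr 1
  · simp [hG]
  · simp only [hGf]
    rw [Summable.tsum_prod hs2, ← tsum_mul_left]
    refine tsum_congr fun I => ?_
    rw [tsum_bool]; ring

lemma total_sum (hdeg : Module.finrank ℚ K = 2) (hneg : NumberField.discr K < -4) :
    (∀ c : ℝ, 0 < c → Summable (fun I : (Ideal (𝓞 K))⁰ =>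
      rexp (-(c * (Ideal.absNorm (I : Ideal (𝓞 K)) : ℝ))))) ∧
    ∀ y : ℝ, y = 2 * π / √|(discr K : ℝ)| →
      (classNumber K : ℝ) = 2 * ∑' I : (Ideal (𝓞 K))⁰,
          rexp (-(y / 2 * (Ideal.absNorm (I : Ideal (𝓞 K)) : ℝ)))
        - 4 * ∑' I : (Ideal (𝓞 K))⁰,
          rexp (-(2 * y * (Ideal.absNorm (I : Ideal (𝓞 K)) : ℝ))) := by
  classical
  have hJ : ∀ C : ClassGroup (𝓞 K), ∃ J : (Ideal (𝓞 K))⁰, ClassGroup.mk0 J = C⁻¹ :=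
    fun C => ClassGroup.mk0_surjective _
  choose J hJ using hJ
  have hsum : ∀ c : ℝ, 0 < c → Summable (fun I : (Ideal (𝓞 K))⁰ =>
      rexp (-(c * (Ideal.absNorm (I : Ideal (𝓞 K)) : ℝ)))) := by
    intro c hc
    rw [← (Equiv.sigmaFiberEquiv (fun I : (Ideal (𝓞 K))⁰ => ClassGroup.mk0 I)).summable_iff]
    refine (summable_sigma_of_nonneg (fun _ => (exp_pos _).le)).mpr ⟨fun C => (class_sum hdeg hneg C (J C) (J C).2 (hJ C) hc).1, ?_⟩
    exact (hasSum_fintype _).summable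
  have htot : ∀ c : ℝ, 0 < c → ∑ C : ClassGroup (𝓞 K), ∑' α : (J C : Ideal (𝓞 K)),
      rexp (-(c * ((Ideal.absNorm (Ideal.span {(α : 𝓞 K)}) : ℝ) /
        Ideal.absNorm (J C : Ideal (𝓞 K))))) = (classNumber K : ℝ) +
      2 * ∑' I : (Ideal (𝓞 K))⁰, rexp (-(c * (Ideal.absNorm (I : Ideal (𝓞 K)) : ℝ))) := by
    intro c hc
    have hs := (Equiv.sigmaFiberEquiv (fun I : (Ideal (𝓞 K))⁰ => ClassGroup.mk0 I)).summable_iff.mpr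
      (hsum c hc)
    have hs2 := hs.tsum_sigma
    simp only [Function.comp] at hs2
    rw [← (Equiv.sigmaFiberEquiv (fun I : (Ideal (𝓞 K))⁰ => ClassGroup.mk0 I)).tsum_eq, hs2,
      tsum_fintype,
      Finset.mul_sum, classNumber, ← Finset.card_univ, Finset.card_eq_sum_ones, Nat.cast_sum,
      ← Finset.sum_add_distrib]
    refine Finset.sum_congr rfl fun C _ => ?_
    rw [(class_sum hdeg hneg C (J C) (J C).2 (hJ C) hc).2]
    simp
  refine ⟨hsum, fun y hy => ?_⟩
  have hD : (0:ℝ) < √|(discr K : ℝ)| := by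
    rw [Real.sqrt_pos, abs_pos]; exact_mod_cast (by omega : discr K ≠ 0)
  have hy0 : 0 < y := by rw [hy]; positivity
  have h1 := htot (y / 2) (by positivity)
  have h2 := htot (2 * y) (by positivity)
  have h3 : ∑ C : ClassGroup (𝓞 K), ∑' α : (J C : Ideal (𝓞 K)),
      rexp (-(y / 2 * ((Ideal.absNorm (Ideal.span {(α : 𝓞 K)}) : ℝ) /
        Ideal.absNorm (J C : Ideal (𝓞 K))))) = 2 * ∑ C : ClassGroup (𝓞 K), ∑' α : (J C : Ideal (𝓞 K)),
      rexp (-(2 * y * ((Ideal.absNorm (Ideal.span {(α : 𝓞 K)}) : ℝ) /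
        Ideal.absNorm (J C : Ideal (𝓞 K))))) := by
    rw [Finset.mul_sum]
    refine Finset.sum_congr rfl fun C _ => ?_
    have := (theta_ideal hdeg (by omega) (J C) (nonZeroDivisors.coe_ne_zero _)).2 2 (by norm_num)
    have e1 : 2 * π * (2:ℝ)⁻¹ / √|(discr K : ℝ)| = y / 2 := by rw [hy]; ring
    have e2 : 2 * π * (2:ℝ) / √|(discr K : ℝ)| = 2 * y := by rw [hy]; ring
    rw [e1, e2] at this
    exact this
  rw [h1, h2] at h3
  linarith
end ClassSum

section Count
variable {K : Type*} [Field K] [NumberField K]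

/-- The number of ideals of norm `n`. -/
noncomputable def idealCount (K : Type*) [Field K] [NumberField K] (n : ℕ) : ℕ :=
  Nat.card {I : Ideal (𝓞 K) // Ideal.absNorm I = n}

lemma absNorm_sup_span (hdeg : Module.finrank ℚ K = 2) (L : Ideal (𝓞 K)) {a b : ℕ}
    (hab : a.Coprime b) (hL : Ideal.absNorm L = a * b) :
    Ideal.absNorm (L ⊔ Ideal.span {(a : 𝓞 K)}) ∣ a := by
  have h1 : Ideal.absNorm (L ⊔ Ideal.span {(a : 𝓞 K)}) ∣ a ^ 2 := by
    have := Ideal.absNorm_dvd_absNorm_of_le (le_sup_right : Ideal.span {(a : 𝓞 K)} ≤ L ⊔ Ideal.span {(a : 𝓞 K)})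
    rwa [Ideal.absNorm_span_natCast, finrank_int hdeg] at this
  have h2 : Ideal.absNorm (L ⊔ Ideal.span {(a : 𝓞 K)}) ∣ a * b := by
    rw [← hL]
    exact Ideal.absNorm_dvd_absNorm_of_le le_sup_left
  have h3 : Nat.Coprime (Ideal.absNorm (L ⊔ Ideal.span {(a : 𝓞 K)})) b :=
    Nat.Coprime.coprime_dvd_left h1 (Nat.Coprime.pow_left 2 hab)
  exact h3.dvd_of_dvd_mul_right h2

lemma sup_eq_top_of_coprime (I J : Ideal (𝓞 K))
    (h : (Ideal.absNorm I).Coprime (Ideal.absNorm J)) : IsCoprime I J := by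
  rw [Ideal.isCoprime_iff_exists]
  obtain ⟨u, v, huv⟩ := (Nat.isCoprime_iff_coprime.mpr h)
  refine ⟨(u : 𝓞 K) * (Ideal.absNorm I : 𝓞 K), I.mul_mem_left _ (Ideal.absNorm_mem I),
    (v : 𝓞 K) * (Ideal.absNorm J : 𝓞 K), J.mul_mem_left _ (Ideal.absNorm_mem J), ?_⟩
  exact_mod_cast congrArg (Int.cast : ℤ → 𝓞 K) huv

lemma idealCount_mul (hdeg : Module.finrank ℚ K = 2) {a b : ℕ} (ha : a ≠ 0) (hb : b ≠ 0)
    (hab : a.Coprime b) : idealCount K (a * b) = idealCount K a * idealCount K b := by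
  unfold idealCount
  rw [← Nat.card_prod]
  symm
  refine Nat.card_congr (Equiv.ofBijective (fun p => ⟨p.1.1 * p.2.1, by
    rw [map_mul, p.1.2, p.2.2]⟩) ⟨?_, ?_⟩)
  · rintro ⟨⟨I, hI⟩, ⟨J, hJ⟩⟩ ⟨⟨I', hI'⟩, ⟨J', hJ'⟩⟩ h
    have h0 : I * J = I' * J' := congrArg Subtype.val h
    have c1 : IsCoprime I J' := sup_eq_top_of_coprime _ _ (by rw [hI, hJ']; exact hab)
    have c2 : IsCoprime I' J := sup_eq_top_of_coprime _ _ (by rw [hI', hJ]; exact hab)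
    have d1 : I ∣ I' := c1.dvd_of_dvd_mul_right (h0 ▸ dvd_mul_right I J)
    have d2 : I' ∣ I := c2.dvd_of_dvd_mul_right (h0 ▸ dvd_mul_right I' J')
    have d3 : J ∣ J' := c2.symm.dvd_of_dvd_mul_left (h0 ▸ dvd_mul_left J I)
    have d4 : J' ∣ J := c1.symm.dvd_of_dvd_mul_left (h0 ▸ dvd_mul_left J' I')
    have e1 : I = I' := le_antisymm (Ideal.le_of_dvd d2) (Ideal.le_of_dvd d1)
    have e2 : J = J' := le_antisymm (Ideal.le_of_dvd d4) (Ideal.le_of_dvd d3)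
    subst e1 e2
    rfl
  · rintro ⟨L, hL⟩
    have n1 := absNorm_sup_span hdeg L hab hL
    have n2 := absNorm_sup_span hdeg L hab.symm (by rw [hL, mul_comm])
    have hmul : (L ⊔ Ideal.span {(a : 𝓞 K)}) * (L ⊔ Ideal.span {(b : 𝓞 K)}) = L := by
      have hle : (L ⊔ Ideal.span {(a : 𝓞 K)}) * (L ⊔ Ideal.span {(b : 𝓞 K)}) ≤ L := by
        rw [Ideal.sup_mul]
        refine sup_le Ideal.mul_le_left ?_
        rw [Ideal.mul_sup]
        refine sup_le Ideal.mul_le_right ?_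
        rw [Ideal.span_singleton_mul_span_singleton, Ideal.span_singleton_le_iff_mem]
        have := Ideal.absNorm_mem L
        rw [hL] at this
        exact_mod_cast this
      refine le_antisymm hle ?_
      intro x hx
      obtain ⟨u, v, huv⟩ := (Nat.isCoprime_iff_coprime.mpr hab)
      have huv' : (u : 𝓞 K) * (a : 𝓞 K) + (v : 𝓞 K) * (b : 𝓞 K) = 1 := by
        exact_mod_cast congrArg (Int.cast : ℤ → 𝓞 K) huv
      have : x = (u : 𝓞 K) * ((a : 𝓞 K) * x) + (v : 𝓞 K) * (x * (b : 𝓞 K)) := by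
        linear_combination (-x) * huv'
      rw [this]
      refine add_mem (Ideal.mul_mem_left _ _ (Ideal.mul_mem_mul ?_ ?_))
        (Ideal.mul_mem_left _ _ (Ideal.mul_mem_mul ?_ ?_))
      · exact Ideal.mem_sup_right (Ideal.mem_span_singleton_self _)
      · exact Ideal.mem_sup_left hx
      · exact Ideal.mem_sup_left hx
      · exact Ideal.mem_sup_right (Ideal.mem_span_singleton_self _)
    have hn : Ideal.absNorm (L ⊔ Ideal.span {(a : 𝓞 K)}) * Ideal.absNorm (L ⊔ Ideal.span {(b : 𝓞 K)})
        = a * b := by rw [← map_mul, hmul, hL]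
    have l1 := Nat.le_of_dvd (Nat.pos_of_ne_zero ha) n1
    have l2 := Nat.le_of_dvd (Nat.pos_of_ne_zero hb) n2
    have ha' := Nat.pos_of_ne_zero ha
    have hb' := Nat.pos_of_ne_zero hb
    have e1 : Ideal.absNorm (L ⊔ Ideal.span {(a : 𝓞 K)}) = a := by
      by_contra hne
      have : Ideal.absNorm (L ⊔ Ideal.span {(a : 𝓞 K)}) < a := lt_of_le_of_ne l1 hne
      nlinarith
    have e2 : Ideal.absNorm (L ⊔ Ideal.span {(b : 𝓞 K)}) = b := by
      rw [e1] at hn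
      exact Nat.eq_of_mul_eq_mul_left ha' hn
    exact ⟨(⟨_, e1⟩, ⟨_, e2⟩), Subtype.ext hmul⟩

lemma idealCount_one : idealCount K 1 = 1 := by
  unfold idealCount
  rw [Nat.card_eq_one_iff_unique]
  exact ⟨⟨fun a b => Subtype.ext ((Ideal.absNorm_eq_one_iff.mp a.2).trans
    (Ideal.absNorm_eq_one_iff.mp b.2).symm)⟩, ⟨⟨⊤, by simp⟩⟩⟩

/-- An ideal of norm `p ^ (k+1)` is divisible by a prime `P` of norm `p`, or by `(p)`. -/
lemma exists_prime_factor (hdeg : Module.finrank ℚ K = 2) {p : ℕ} (hp : p.Prime) {k : ℕ}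
    (I : Ideal (𝓞 K)) (hI : Ideal.absNorm I = p ^ (k + 1)) :
    ∃ P : Ideal (𝓞 K), P ∣ I ∧ P ∣ Ideal.span {(p : 𝓞 K)} ∧
      (Ideal.absNorm P = p ∨ P = Ideal.span {(p : 𝓞 K)}) := by
  have hne : I ≠ ⊤ := by
    rintro rfl
    rw [Ideal.absNorm_top] at hI
    exact absurd hI.symm (Nat.one_lt_pow (by omega) hp.one_lt).ne'
  obtain ⟨P, hP, hIP⟩ := Ideal.exists_le_maximal I hne
  have hPI : P ∣ I := Ideal.dvd_iff_le.mpr hIP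
  have hpmem : (p : 𝓞 K) ∈ P := by
    have h1 := hIP (Ideal.absNorm_mem I)
    rw [hI] at h1
    push_cast at h1
    exact hP.isPrime.mem_of_pow_mem _ h1
  have hPp : P ∣ Ideal.span {(p : 𝓞 K)} := by rwa [Ideal.dvd_span_singleton]
  refine ⟨P, hPI, hPp, ?_⟩
  obtain ⟨Q, hQ⟩ := hPp
  have hn : p ^ 2 = Ideal.absNorm P * Ideal.absNorm Q := by
    rw [← map_mul, ← hQ, Ideal.absNorm_span_natCast, finrank_int hdeg]
  have hd : Ideal.absNorm P ∣ p ^ 2 := ⟨_, hn⟩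
  rw [Nat.dvd_prime_pow hp] at hd
  obtain ⟨m, hm, hPm⟩ := hd
  interval_cases m
  · exact absurd (Ideal.absNorm_eq_one_iff.mp (by simpa using hPm)) hP.ne_top
  · left; simpa using hPm
  · right
    have : Ideal.absNorm Q = 1 := by
      rw [hPm] at hn
      exact Nat.eq_of_mul_eq_mul_left (pow_pos hp.pos 2) (by rw [← hn, mul_one])
    rw [Ideal.absNorm_eq_one_iff] at this
    rw [hQ, this, Ideal.mul_top]

lemma idealCount_prime_pow (hdeg : Module.finrank ℚ K = 2) {p : ℕ} (hp : p.Prime) :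
    ∃ ε : ℤ, (ε = -1 ∨ ε = 0 ∨ ε = 1) ∧
      ∀ k, (idealCount K (p ^ k) : ℤ) = ∑ j ∈ Finset.range (k + 1), ε ^ j := by
  have hspan : Ideal.absNorm (Ideal.span {(p : 𝓞 K)}) = p ^ 2 := by
    rw [Ideal.absNorm_span_natCast, finrank_int hdeg]
  have hspan0 : Ideal.span {(p : 𝓞 K)} ≠ 0 := by
    intro h
    rw [h] at hspan
    simp at hspan
    exact hp.ne_zero (pow_eq_zero_iff (two_ne_zero)|>.mp hspan.symm)
  by_cases hex : ∃ P : Ideal (𝓞 K), Ideal.absNorm P = p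
  · obtain ⟨P, hP⟩ := hex
    have hPd : P ∣ Ideal.span {(p : 𝓞 K)} := by
      rw [Ideal.dvd_span_singleton]
      have := Ideal.absNorm_mem P
      rwa [hP] at this
    obtain ⟨Q, hQ⟩ := hPd
    have hQn : Ideal.absNorm Q = p := by
      have h := congrArg Ideal.absNorm hQ
      rw [map_mul, hspan, hP, sq] at h
      exact (Nat.eq_of_mul_eq_mul_left hp.pos h).symm
    have hprime : ∀ R : Ideal (𝓞 K), Ideal.absNorm R = p → Prime R := fun R hR =>
      UniqueFactorizationMonoid.irreducible_iff_prime.mp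
        (Ideal.irreducible_of_irreducible_absNorm (by rw [hR]; exact hp.prime.irreducible))
    have heq : ∀ R T : Ideal (𝓞 K), Ideal.absNorm R = p → Ideal.absNorm T = p → R ∣ T → R = T := by
      intro R T hR hT hd
      exact associated_iff_eq.mp ((hprime R hR).associated_of_dvd (hprime T hT) hd)
    have hlist : ∀ k, ∀ I : Ideal (𝓞 K), Ideal.absNorm I = p ^ k → ∃ i ≤ k, I = P ^ i * Q ^ (k - i) := by
      intro k
      induction k with
      | zero =>
        intro I hI
        exact ⟨0, le_rfl, by simpa [Ideal.absNorm_eq_one_iff] using hI⟩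
      | succ k ih =>
        intro I hI
        obtain ⟨R, hRI, hRp, hR⟩ := exists_prime_factor hdeg hp I hI
        have hPQ : P ∣ I ∨ Q ∣ I := by
          rcases hR with hR | hR
          · rw [hQ] at hRp
            rcases (hprime R hR).dvd_or_dvd hRp with h | h
            · left; rwa [← heq R P hR hP h]
            · right; rwa [← heq R Q hR hQn h]
          · left; rw [hR, hQ] at hRI
            exact (dvd_mul_right P Q).trans hRI
        have hnorm : ∀ R J : Ideal (𝓞 K), Ideal.absNorm R = p → I = R * J →
            Ideal.absNorm J = p ^ k := by
          intro R J hR hJ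
          rw [hJ, map_mul, hR, pow_succ'] at hI
          exact Nat.eq_of_mul_eq_mul_left hp.pos hI
        rcases hPQ with ⟨J, hJ⟩ | ⟨J, hJ⟩
        · obtain ⟨i, hi, hJ'⟩ := ih J (hnorm P J hP hJ)
          refine ⟨i + 1, by omega, ?_⟩
          rw [hJ, hJ', Nat.add_sub_add_right, pow_succ']
          ring
        · obtain ⟨i, hi, hJ'⟩ := ih J (hnorm Q J hQn hJ)
          refine ⟨i, by omega, ?_⟩
          rw [hJ, hJ', Nat.succ_sub hi, pow_succ']
          ring
    have hnpow : ∀ k i, i ≤ k → Ideal.absNorm (P ^ i * Q ^ (k - i)) = p ^ k := by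
      intro k i hi
      rw [map_mul, map_pow, map_pow, hP, hQn, ← pow_add]
      congr 1; omega
    by_cases hPQ : P = Q
    · refine ⟨0, by tauto, fun k => ?_⟩
      have : idealCount K (p ^ k) = 1 := by
        unfold idealCount
        rw [Nat.card_eq_one_iff_unique]
        refine ⟨⟨?_⟩, ⟨⟨_, hnpow k k le_rfl⟩⟩⟩
        rintro ⟨a, ha⟩ ⟨b, hb⟩
        obtain ⟨i, hi, h1⟩ := hlist k a ha
        obtain ⟨j, hj, h2⟩ := hlist k b hb
        apply Subtype.ext
        simp only
        rw [h1, h2, ← hPQ, ← pow_add, ← pow_add]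
        congr 1; omega
      rw [this, Finset.sum_range_succ']
      simp
    · refine ⟨1, by tauto, fun k => ?_⟩
      have hinj : ∀ i j, i < j → j ≤ k → P ^ i * Q ^ (k - i) ≠ P ^ j * Q ^ (k - j) := by
        intro i j hij hjk h
        have hP0 : P ≠ 0 := (hprime P hP).ne_zero
        have hQ0 : Q ≠ 0 := (hprime Q hQn).ne_zero
        obtain ⟨m, rfl⟩ : ∃ m, j = i + m := ⟨j - i, by omega⟩
        obtain ⟨n, rfl⟩ : ∃ n, k = i + m + n := ⟨k - (i + m), by omega⟩
        have e1 : i + m + n - i = m + n := by omega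
        have e2 : i + m + n - (i + m) = n := by omega
        rw [e1, e2] at h
        have h2 : (P ^ i * Q ^ n) * Q ^ m = (P ^ i * Q ^ n) * P ^ m := by
          calc (P ^ i * Q ^ n) * Q ^ m = P ^ i * Q ^ (m + n) := by ring
            _ = P ^ (i + m) * Q ^ n := h
            _ = _ := by ring
        have h3 := mul_left_cancel₀ (mul_ne_zero (pow_ne_zero _ hP0) (pow_ne_zero _ hQ0)) h2
        have h4 : P ∣ Q ^ m := by rw [h3]; exact dvd_pow_self _ (by omega)
        exact hPQ (heq P Q hP hQn ((hprime P hP).dvd_of_dvd_pow h4))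
      have : idealCount K (p ^ k) = k + 1 := by
        unfold idealCount
        rw [← Nat.card_fin (k + 1)]
        symm
        refine Nat.card_congr (Equiv.ofBijective (fun i => ⟨_, hnpow k i (by omega)⟩) ⟨?_, ?_⟩)
        · intro i j h
          have h0 : P ^ (i:ℕ) * Q ^ (k - i) = P ^ (j:ℕ) * Q ^ (k - j) := congrArg Subtype.val h
          rcases lt_trichotomy (i:ℕ) j with h1 | h1 | h1
          · exact absurd h0 (hinj _ _ h1 (by omega))
          · exact Fin.ext h1
          · exact absurd h0.symm (hinj _ _ h1 (by omega))
        · rintro ⟨a, ha⟩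
          obtain ⟨i, hi, h1⟩ := hlist k a ha
          exact ⟨⟨i, by omega⟩, Subtype.ext h1.symm⟩
      rw [this]
      simp
  · push Not at hex
    refine ⟨-1, by tauto, ?_⟩
    have h0 : idealCount K (p ^ 0) = 1 := by rw [pow_zero]; exact idealCount_one
    have h1 : idealCount K (p ^ 1) = 0 := by
      unfold idealCount
      rw [pow_one, Nat.card_eq_zero]
      left
      exact ⟨fun a => hex a.1 a.2⟩
    have h2 : ∀ k, idealCount K (p ^ (k + 2)) = idealCount K (p ^ k) := by
      intro k
      unfold idealCount
      symm
      refine Nat.card_congr (Equiv.ofBijective (fun I => ⟨Ideal.span {(p : 𝓞 K)} * I.1, by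
        rw [map_mul, hspan, I.2]; ring⟩) ⟨?_, ?_⟩)
      · rintro ⟨a, ha⟩ ⟨b, hb⟩ h
        exact Subtype.ext (mul_left_cancel₀ hspan0 (congrArg Subtype.val h))
      · rintro ⟨a, ha⟩
        obtain ⟨R, hRI, hRp, hR⟩ := exists_prime_factor hdeg hp (k := k + 1) a ha
        rcases hR with hR | hR
        · exact absurd hR (hex R)
        · rw [hR] at hRI
          obtain ⟨J, hJ⟩ := hRI
          refine ⟨⟨J, ?_⟩, Subtype.ext hJ.symm⟩
          rw [hJ, map_mul, hspan, pow_add, mul_comm] at ha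
          exact Nat.eq_of_mul_eq_mul_right (pow_pos hp.pos 2) ha
    intro k
    induction k using Nat.twoStepInduction with
    | zero => rw [h0]; simp
    | one => rw [h1]; simp [Finset.sum_range_succ]
    | more k ih1 ih2 =>
      rw [h2, ih1, Finset.sum_range_succ _ (k + 2), Finset.sum_range_succ _ (k + 1)]
      ring
end Count

section Character
variable {K : Type*} [Field K] [NumberField K]

/-- The completely multiplicative function with `chi p = r(p) - 1`. -/
noncomputable def chi (K : Type*) [Field K] [NumberField K] (n : ℕ) : ℤ :=
  if n = 0 then 0 else n.factorization.prod fun p k => ((idealCount K p : ℤ) - 1) ^ k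

lemma chi_zero : chi K 0 = 0 := by simp [chi]

lemma chi_one : chi K 1 = 1 := by simp [chi]

lemma chi_mul (m n : ℕ) : chi K (m * n) = chi K m * chi K n := by
  rcases eq_or_ne m 0 with rfl | hm
  · simp [chi]
  rcases eq_or_ne n 0 with rfl | hn
  · simp [chi]
  simp only [chi, hm, hn, mul_eq_zero, or_self, if_false]
  rw [Nat.factorization_mul hm hn, Finsupp.prod_add_index']
  · intro a; simp
  · intro a b c; rw [pow_add]

lemma chi_prime {p : ℕ} (hp : p.Prime) : chi K p = (idealCount K p : ℤ) - 1 := by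
  simp only [chi, hp.ne_zero, if_false, hp.factorization]
  rw [Finsupp.prod_single_index] <;> simp

lemma chi_pow (m k : ℕ) : chi K (m ^ k) = chi K m ^ k := by
  induction k with
  | zero => simp [chi_one]
  | succ k ih => rw [pow_succ, chi_mul, ih, pow_succ]

lemma idealCount_pow_chi (hdeg : Module.finrank ℚ K = 2) {p : ℕ} (hp : p.Prime) :
    (chi K p = -1 ∨ chi K p = 0 ∨ chi K p = 1) ∧
      ∀ k, (idealCount K (p ^ k) : ℤ) = ∑ j ∈ Finset.range (k + 1), chi K p ^ j := by
  obtain ⟨ε, h1, h2⟩ := idealCount_prime_pow (K := K) hdeg hp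
  have h3 : ε = chi K p := by
    have := h2 1
    rw [pow_one] at this
    rw [chi_prime hp, this]
    simp [Finset.sum_range_succ]
  rw [← h3]
  exact ⟨h1, h2⟩

lemma chi_abs_le (hdeg : Module.finrank ℚ K = 2) (n : ℕ) : |chi K n| ≤ 1 := by
  induction n using Nat.recOnMul with
  | zero => simp [chi_zero]
  | one => simp [chi_one]
  | prime p hp =>
    rcases (idealCount_pow_chi (K := K) hdeg hp).1 with h | h | h <;> simp [h]
  | mul a b ha hb =>
    rw [chi_mul, abs_mul]
    exact mul_le_one₀ ha (abs_nonneg _) hb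

lemma idealCount_eq_sum (hdeg : Module.finrank ℚ K = 2) {n : ℕ} (hn : n ≠ 0) :
    (idealCount K n : ℤ) = ∑ d ∈ n.divisors, chi K d := by
  let f : ArithmeticFunction ℤ := ⟨fun n => if n = 0 then 0 else (idealCount K n : ℤ), by simp⟩
  let X : ArithmeticFunction ℤ := ⟨chi K, chi_zero⟩
  have hX : X.IsMultiplicative := ⟨chi_one, fun _ => chi_mul _ _⟩
  have hf : f.IsMultiplicative := by
    rw [ArithmeticFunction.IsMultiplicative.iff_ne_zero]
    refine ⟨?_, ?_⟩
    · change (if (1:ℕ) = 0 then (0:ℤ) else (idealCount K 1 : ℤ)) = 1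
      rw [if_neg one_ne_zero, idealCount_one, Nat.cast_one]
    · intro m n hm hn hmn
      change (if m * n = 0 then (0:ℤ) else _) = (if m = 0 then (0:ℤ) else _) * (if n = 0 then (0:ℤ) else _)
      simp [hm, hn, idealCount_mul hdeg hm hn hmn]
  have hg : ((ArithmeticFunction.zeta : ArithmeticFunction ℤ) * X).IsMultiplicative :=
    ArithmeticFunction.isMultiplicative_zeta.natCast.mul hX
  have key : f = (ArithmeticFunction.zeta : ArithmeticFunction ℤ) * X := by
    rw [ArithmeticFunction.IsMultiplicative.eq_iff_eq_on_prime_powers f hf _ hg]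
    intro p i hp
    rw [ArithmeticFunction.coe_zeta_mul_apply, Nat.sum_divisors_prime_pow hp]
    change (if p ^ i = 0 then (0:ℤ) else _) = ∑ j ∈ Finset.range (i + 1), chi K (p ^ j)
    rw [if_neg (pow_ne_zero _ hp.ne_zero), (idealCount_pow_chi hdeg hp).2]
    simp [chi_pow]
  have := congrArg (fun g : ArithmeticFunction ℤ => g n) key
  simp only [ArithmeticFunction.coe_zeta_mul_apply] at this
  change (if n = 0 then (0:ℤ) else _) = ∑ d ∈ n.divisors, chi K d at this
  rwa [if_neg hn] at this

lemma norm_form (hdeg : Module.finrank ℚ K = 2) (hneg : NumberField.discr K < 0) :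
    ∃ (bs : Module.Basis (Fin 2) ℤ (𝓞 K)) (a b c : ℤ), discr K = b ^ 2 - 4 * a * c ∧
      ∀ x : 𝓞 K, Algebra.norm ℤ x =
        a * (bs.repr x 0) ^ 2 + b * (bs.repr x 0) * (bs.repr x 1) + c * (bs.repr x 1) ^ 2 := by
  obtain ⟨σ, hT, hN⟩ := exists_emb hdeg hneg
  obtain ⟨bs⟩ := exists_basis hdeg
  have hD := discr_im hT bs
  refine ⟨bs, Algebra.norm ℤ (bs 0), Algebra.norm ℤ (bs 0 + bs 1) - Algebra.norm ℤ (bs 0) -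
    Algebra.norm ℤ (bs 1), Algebra.norm ℤ (bs 1), ?_, ?_⟩
  · have : (discr K : ℝ) = (((Algebra.norm ℤ (bs 0 + bs 1) - Algebra.norm ℤ (bs 0) -
      Algebra.norm ℤ (bs 1)) ^ 2 - 4 * Algebra.norm ℤ (bs 0) * Algebra.norm ℤ (bs 1) : ℤ) : ℝ) := by
      rw [hD]
      push_cast
      simp only [norm_int hN, map_add, Complex.normSq_apply, Complex.add_re, Complex.add_im]
      ring
    exact_mod_cast this
  · intro x
    have hx : x = (bs.repr x 0 : 𝓞 K) * bs 0 + (bs.repr x 1 : 𝓞 K) * bs 1 := by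
      conv_lhs => rw [← bs.sum_repr x]
      simp [Fin.sum_univ_two, zsmul_eq_mul]
    set u := bs.repr x 0
    set v := bs.repr x 1
    rw [hx]
    have : ((Algebra.norm ℤ ((u : 𝓞 K) * bs 0 + (v : 𝓞 K) * bs 1) : ℤ) : ℝ) =
        ((Algebra.norm ℤ (bs 0) * u ^ 2 + (Algebra.norm ℤ (bs 0 + bs 1) - Algebra.norm ℤ (bs 0) -
    Algebra.norm ℤ (bs 1)) * u * v + Algebra.norm ℤ (bs 1) * v ^ 2 : ℤ) : ℝ) := by
      push_cast
      simp only [norm_int hN, map_add, map_mul, map_intCast, Complex.normSq_apply, Complex.add_re,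
        Complex.add_im, Complex.mul_re, Complex.mul_im, Complex.intCast_re, Complex.intCast_im]
      ring
    exact_mod_cast this

lemma mem_two_iff (bs : Module.Basis (Fin 2) ℤ (𝓞 K)) (x : 𝓞 K) :
    x ∈ Ideal.span {((2 : ℕ) : 𝓞 K)} ↔ 2 ∣ bs.repr x 0 ∧ 2 ∣ bs.repr x 1 := by
  rw [Ideal.mem_span_singleton]
  constructor
  · rintro ⟨y, rfl⟩
    have : ((2 : ℕ) : 𝓞 K) * y = (2 : ℤ) • y := by simp [zsmul_eq_mul]
    rw [this]
    simp only [map_smul, Finsupp.smul_apply, smul_eq_mul]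
    exact ⟨dvd_mul_right _ _, dvd_mul_right _ _⟩
  · rintro ⟨⟨u, hu⟩, ⟨v, hv⟩⟩
    refine ⟨(u : 𝓞 K) * bs 0 + (v : 𝓞 K) * bs 1, ?_⟩
    conv_lhs => rw [← bs.sum_repr x]
    simp only [Fin.sum_univ_two, zsmul_eq_mul, hu, hv]
    push_cast
    ring

lemma discr_mod_four (hdeg : Module.finrank ℚ K = 2) (hneg : NumberField.discr K < 0) :
    discr K % 4 = 0 ∨ discr K % 4 = 1 := by
  obtain ⟨bs, a, b, c, hD, -⟩ := norm_form hdeg hneg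
  rw [hD]
  rcases Int.even_or_odd' b with ⟨k, rfl | rfl⟩
  · left
    have : (2 * k) ^ 2 - 4 * a * c = 4 * (k ^ 2 - a * c) := by ring
    omega
  · right
    have : (2 * k + 1) ^ 2 - 4 * a * c = 4 * (k ^ 2 + k - a * c) + 1 := by ring
    omega

lemma chi_two_inert (hdeg : Module.finrank ℚ K = 2) (hneg : NumberField.discr K < 0)
    (h5 : discr K % 8 = 5) : chi K 2 = -1 := by
  obtain ⟨bs, a, b, c, hD, hn⟩ := norm_form hdeg hneg
  rw [hD] at h5
  have hb : b % 2 = 1 := by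
    by_contra h
    obtain ⟨k, rfl⟩ : ∃ k, b = 2 * k := ⟨b / 2, by omega⟩
    have : (2 * k) ^ 2 - 4 * a * c = 4 * (k ^ 2 - a * c) := by ring
    omega
  have hac : (a * c) % 2 = 1 := by
    obtain ⟨k, rfl⟩ : ∃ k, b = 2 * k + 1 := ⟨b / 2, by omega⟩
    obtain ⟨m, hm⟩ : ∃ m, k ^ 2 + k = 2 * m := by
      obtain ⟨m, hm⟩ := Int.even_mul_succ_self k
      exact ⟨m, by linarith⟩
    have : (2 * k + 1) ^ 2 - 4 * a * c = 8 * m + 1 - 4 * (a * c) := by linear_combination 4 * hm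
    omega
  rw [Int.mul_emod] at hac
  have ha : a % 2 = 1 := by
    rcases Int.emod_two_eq_zero_or_one a with h | h
    · rw [h] at hac; simp at hac
    · exact h
  have hc : c % 2 = 1 := by
    rcases Int.emod_two_eq_zero_or_one c with h | h
    · rw [h] at hac; simp at hac
    · exact h
  have hodd : ∀ u v : ℤ, 2 ∣ a * u ^ 2 + b * u * v + c * v ^ 2 → 2 ∣ u ∧ 2 ∣ v := by
    intro u v h
    have ha' : Odd a := Int.odd_iff.mpr ha
    have hb' : Odd b := Int.odd_iff.mpr hb
    have hc' : Odd c := Int.odd_iff.mpr hc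
    rw [← even_iff_two_dvd] at h ⊢
    rw [← even_iff_two_dvd]
    simp only [Int.even_add, Int.even_mul, Int.even_pow, Int.not_even_iff_odd.mpr ha',
      Int.not_even_iff_odd.mpr hb', Int.not_even_iff_odd.mpr hc'] at h
    tauto
  have hz : idealCount K 2 = 0 := by
    unfold idealCount
    rw [Nat.card_eq_zero]
    left
    refine ⟨?_⟩
    rintro ⟨P, hP⟩
    have hle : P ≤ Ideal.span {((2 : ℕ) : 𝓞 K)} := by
      intro x hx
      have h1 := Ideal.absNorm_dvd_norm_of_mem hx
      rw [hP, hn] at h1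
      rw [mem_two_iff bs]
      exact hodd _ _ (by exact_mod_cast h1)
    have := Ideal.absNorm_dvd_absNorm_of_le hle
    rw [hP, Ideal.absNorm_span_natCast, finrank_int hdeg] at this
    norm_num at this
  rw [chi_prime Nat.prime_two, hz]; simp

lemma chi_two_ram (hdeg : Module.finrank ℚ K = 2) (hneg : NumberField.discr K < 0)
    (h4 : discr K % 4 = 0) : chi K 2 = 0 := by
  obtain ⟨bs, a, b, c, hD, hn⟩ := norm_form hdeg hneg
  rw [hD] at h4
  have hb : Even b := by
    rw [← Int.not_odd_iff_even]
    rintro ⟨k, rfl⟩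
    have : (2 * k + 1) ^ 2 - 4 * a * c = 4 * (k ^ 2 + k - a * c) + 1 := by ring
    omega
  have hev : ∀ x : 𝓞 K, Even (Algebra.norm ℤ x) ↔ Even (a * bs.repr x 0 + c * bs.repr x 1) := by
    intro x
    rw [hn]
    simp only [Int.even_add, Int.even_mul, Int.even_pow, hb]
    tauto
  let I0 : Ideal (𝓞 K) :=
    { carrier := {x | Even (Algebra.norm ℤ x)}
      add_mem' := by
        intro x y hx hy
        simp only [Set.mem_ofPred_eq] at hx hy ⊢
        rw [hev] at hx hy ⊢
        have := hx.add hy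
        have e : a * bs.repr (x + y) 0 + c * bs.repr (x + y) 1 =
            (a * bs.repr x 0 + c * bs.repr x 1) + (a * bs.repr y 0 + c * bs.repr y 1) := by
          simp only [map_add, Finsupp.add_apply]
          ring
        rw [e]
        exact this
      zero_mem' := by
        simp only [Set.mem_ofPred_eq]
        rw [hev]; simp
      smul_mem' := by
        intro r x hx
        simp only [Set.mem_ofPred_eq, smul_eq_mul, map_mul] at hx ⊢
        exact hx.mul_left _ }
  have hI0 : ∀ x, x ∈ I0 ↔ Even (Algebra.norm ℤ x) := fun x => Iff.rfl
  have htop : I0 ≠ ⊤ := by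
    rw [Ne, Ideal.eq_top_iff_one, hI0]
    simp
  have h2mem : Ideal.span {((2 : ℕ) : 𝓞 K)} ≤ I0 := by
    intro x hx
    rw [mem_two_iff bs] at hx
    rw [hI0, hev]
    exact ((even_iff_two_dvd.mpr hx.1).mul_left _).add ((even_iff_two_dvd.mpr hx.2).mul_left _)
  have hN : Ideal.absNorm I0 = 2 := by
    have hd := Ideal.absNorm_dvd_absNorm_of_le h2mem
    rw [Ideal.absNorm_span_natCast, finrank_int hdeg] at hd
    have h1 : Ideal.absNorm I0 ≠ 1 := fun h => htop (Ideal.absNorm_eq_one_iff.mp h)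
    rw [Nat.dvd_prime_pow Nat.prime_two] at hd
    obtain ⟨m, hm, hPm⟩ := hd
    interval_cases m
    · exact absurd hPm (by simpa using h1)
    · simpa using hPm
    · exfalso
      obtain ⟨Q, hQ⟩ := Ideal.dvd_iff_le.mpr h2mem
      have hQ1 : Ideal.absNorm Q = 1 := by
        have := congrArg Ideal.absNorm hQ
        rw [map_mul, Ideal.absNorm_span_natCast, finrank_int hdeg, hPm] at this
        omega
      rw [Ideal.absNorm_eq_one_iff] at hQ1
      rw [hQ1, Ideal.mul_top] at hQ
      have hall : ∀ x : 𝓞 K, Even (a * bs.repr x 0 + c * bs.repr x 1) →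
          2 ∣ bs.repr x 0 ∧ 2 ∣ bs.repr x 1 := by
        intro x hx
        rw [← hev, ← hI0, ← hQ, mem_two_iff bs] at hx
        exact hx
      have t1 := hall (bs 0)
      have t2 := hall (bs 1)
      have t3 := hall (bs 0 + bs 1)
      simp at t1 t2 t3
      rcases Int.even_or_odd a with ha | ha
      · exact absurd ha (Int.not_even_iff_odd.mpr t1)
      · rcases Int.even_or_odd c with hc | hc
        · exact absurd hc (Int.not_even_iff_odd.mpr t2)
        · exact absurd (ha.add_odd hc) (Int.not_even_iff_odd.mpr t3)
  have hone : idealCount K 2 = 1 := by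
    unfold idealCount
    rw [Nat.card_eq_one_iff_unique]
    have hu : ∀ P : Ideal (𝓞 K), Ideal.absNorm P = 2 → P = I0 := by
      intro P hP
      have hle : P ≤ I0 := by
        intro x hx
        have h1 := Ideal.absNorm_dvd_norm_of_mem hx
        rw [hP] at h1
        rw [hI0, even_iff_two_dvd]
        exact_mod_cast h1
      obtain ⟨Q, hQ⟩ := Ideal.dvd_iff_le.mpr hle
      have hQ1 : Ideal.absNorm Q = 1 := by
        have := congrArg Ideal.absNorm hQ
        rw [map_mul, hP, hN] at this
        omega
      rw [Ideal.absNorm_eq_one_iff] at hQ1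
      rw [hQ, hQ1, Ideal.mul_top]
    exact ⟨⟨fun x y => Subtype.ext ((hu x.1 x.2).trans (hu y.1 y.2).symm)⟩, ⟨⟨I0, hN⟩⟩⟩
  rw [chi_prime Nat.prime_two, hone]; simp
end Character

section Lambert
open nonZeroDivisors

lemma lambert {χ : ℕ → ℝ} (hχ : ∀ n, |χ n| ≤ 1) (h0 : χ 0 = 0) {c : ℝ} (hc : 0 < c) :
    ∑' n : ℕ+, (∑ d ∈ (n : ℕ).divisors, χ d) * rexp (-(c * (n : ℕ))) =
      ∑' d : ℕ, χ d * (1 / (rexp (c * d) - 1)) := by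
  set r := rexp (-c) with hr
  have hr0 : 0 < r := exp_pos _
  have hr1 : r < 1 := by rw [hr]; rw [← Real.exp_zero]; exact Real.exp_lt_exp.mpr (by linarith)
  have hpow : ∀ n : ℕ, rexp (-(c * n)) = r ^ n := by
    intro n; rw [hr, ← Real.exp_nat_mul]; congr 1; ring
  have hs : Summable fun p : ℕ+ × ℕ+ => χ p.1 * r ^ ((p.1 : ℕ) * (p.2 : ℕ)) := by
    have h1 := summable_prod_mul_pow (𝕜 := ℝ) 0 (r := r) (by rw [Real.norm_eq_abs, abs_of_pos hr0]; exact hr1)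
    refine Summable.of_norm_bounded h1 fun p => ?_
    rw [norm_mul, Real.norm_eq_abs, Real.norm_eq_abs, pow_zero, one_mul, abs_of_pos (pow_pos hr0 _)]
    exact mul_le_of_le_one_left (pow_pos hr0 _).le (hχ _)
  have e1 : ∑' p : ℕ+ × ℕ+, χ p.1 * r ^ ((p.1 : ℕ) * (p.2 : ℕ)) =
      ∑' n : ℕ+, (∑ d ∈ (n : ℕ).divisors, χ d) * rexp (-(c * (n : ℕ))) := by
    have hs' := sigmaAntidiagonalEquivProd.summable_iff.mpr hs
    rw [← sigmaAntidiagonalEquivProd.tsum_eq]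
    refine hs'.tsum_sigma.trans ?_
    refine tsum_congr fun n => ?_
    rw [tsum_fintype]
    have : ∀ x : Nat.divisorsAntidiagonal n,
        ((fun p : ℕ+ × ℕ+ => χ p.1 * r ^ ((p.1 : ℕ) * (p.2 : ℕ))) ∘ sigmaAntidiagonalEquivProd) ⟨n, x⟩ =
        χ x.1.1 * rexp (-(c * (n : ℕ))) := by
      intro x
      simp only [Function.comp, hpow]
      congr 2
      exact divisorsAntidiagonalFactors_eq x
    simp only [this]
    rw [Finset.univ_eq_attach, (n : ℕ).divisorsAntidiagonal.sum_attach (fun x => χ x.1 * rexp (-(c * (n : ℕ)))),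
      Nat.sum_divisorsAntidiagonal (fun x _ => χ x * rexp (-(c * (n : ℕ)))), Finset.sum_mul]
  rw [← e1, hs.tsum_prod]
  rw [← tsum_pnat_eq_tsum_of_eq_zero (f := fun d : ℕ => χ d * (1 / (rexp (c * d) - 1))) (by simp [h0])]
  refine tsum_congr fun d => ?_
  simp only []
  rw [tsum_mul_left]
  congr 1
  have hd0 : 0 < r ^ (d : ℕ) := pow_pos hr0 _
  have hd1 : r ^ (d : ℕ) < 1 := pow_lt_one₀ hr0.le hr1 d.pos.ne'
  have : rexp (c * d) = (r ^ (d : ℕ))⁻¹ := by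
    rw [← hpow, ← Real.exp_neg, neg_neg]
  rw [this, tsum_pnat_eq_tsum_succ (f := fun m : ℕ => r ^ ((d : ℕ) * m))]
  simp only [mul_add, pow_add, pow_mul, mul_one, pow_one]
  rw [tsum_mul_right, tsum_geometric_of_lt_one hd0.le hd1]
  have : 1 - r ^ (d : ℕ) ≠ 0 := by linarith
  have h3 : (r ^ (d : ℕ))⁻¹ - 1 = (1 - r ^ (d : ℕ)) / r ^ (d : ℕ) := by field_simp
  rw [h3]
  field_simp

variable {K : Type*} [Field K] [NumberField K]

lemma ideal_tsum (c : ℝ) (hs : Summable (fun I : (Ideal (𝓞 K))⁰ =>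
      rexp (-(c * (Ideal.absNorm (I : Ideal (𝓞 K)) : ℝ))))) :
    ∑' I : (Ideal (𝓞 K))⁰, rexp (-(c * (Ideal.absNorm (I : Ideal (𝓞 K)) : ℝ))) =
      ∑' n : ℕ+, (idealCount K n : ℝ) * rexp (-(c * (n : ℕ))) := by
  let ν : (Ideal (𝓞 K))⁰ → ℕ+ := fun I => ⟨Ideal.absNorm (I : Ideal (𝓞 K)),
    Ideal.absNorm_pos_of_nonZeroDivisors I⟩
  have hs' := (Equiv.sigmaFiberEquiv ν).summable_iff.mpr hs
  rw [← (Equiv.sigmaFiberEquiv ν).tsum_eq]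
  refine hs'.tsum_sigma.trans (tsum_congr fun n => ?_)
  have : ∀ x : {I : (Ideal (𝓞 K))⁰ // ν I = n},
      ((fun I : (Ideal (𝓞 K))⁰ => rexp (-(c * (Ideal.absNorm (I : Ideal (𝓞 K)) : ℝ)))) ∘
        (Equiv.sigmaFiberEquiv ν)) ⟨n, x⟩ = rexp (-(c * (n : ℕ))) := by
    rintro ⟨I, rfl⟩
    rfl
  simp only [this]
  rw [tsum_const, nsmul_eq_mul]
  congr 2
  unfold idealCount
  refine Nat.card_congr ⟨fun x => ⟨x.1.1, congrArg PNat.val x.2⟩, fun x => ⟨⟨x.1, ?_⟩, ?_⟩, ?_, ?_⟩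
  · rw [mem_nonZeroDivisors_iff_ne_zero]
    intro h
    have := x.2
    rw [h, Ideal.zero_eq_bot, Ideal.absNorm_bot] at this
    exact n.ne_zero this.symm
  · exact PNat.eq x.2
  · intro x; rfl
  · intro x; rfl

lemma classNumber_eq (hdeg : Module.finrank ℚ K = 2) (hneg : NumberField.discr K < -4)
    {y : ℝ} (hy : y = 2 * π / √|(discr K : ℝ)|) :
    (classNumber K : ℝ) = 2 * ∑' d : ℕ, (chi K d : ℝ) * (1 / (rexp (y / 2 * d) - 1)) -
      4 * ∑' d : ℕ, (chi K d : ℝ) * (1 / (rexp (2 * y * d) - 1)) := by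
  have hD : (0:ℝ) < √|(discr K : ℝ)| := by
    rw [Real.sqrt_pos, abs_pos]; exact_mod_cast (by omega : discr K ≠ 0)
  have hy0 : 0 < y := by rw [hy]; positivity
  obtain ⟨h1, h2⟩ := total_sum hdeg hneg
  have key : ∀ c : ℝ, 0 < c → ∑' I : (Ideal (𝓞 K))⁰, rexp (-(c * (Ideal.absNorm (I : Ideal (𝓞 K)) : ℝ)))
      = ∑' d : ℕ, (chi K d : ℝ) * (1 / (rexp (c * d) - 1)) := by
    intro c hc
    rw [ideal_tsum c (h1 c hc), ← lambert (fun n => by exact_mod_cast chi_abs_le hdeg n)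
      (by simp [chi_zero]) hc]
    refine tsum_congr fun n => ?_
    congr 1
    exact_mod_cast congrArg (Int.cast : ℤ → ℝ) (idealCount_eq_sum (K := K) hdeg n.ne_zero)
  rw [h2 y hy, key _ (by positivity), key _ (by positivity)]
end Lambert

section Analytic

lemma log_sub_log_ge {X Y : ℝ} (hY : 0 < Y) (hXY : Y ≤ X) :
    2 * (X - Y) / (X + Y) ≤ Real.log X - Real.log Y := by
  have hX : 0 < X := by linarith
  set w := (X - Y) / (X + Y) with hw
  have hw0 : 0 ≤ w := div_nonneg (by linarith) (by linarith)
  have hw1 : w < 1 := by rw [hw, div_lt_one (by linarith)]; linarith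
  have h := Real.hasSum_log_sub_log_of_abs_lt_one (x := w) (by rw [abs_of_nonneg hw0]; exact hw1)
  have h1 := le_hasSum h 0 (fun i _ => by positivity)
  have e1 : 1 + w = 2 * X / (X + Y) := by rw [hw]; field_simp; ring
  have e2 : 1 - w = 2 * Y / (X + Y) := by rw [hw]; field_simp; ring
  rw [e1, e2, Real.log_div (by positivity) (by positivity), Real.log_div (by positivity) (by positivity),
    Real.log_mul (by norm_num) hX.ne', Real.log_mul (by norm_num) hY.ne'] at h1
  have e3 : 2 * (X - Y) / (X + Y) = 2 * w := by rw [hw]; ring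
  rw [e3]
  norm_num at h1
  linarith

/-- The antiderivative of `-1/sinh`. -/
noncomputable def Lf (x : ℝ) : ℝ := Real.log (Real.cosh (x / 2)) - Real.log (Real.sinh (x / 2))

lemma Lf_nonneg {x : ℝ} (hx : 0 < x) : 0 ≤ Lf x := by
  unfold Lf
  have h1 : 0 < Real.sinh (x / 2) := Real.sinh_pos_iff.mpr (by linarith)
  have := Real.log_le_log h1 (Real.sinh_lt_cosh (x / 2)).le
  linarith

lemma sinh_tele {z a : ℝ} (ha : 0 < a) (haz : a < z) :
    1 / Real.sinh z ≤ (1 / (2 * a)) * (Lf (z - a) - Lf (z + a)) := by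
  have hz : 0 < Real.sinh z := Real.sinh_pos_iff.mpr (by linarith)
  have hsa : a ≤ Real.sinh a := Real.self_le_sinh_iff.mpr ha.le
  have hp : 0 < Real.sinh ((z - a) / 2) := Real.sinh_pos_iff.mpr (by linarith)
  have hq : 0 < Real.sinh ((z + a) / 2) := Real.sinh_pos_iff.mpr (by linarith)
  have cp := Real.cosh_pos ((z - a) / 2)
  have cq := Real.cosh_pos ((z + a) / 2)
  have e1 : Real.sinh z = Real.sinh ((z + a) / 2) * Real.cosh ((z - a) / 2) +
      Real.cosh ((z + a) / 2) * Real.sinh ((z - a) / 2) := by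
    rw [← Real.sinh_add]; congr 1; ring
  have e2 : Real.sinh a = Real.sinh ((z + a) / 2) * Real.cosh ((z - a) / 2) -
      Real.cosh ((z + a) / 2) * Real.sinh ((z - a) / 2) := by
    rw [← Real.sinh_sub]; congr 1; ring
  have h := log_sub_log_ge (X := Real.sinh ((z + a) / 2) * Real.cosh ((z - a) / 2))
    (Y := Real.cosh ((z + a) / 2) * Real.sinh ((z - a) / 2)) (by positivity) (by linarith)
  rw [← e1, ← e2, Real.log_mul hq.ne' cp.ne', Real.log_mul cq.ne' hp.ne'] at h
  have h2 : 2 * Real.sinh a / Real.sinh z ≤ Lf (z - a) - Lf (z + a) := by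
    unfold Lf; linarith
  have h3 : 2 * a / Real.sinh z ≤ 2 * Real.sinh a / Real.sinh z := by gcongr
  have h4 : 1 / Real.sinh z = (1 / (2 * a)) * (2 * a / Real.sinh z) := by field_simp
  rw [h4]
  exact mul_le_mul_of_nonneg_left (h3.trans h2) (by positivity)

/-- The antiderivative of `-1/(exp (x/2) + 1)`. -/
noncomputable def Mf (x : ℝ) : ℝ := 2 * Real.log (1 + rexp (-(x / 2)))

lemma Mf_nonneg (x : ℝ) : 0 ≤ Mf x := by
  unfold Mf
  have := Real.log_nonneg (x := 1 + rexp (-(x / 2))) (by linarith [exp_pos (-(x / 2))])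
  linarith

lemma Mf_le {x : ℝ} (hx : 0 ≤ x) : Mf x ≤ 2 * Real.log 2 := by
  unfold Mf
  have h1 : rexp (-(x / 2)) ≤ 1 := Real.exp_le_one_iff.mpr (by linarith)
  have := Real.log_le_log (x := 1 + rexp (-(x / 2))) (by positivity) (by linarith : _ ≤ (2:ℝ))
  linarith

lemma Mf_deriv (x : ℝ) : HasDerivAt Mf (-(1 / (rexp (x / 2) + 1))) x := by
  unfold Mf
  have h1 : HasDerivAt (fun x : ℝ => rexp (-(x / 2))) (rexp (-(x / 2)) * (-(1 / 2))) x :=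
    ((hasDerivAt_id x).div_const 2).neg.exp
  have h2 := ((h1.const_add 1).log (by positivity)).const_mul 2
  refine h2.congr_deriv ?_
  rw [Real.exp_neg]
  have := exp_pos (x / 2)
  field_simp

lemma S_convex {z a : ℝ} (ha : 0 ≤ a) (haz : a ≤ z) :
    2 * (1 / (rexp (z / 2) + 1)) ≤ 1 / (rexp ((z - a) / 2) + 1) + 1 / (rexp ((z + a) / 2) + 1) := by
  have e1 : rexp ((z - a) / 2) = rexp (z / 2) / rexp (a / 2) := by rw [← Real.exp_sub]; congr 1; ring
  have e2 : rexp ((z + a) / 2) = rexp (z / 2) * rexp (a / 2) := by rw [← Real.exp_add]; congr 1; ring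
  rw [e1, e2]
  have hk : 0 < rexp (a / 2) := exp_pos _
  have hu : 1 ≤ rexp (z / 2) := Real.one_le_exp (by linarith)
  set u := rexp (z / 2)
  set k := rexp (a / 2)
  have e3 : 1 / (u / k + 1) = k / (u + k) := by field_simp
  rw [e3, div_add_div _ _ (by positivity) (by positivity), mul_one_div, div_le_div_iff₀ (by positivity) (by positivity)]
  nlinarith [mul_nonneg (mul_nonneg (by linarith : (0:ℝ) ≤ u) (by linarith : (0:ℝ) ≤ u - 1)) (sq_nonneg (k - 1))]

lemma S_tele {z a : ℝ} (ha : 0 < a) (haz : a ≤ z) :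
    1 / (rexp (z / 2) + 1) ≤ (1 / (2 * a)) * (Mf (z - a) - Mf (z + a)) := by
  let φ : ℝ → ℝ := fun t => Mf (z - t) - Mf (z + t) - 2 * t * (1 / (rexp (z / 2) + 1))
  have hd : ∀ t, HasDerivAt φ (1 / (rexp ((z - t) / 2) + 1) + 1 / (rexp ((z + t) / 2) + 1) -
      2 * (1 / (rexp (z / 2) + 1))) t := by
    intro t
    have h1 := (Mf_deriv (z - t)).comp t ((hasDerivAt_id t).const_sub z)
    have h2 := (Mf_deriv (z + t)).comp t ((hasDerivAt_id t).const_add z)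
    have h3 := ((hasDerivAt_id t).const_mul 2).mul_const (1 / (rexp (z / 2) + 1))
    have h4 := (h1.sub h2).sub h3
    refine h4.congr_deriv ?_
    ring
  have hmono : MonotoneOn φ (Set.Icc 0 a) := by
    apply monotoneOn_of_deriv_nonneg (convex_Icc 0 a)
    · exact fun t _ => (hd t).continuousAt.continuousWithinAt
    · exact fun t _ => (hd t).differentiableAt.differentiableWithinAt
    · intro t ht
      rw [interior_Icc] at ht
      rw [(hd t).deriv]
      have := S_convex (z := z) (a := t) ht.1.le (by linarith [ht.2])
      linarith
  have h := hmono (Set.left_mem_Icc.mpr ha.le) (Set.right_mem_Icc.mpr ha.le) ha.le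
  simp only [φ, sub_zero, add_zero, mul_zero, zero_mul, sub_self] at h
  rw [one_div_mul_eq_div, le_div_iff₀ (by positivity)]
  linarith

lemma tele_bound {f A : ℕ → ℝ} (hf : ∀ k, 0 ≤ f k) (hA : ∀ k, 0 ≤ A k)
    (h : ∀ k, f k ≤ A k - A (k + 1)) : Summable f ∧ ∑' k, f k ≤ A 0 := by
  have hs : ∀ n, ∑ i ∈ Finset.range n, f i ≤ A 0 := by
    intro n
    calc ∑ i ∈ Finset.range n, f i ≤ ∑ i ∈ Finset.range n, (A i - A (i + 1)) :=
          Finset.sum_le_sum fun i _ => h i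
      _ = A 0 - A n := Finset.sum_range_sub' _ _
      _ ≤ A 0 := by linarith [hA n]
  exact ⟨summable_of_sum_range_le hf hs, Real.tsum_le_of_sum_range_le hf hs⟩

lemma sumS_odd {y : ℝ} (hy : 0 < y) :
    Summable (fun k : ℕ => 1 / (rexp (y * ((2 * k + 1 : ℕ) : ℝ) / 2) + 1)) ∧
    ∑' k : ℕ, 1 / (rexp (y * ((2 * k + 1 : ℕ) : ℝ) / 2) + 1) ≤ Real.log 2 / y := by
  have h := tele_bound (f := fun k : ℕ => 1 / (rexp (y * ((2 * k + 1 : ℕ) : ℝ) / 2) + 1))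
    (A := fun k : ℕ => (1 / (2 * y)) * Mf (2 * k * y)) (fun k => by positivity)
    (fun k => mul_nonneg (by positivity) (Mf_nonneg _)) (fun k => by
      have := S_tele (z := y * ((2 * k + 1 : ℕ) : ℝ)) hy (by push_cast; nlinarith [k.cast_nonneg (α := ℝ)])
      refine this.trans (le_of_eq ?_)
      rw [mul_sub]
      congr 3 <;> (push_cast; ring))
  refine ⟨h.1, h.2.trans ?_⟩
  have := Mf_le (x := 0) le_rfl
  simp only [CharP.cast_eq_zero, mul_zero, zero_mul]
  calc 1 / (2 * y) * Mf 0 ≤ 1 / (2 * y) * (2 * Real.log 2) := by gcongr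
    _ = _ := by field_simp

lemma sumS_all {y : ℝ} (hy : 0 < y) :
    Summable (fun k : ℕ => 1 / (rexp (y * ((k + 1 : ℕ) : ℝ) / 2) + 1)) ∧
    ∑' k : ℕ, 1 / (rexp (y * ((k + 1 : ℕ) : ℝ) / 2) + 1) ≤ 2 * Real.log 2 / y := by
  have h := tele_bound (f := fun k : ℕ => 1 / (rexp (y * ((k + 1 : ℕ) : ℝ) / 2) + 1))
    (A := fun k : ℕ => (1 / y) * Mf ((k + 1 / 2) * y)) (fun k => by positivity)
    (fun k => mul_nonneg (by positivity) (Mf_nonneg _)) (fun k => by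
      have := S_tele (z := y * ((k + 1 : ℕ) : ℝ)) (half_pos hy) (by push_cast; nlinarith [k.cast_nonneg (α := ℝ)])
      refine this.trans (le_of_eq ?_)
      rw [mul_sub]
      congr 3 <;> (push_cast; ring))
  refine ⟨h.1, h.2.trans ?_⟩
  have := Mf_le (x := (((0:ℕ):ℝ) + 1 / 2) * y) (by positivity)
  calc 1 / y * Mf ((((0:ℕ):ℝ) + 1 / 2) * y) ≤ 1 / y * (2 * Real.log 2) := by gcongr
    _ = _ := by field_simp

lemma sumH_all {y : ℝ} (hy : 0 < y) :
    Summable (fun k : ℕ => 1 / Real.sinh (y * ((k + 1 : ℕ) : ℝ))) ∧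
    ∑' k : ℕ, 1 / Real.sinh (y * ((k + 1 : ℕ) : ℝ)) ≤ (1 / y) * Lf (y / 2) := by
  have h := tele_bound (f := fun k : ℕ => 1 / Real.sinh (y * ((k + 1 : ℕ) : ℝ)))
    (A := fun k : ℕ => (1 / y) * Lf ((k + 1 / 2) * y)) (fun k => by
      have : 0 < Real.sinh (y * ((k + 1 : ℕ) : ℝ)) := Real.sinh_pos_iff.mpr (by positivity)
      positivity)
    (fun k => mul_nonneg (by positivity) (Lf_nonneg (by positivity))) (fun k => by
      have := sinh_tele (z := y * ((k + 1 : ℕ) : ℝ)) (half_pos hy) (by push_cast; nlinarith [k.cast_nonneg (α := ℝ)])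
      refine this.trans (le_of_eq ?_)
      rw [mul_sub]
      congr 3 <;> (push_cast; ring))
  refine ⟨h.1, h.2.trans (le_of_eq ?_)⟩
  simp only [CharP.cast_eq_zero]
  congr 2; ring

lemma sumH_odd {y : ℝ} (hy : 0 < y) :
    Summable (fun k : ℕ => 1 / Real.sinh (y * ((2 * k + 1 : ℕ) : ℝ))) ∧
    ∑' k : ℕ, 1 / Real.sinh (y * ((2 * k + 1 : ℕ) : ℝ)) ≤
      1 / Real.sinh y + (1 / (2 * y)) * Lf (2 * y) := by
  have h := tele_bound (f := fun k : ℕ => 1 / Real.sinh (y * ((2 * (k + 1) + 1 : ℕ) : ℝ)))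
    (A := fun k : ℕ => (1 / (2 * y)) * Lf ((2 * k + 2) * y)) (fun k => by
      have : 0 < Real.sinh (y * ((2 * (k + 1) + 1 : ℕ) : ℝ)) := Real.sinh_pos_iff.mpr (by positivity)
      positivity)
    (fun k => mul_nonneg (by positivity) (Lf_nonneg (by positivity))) (fun k => by
      have := sinh_tele (z := y * ((2 * (k + 1) + 1 : ℕ) : ℝ)) hy (by push_cast; nlinarith [k.cast_nonneg (α := ℝ)])
      refine this.trans (le_of_eq ?_)
      rw [mul_sub]
      congr 3 <;> (push_cast; ring))
  have hs : Summable (fun k : ℕ => 1 / Real.sinh (y * ((2 * k + 1 : ℕ) : ℝ))) :=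
    (summable_nat_add_iff (f := fun k : ℕ => 1 / Real.sinh (y * ((2 * k + 1 : ℕ) : ℝ))) 1).mp h.1
  refine ⟨hs, ?_⟩
  rw [hs.tsum_eq_zero_add]
  have h2 := h.2
  simp only [CharP.cast_eq_zero, mul_zero, zero_add] at h2 ⊢
  simp only [Nat.cast_one, mul_one]
  linarith
end Analytic

section Sums

lemma P_id1 {t : ℝ} (ht : 0 < t) : 2 * (1 / (rexp (t / 2) - 1)) - 4 * (1 / (rexp t - 1)) =
    2 * (1 / (rexp (t / 2) + 1)) := by
  have e : rexp t = rexp (t / 2) ^ 2 := by rw [← Real.exp_nat_mul]; congr 1; push_cast; ring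
  have hu : 1 < rexp (t / 2) := Real.one_lt_exp_iff.mpr (by linarith)
  rw [e]
  generalize rexp (t / 2) = u at *
  have h1 : u - 1 ≠ 0 := by linarith
  have h2 : u + 1 ≠ 0 := by linarith
  have h3 : u ^ 2 - 1 = (u - 1) * (u + 1) := by ring
  rw [h3]
  field_simp
  ring

lemma P_id2 {t : ℝ} (ht : 0 < t) : 1 / (rexp t - 1) - 1 / (rexp (2 * t) - 1) =
    1 / 2 * (1 / Real.sinh t) := by
  have e : rexp (2 * t) = rexp t ^ 2 := by rw [← Real.exp_nat_mul]; congr 1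
  have hu : 1 < rexp t := Real.one_lt_exp_iff.mpr ht
  have hs : Real.sinh t = (rexp t ^ 2 - 1) / (2 * rexp t) := by
    rw [Real.sinh_eq, Real.exp_neg]
    have := exp_pos t
    field_simp
  rw [e, hs]
  generalize rexp t = u at *
  have h1 : u - 1 ≠ 0 := by linarith
  have h2 : u + 1 ≠ 0 := by linarith
  have h0 : u ≠ 0 := by linarith
  have h3 : u ^ 2 - 1 = (u - 1) * (u + 1) := by ring
  rw [h3]
  field_simp
  ring

lemma P_summable {c : ℝ} (hc : 0 < c) : Summable (fun d : ℕ => 1 / (rexp (c * d) - 1)) := by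
  have hr : ‖rexp (-c)‖ < 1 := by
    rw [Real.norm_eq_abs, abs_of_pos (exp_pos _)]; rw [← Real.exp_zero]; exact Real.exp_lt_exp.mpr (by linarith)
  have h := summable_norm_pow_mul_geometric_div_one_sub 0 hr
  refine h.congr fun d => ?_
  rcases Nat.eq_zero_or_pos d with rfl | hd
  · simp
  have e : rexp (-c) ^ d = (rexp (c * d))⁻¹ := by
    rw [← Real.exp_nat_mul, ← Real.exp_neg]; congr 1; ring
  have hu : 1 < rexp (c * d) := Real.one_lt_exp_iff.mpr (by positivity)
  rw [e]
  simp only [pow_zero, one_mul]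
  generalize rexp (c * d) = u at *
  have h1 : u - 1 ≠ 0 := by linarith
  have h0 : u ≠ 0 := by linarith
  field_simp

variable {χ : ℕ → ℝ}

lemma abs_tsum_bound {ψ g : ℕ → ℝ} (hψ : ∀ k, |ψ k| ≤ 1) (hg : ∀ k, 0 ≤ g k) (hs : Summable g) :
    Summable (fun k => ψ k * g k) ∧ |∑' k, ψ k * g k| ≤ ∑' k, g k := by
  have hb : ∀ k, ‖ψ k * g k‖ ≤ g k := fun k => by
    rw [Real.norm_eq_abs, abs_mul, abs_of_nonneg (hg k)]
    exact mul_le_of_le_one_left (hg k) (hψ k)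
  exact ⟨Summable.of_norm_bounded hs hb, tsum_of_norm_bounded hs.hasSum hb⟩

lemma P_nonneg {c : ℝ} (hc : 0 < c) (d : ℕ) : 0 ≤ 1 / (rexp (c * d) - 1) := by
  have : 1 ≤ rexp (c * d) := Real.one_le_exp (by positivity)
  exact div_nonneg zero_le_one (by linarith)

/-- The Lambert series of `χ`. -/
noncomputable def Wf (χ : ℕ → ℝ) (c : ℝ) : ℝ := ∑' d : ℕ, χ d * (1 / (rexp (c * d) - 1))

/-- The odd part of the Lambert series of `χ`. -/
noncomputable def Wo (χ : ℕ → ℝ) (c : ℝ) : ℝ :=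
  ∑' k : ℕ, χ (2 * k + 1) * (1 / (rexp (c * ((2 * k + 1 : ℕ) : ℝ)) - 1))

lemma Wf_summable (hχ : ∀ n, |χ n| ≤ 1) {c : ℝ} (hc : 0 < c) :
    Summable (fun d : ℕ => χ d * (1 / (rexp (c * d) - 1))) :=
  (abs_tsum_bound hχ (P_nonneg hc) (P_summable hc)).1

lemma Wo_summable (hχ : ∀ n, |χ n| ≤ 1) {c : ℝ} (hc : 0 < c) :
    Summable (fun k : ℕ => χ (2 * k + 1) * (1 / (rexp (c * ((2 * k + 1 : ℕ) : ℝ)) - 1))) :=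
  (Wf_summable hχ hc).comp_injective (i := fun k : ℕ => 2 * k + 1)
    (fun a b h => by simp only at h; omega)

lemma Wf_split (hχ : ∀ n, |χ n| ≤ 1) {c : ℝ} (hc : 0 < c) :
    Wf χ c = ∑' k : ℕ, χ (2 * k) * (1 / (rexp (c * ((2 * k : ℕ) : ℝ)) - 1)) + Wo χ c := by
  have h1 : Summable (fun k : ℕ => χ (2 * k) * (1 / (rexp (c * ((2 * k : ℕ) : ℝ)) - 1))) :=
    (Wf_summable hχ hc).comp_injective (i := fun k : ℕ => 2 * k)
      (fun a b h => by simp only at h; omega)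
  exact (tsum_even_add_odd (f := fun d : ℕ => χ d * (1 / (rexp (c * d) - 1))) h1
    (Wo_summable hχ hc)).symm

lemma Wf_inert (hχ : ∀ n, |χ n| ≤ 1) (h2 : ∀ n, χ (2 * n) = - χ n) {c : ℝ} (hc : 0 < c) :
    Wf χ c = Wo χ c - Wf χ (2 * c) := by
  rw [Wf_split hχ hc, Wf, ← neg_add_eq_sub, ← tsum_neg]
  congr 1
  refine tsum_congr fun k => ?_
  rw [h2]
  push_cast
  rw [show c * (2 * (k:ℝ)) = 2 * c * k by ring]
  ring

lemma Wf_ram (hχ : ∀ n, |χ n| ≤ 1) (h2 : ∀ n, χ (2 * n) = 0) {c : ℝ} (hc : 0 < c) :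
    Wf χ c = Wo χ c := by
  rw [Wf_split hχ hc]
  simp [h2]

lemma Wo_diff1 (hχ : ∀ n, |χ n| ≤ 1) {y : ℝ} (hy : 0 < y) :
    |2 * Wo χ (y / 2) - 4 * Wo χ y| ≤ 2 * (Real.log 2 / y) := by
  have e : 2 * Wo χ (y / 2) - 4 * Wo χ y =
      2 * ∑' k : ℕ, χ (2 * k + 1) * (1 / (rexp (y * ((2 * k + 1 : ℕ) : ℝ) / 2) + 1)) := by
    rw [Wo, Wo, ← tsum_mul_left, ← tsum_mul_left, ← tsum_mul_left,
      ← Summable.tsum_sub ((Wo_summable hχ (half_pos hy)).mul_left 2) ((Wo_summable hχ hy).mul_left 4)]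
    refine tsum_congr fun k => ?_
    have h := P_id1 (t := y * ((2 * k + 1 : ℕ) : ℝ)) (by positivity)
    rw [show y / 2 * ((2 * k + 1 : ℕ) : ℝ) = y * ((2 * k + 1 : ℕ) : ℝ) / 2 by ring]
    linear_combination χ (2 * k + 1) * h
  have hb := sumS_odd hy
  have h := (abs_tsum_bound (ψ := fun k => χ (2 * k + 1)) (fun k => hχ _) (fun k => by positivity) hb.1).2
  rw [e, abs_mul, abs_of_pos (by norm_num : (0:ℝ) < 2)]
  linarith [hb.2]

lemma Wo_diff2 (hχ : ∀ n, |χ n| ≤ 1) {y : ℝ} (hy : 0 < y) :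
    |2 * (Wo χ y - Wo χ (2 * y))| ≤ 1 / Real.sinh y + (1 / (2 * y)) * Lf (2 * y) := by
  have e : 2 * (Wo χ y - Wo χ (2 * y)) =
      ∑' k : ℕ, χ (2 * k + 1) * (1 / Real.sinh (y * ((2 * k + 1 : ℕ) : ℝ))) := by
    rw [Wo, Wo, ← Summable.tsum_sub (Wo_summable hχ hy) (Wo_summable hχ (by positivity)), ← tsum_mul_left]
    refine tsum_congr fun k => ?_
    have h := P_id2 (t := y * ((2 * k + 1 : ℕ) : ℝ)) (by positivity)
    rw [show 2 * y * ((2 * k + 1 : ℕ) : ℝ) = 2 * (y * ((2 * k + 1 : ℕ) : ℝ)) by ring]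
    linear_combination 2 * χ (2 * k + 1) * h
  have hb := sumH_odd hy
  have h := (abs_tsum_bound (ψ := fun k => χ (2 * k + 1)) (fun k => hχ _) (fun k => by
    have : 0 < Real.sinh (y * ((2 * k + 1 : ℕ) : ℝ)) := Real.sinh_pos_iff.mpr (by positivity)
    positivity) hb.1).2
  rw [e]
  linarith [hb.2]

lemma Wf_all (hχ : ∀ n, |χ n| ≤ 1) (h0 : χ 0 = 0) {y : ℝ} (hy : 0 < y) :
    2 * Wf χ (y / 2) - 4 * Wf χ (2 * y) ≤ 2 * (2 * Real.log 2 / y) + 2 * ((1 / y) * Lf (y / 2)) := by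
  have hs := sumS_all hy
  have hh := sumH_all hy
  have h1 := (abs_tsum_bound (ψ := fun k => χ (k + 1)) (fun k => hχ _) (fun k => by positivity) hs.1)
  have h2 := (abs_tsum_bound (ψ := fun k => χ (k + 1)) (fun k => hχ _) (fun k => by
    have : 0 < Real.sinh (y * ((k + 1 : ℕ) : ℝ)) := Real.sinh_pos_iff.mpr (by positivity)
    positivity) hh.1)
  have sh : ∀ c : ℝ, 0 < c → Wf χ c = ∑' k : ℕ, χ (k + 1) * (1 / (rexp (c * ((k + 1 : ℕ) : ℝ)) - 1)) := by
    intro c hc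
    rw [Wf, (Wf_summable hχ hc).tsum_eq_zero_add, h0, zero_mul, zero_add]
  have ss : ∀ c : ℝ, 0 < c → Summable (fun k : ℕ => χ (k + 1) * (1 / (rexp (c * ((k + 1 : ℕ) : ℝ)) - 1))) := by
    intro c hc
    exact (summable_nat_add_iff 1).mpr (Wf_summable hχ hc)
  have e : 2 * Wf χ (y / 2) - 4 * Wf χ (2 * y) =
      2 * ∑' k : ℕ, χ (k + 1) * (1 / (rexp (y * ((k + 1 : ℕ) : ℝ) / 2) + 1)) +
      2 * ∑' k : ℕ, χ (k + 1) * (1 / Real.sinh (y * ((k + 1 : ℕ) : ℝ))) := by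
    rw [sh _ (half_pos hy), sh _ (by positivity : 0 < 2 * y), ← tsum_mul_left, ← tsum_mul_left,
      ← tsum_mul_left, ← tsum_mul_left,
      ← Summable.tsum_sub ((ss _ (half_pos hy)).mul_left 2) ((ss _ (by positivity : 0 < 2 * y)).mul_left 4),
      ← Summable.tsum_add (h1.1.mul_left 2) (h2.1.mul_left 2)]
    refine tsum_congr fun k => ?_
    have h := P_id1 (t := y * ((k + 1 : ℕ) : ℝ)) (by positivity)
    have h' := P_id2 (t := y * ((k + 1 : ℕ) : ℝ)) (by positivity)
    rw [show y / 2 * ((k + 1 : ℕ) : ℝ) = y * ((k + 1 : ℕ) : ℝ) / 2 by ring,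
      show 2 * y * ((k + 1 : ℕ) : ℝ) = 2 * (y * ((k + 1 : ℕ) : ℝ)) by ring]
    linear_combination χ (k + 1) * h + 4 * χ (k + 1) * h'
  rw [e]
  have := le_abs_self (∑' k : ℕ, χ (k + 1) * (1 / (rexp (y * ((k + 1 : ℕ) : ℝ) / 2) + 1)))
  have := le_abs_self (∑' k : ℕ, χ (k + 1) * (1 / Real.sinh (y * ((k + 1 : ℕ) : ℝ))))
  linarith [h1.2, h2.2, hs.2, hh.2]

lemma Wf_ram_bound (hχ : ∀ n, |χ n| ≤ 1) (h2 : ∀ n, χ (2 * n) = 0) {y : ℝ} (hy : 0 < y) :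
    2 * Wf χ (y / 2) - 4 * Wf χ (2 * y) ≤
      2 * (Real.log 2 / y) + 2 * (1 / Real.sinh y + (1 / (2 * y)) * Lf (2 * y)) := by
  rw [Wf_ram hχ h2 (half_pos hy), Wf_ram hχ h2 (by positivity)]
  have h1 := (abs_le.mp (Wo_diff1 hχ hy)).2
  have h2 := (abs_le.mp (Wo_diff2 hχ hy)).2
  linarith

lemma Wf_inert_bound (hχ : ∀ n, |χ n| ≤ 1) (h2 : ∀ n, χ (2 * n) = - χ n) {y : ℝ} (hy : 0 < y) :
    2 * Wf χ (y / 2) - 4 * Wf χ (2 * y) ≤ 2 * (Real.log 2 / y) + |2 * Wf χ y| := by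
  have h1 := (abs_le.mp (Wo_diff1 hχ hy)).2
  have h3 := Wf_inert hχ h2 (half_pos hy)
  rw [show 2 * (y / 2) = y by ring] at h3
  have h4 := Wf_inert hχ h2 hy
  have := le_abs_self (2 * Wf χ y)
  linarith

lemma Vf_rec (hχ : ∀ n, |χ n| ≤ 1) (h2 : ∀ n, χ (2 * n) = - χ n) {y : ℝ} (hy : 0 < y) :
    |2 * Wf χ y| ≤ 1 / Real.sinh y + (1 / (2 * y)) * Lf (2 * y) + |2 * Wf χ (4 * y)| := by
  have h1 := Wo_diff2 hχ hy
  have h3 := Wf_inert hχ h2 hy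
  have h4 := Wf_inert hχ h2 (by positivity : 0 < 2 * y)
  rw [show 2 * (2 * y) = 4 * y by ring] at h4
  have e : 2 * Wf χ y = 2 * (Wo χ y - Wo χ (2 * y)) + 2 * Wf χ (4 * y) := by linarith
  rw [e]
  exact (abs_add_le _ _).trans (by linarith)

lemma Vf_large (hχ : ∀ n, |χ n| ≤ 1) (h0 : χ 0 = 0) {x : ℝ} (hx : 4 ≤ x) :
    |2 * Wf χ x| ≤ 2 * (50 / 49) / (rexp x - 1) := by
  have hx50 : 50 ≤ rexp x := by
    have h1 : rexp 4 ≤ rexp x := Real.exp_le_exp.mpr hx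
    have h2 : rexp 4 = rexp 1 ^ 4 := by rw [← Real.exp_nat_mul]; norm_num
    have h3 := Real.exp_one_gt_d9
    have h4 : (2.7:ℝ) ^ 4 ≤ rexp 1 ^ 4 := by gcongr; linarith
    norm_num at h4
    linarith
  have hg := hasSum_geometric_of_lt_one (r := (1:ℝ) / 50) (by norm_num) (by norm_num)
  have hg' := hg.mul_left (1 / (rexp x - 1))
  have hb : ∀ k : ℕ, ‖χ (k + 1) * (1 / (rexp (x * ((k + 1 : ℕ) : ℝ)) - 1))‖ ≤
      1 / (rexp x - 1) * (1 / 50) ^ k := by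
    intro k
    have hp := P_nonneg (c := x) (by linarith) (k + 1)
    rw [Real.norm_eq_abs, abs_mul, abs_of_nonneg hp]
    refine (mul_le_of_le_one_left hp (hχ _)).trans ?_
    have e : rexp (x * ((k + 1 : ℕ) : ℝ)) = rexp x ^ k * rexp x := by
      rw [← pow_succ, ← Real.exp_nat_mul]; congr 1; ring
    have hk : (50:ℝ) ^ k ≤ rexp x ^ k := by gcongr
    have hk1 : 1 ≤ rexp x ^ k := one_le_pow₀ (by linarith)
    have hp50 : (0:ℝ) < 50 ^ k := by positivity
    rw [e, one_div_pow, one_div_mul_one_div, one_div_le_one_div (by nlinarith) (by nlinarith)]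
    nlinarith
  have h := tsum_of_norm_bounded hg' hb
  have e : Wf χ x = ∑' k : ℕ, χ (k + 1) * (1 / (rexp (x * ((k + 1 : ℕ) : ℝ)) - 1)) := by
    rw [Wf, (Wf_summable hχ (by linarith)).tsum_eq_zero_add, h0, zero_mul, zero_add]
  rw [abs_mul, abs_of_pos (by norm_num : (0:ℝ) < 2), e]
  rw [Real.norm_eq_abs] at h
  norm_num at h ⊢
  calc _ ≤ _ := mul_le_mul_of_nonneg_left h (by norm_num)
    _ = _ := by ring
end Sums

section Numerics

lemma sinh_lower {y : ℝ} (hy : 0 ≤ y) : y * (1 + y ^ 2 / 6 + y ^ 4 / 120) ≤ Real.sinh y := by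
  have h := sum_le_hasSum (Finset.range 3) (fun i _ => by positivity) (Real.hasSum_sinh y)
  simp only [Finset.sum_range_succ, Finset.sum_range_zero] at h
  norm_num [Nat.factorial] at h
  linarith

lemma log_tangent {x a : ℝ} (hx : 0 < x) (ha : 0 < a) : Real.log x ≤ Real.log a + (x / a - 1) := by
  have h := Real.log_le_sub_one_of_pos (div_pos hx ha)
  rw [Real.log_div hx.ne' ha.ne'] at h
  linarith

lemma log_pi_ge : 2 * Real.log 2 - 1 / 4 ≤ Real.log π := by
  have h1 := Real.quadratic_le_exp_of_nonneg (x := 1 / 4) (by norm_num)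
  have h2 := Real.pi_gt_d2
  have h3 : Real.log (2 ^ 2) ≤ Real.log (π * rexp (1 / 4)) :=
    Real.log_le_log (by norm_num) (by nlinarith)
  rw [Real.log_pow, Real.log_mul (by positivity) (by positivity), Real.log_exp] at h3
  push_cast at h3
  linarith

lemma log_cosh_le (x : ℝ) : Real.log (Real.cosh x) ≤ x ^ 2 / 2 := by
  rw [Real.log_le_iff_le_exp (Real.cosh_pos x)]
  exact Real.cosh_le_exp_half_sq x

lemma log_sinh_ge {x : ℝ} (hx : 0 < x) : Real.log x ≤ Real.log (Real.sinh x) :=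
  Real.log_le_log hx (Real.self_le_sinh_iff.mpr hx.le)

lemma num_split {y : ℝ} (hy : 0 < y) (hy2 : y ≤ 2.82) :
    4 * Real.log 2 + 2 * Lf (y / 2) ≤ 2 * Real.log 2 + 2 * Real.log π - 2 * Real.log y + 4.2 := by
  have h1 := log_cosh_le (y / 2 / 2)
  have h2 := log_sinh_ge (x := y / 2 / 2) (by positivity)
  have h3 : Real.log (y / 2 / 2) = Real.log y - 2 * Real.log 2 := by
    rw [Real.log_div (by positivity) (by norm_num), Real.log_div (by positivity) (by norm_num)]; ring
  have h4 := Real.log_two_lt_d9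
  have h5 := log_pi_ge
  unfold Lf
  norm_num at hy2 ⊢
  nlinarith

lemma num_ram {y : ℝ} (hy : 0 < y) (hy2 : y ≤ 2.82) :
    4 * Real.log 2 + 4 * (y / Real.sinh y) + 2 * Lf (2 * y) ≤
      2 * Real.log 2 + 2 * Real.log π - 2 * Real.log y + 4.2 := by
  have hs : 0 < Real.sinh y := Real.sinh_pos_iff.mpr hy
  have h1 := sinh_lower hy.le
  have h2 : y / Real.sinh y ≤ 6 / (6 + y ^ 2) := by
    rw [div_le_div_iff₀ hs (by positivity)]
    have : 0 ≤ y ^ 5 := by positivity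
    nlinarith
  have h3 : Lf (2 * y) ≤ Real.log (1 + y) - Real.log y := by
    unfold Lf
    rw [show 2 * y / 2 = y by ring]
    have hk : y * Real.cosh y ≤ (1 + y) * Real.sinh y := by
      have e1 := Real.add_one_le_exp (2 * y)
      have e2 : rexp (2 * y) = rexp y * rexp y := by rw [← Real.exp_add]; congr 1; ring
      have e3 : rexp y * rexp (-y) = 1 := by rw [← Real.exp_add]; simp
      rw [Real.cosh_eq, Real.sinh_eq]
      have e4 : (2 * y + 1) * rexp (-y) ≤ rexp y := by
        calc (2 * y + 1) * rexp (-y) ≤ rexp (2 * y) * rexp (-y) := by gcongr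
          _ = rexp y := by rw [e2, mul_assoc, e3, mul_one]
      linarith
    have := Real.log_le_log (mul_pos hy (Real.cosh_pos y)) hk
    rw [Real.log_mul hy.ne' (Real.cosh_pos y).ne', Real.log_mul (by positivity) hs.ne'] at this
    linarith
  have h4 := log_tangent (x := 1 + y) (a := 2) (by positivity) (by norm_num)
  have h5 := log_pi_ge
  have h6 : 4 * (6 / (6 + y ^ 2)) + y ≤ 4.7 := by
    rw [← mul_div_assoc, div_add' _ _ _ (by positivity), div_le_iff₀ (by positivity)]
    norm_num at hy2 ⊢
    nlinarith [sq_nonneg (y - 4 / 5), mul_nonneg hy.le (sq_nonneg (y - 4 / 5)), mul_nonneg (by linarith : 0 ≤ 141 / 50 - y) (sq_nonneg (y - 4 / 5)), mul_nonneg hy.le (by linarith : 0 ≤ 141 / 50 - y)]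
  norm_num at h6 ⊢
  linarith

lemma num_step {y : ℝ} (hy : 0 < y) (hy1 : y < 1) :
    3 * (y / Real.sinh y) + 3 / 2 * Lf (2 * y) + (3.7 - 2 * Real.log (4 * y)) / 4 ≤
      3.7 - 2 * Real.log y := by
  have hs : 0 < Real.sinh y := Real.sinh_pos_iff.mpr hy
  have h1 := sinh_lower hy.le
  have h2 : y / Real.sinh y ≤ 6 / (6 + y ^ 2) := by
    rw [div_le_div_iff₀ hs (by positivity)]
    have : 0 ≤ y ^ 5 := by positivity
    nlinarith
  have h3 : Lf (2 * y) ≤ y ^ 2 / 2 - Real.log y := by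
    unfold Lf
    rw [show 2 * y / 2 = y by ring]
    linarith [log_cosh_le y, log_sinh_ge hy]
  have h4 : Real.log (4 * y) = 2 * Real.log 2 + Real.log y := by
    rw [Real.log_mul (by norm_num) hy.ne', show (4:ℝ) = 2 ^ 2 by norm_num, Real.log_pow]; push_cast; ring
  have h5 := Real.log_two_gt_d9
  have h6 : 3 * (6 / (6 + y ^ 2)) + 3 / 4 * y ^ 2 ≤ 3.4 := by
    rw [← mul_div_assoc, div_add' _ _ _ (by positivity), div_le_iff₀ (by positivity)]
    have : y ^ 2 ≤ 1 := by nlinarith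
    norm_num
    nlinarith [sq_nonneg y]
  rw [h4]
  norm_num at h6 h5 ⊢
  linarith

lemma num_base {y : ℝ} (hy1 : 1 ≤ y) (hy4 : y ≤ 4) :
    3 * (y / Real.sinh y) + 3 / 2 * Lf (2 * y) + 3 * y * (2 * (50 / 49) / (rexp (4 * y) - 1)) ≤
      3.7 - 2 * Real.log y := by
  have hy : 0 < y := by linarith
  have hs : 0 < Real.sinh y := Real.sinh_pos_iff.mpr hy
  have h1 := sinh_lower hy.le
  have hE : 3 * y * (2 * (50 / 49) / (rexp (4 * y) - 1)) ≤ 0.125 := by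
    have h50 : 50 ≤ rexp 4 := by
      have h2 : rexp 4 = rexp 1 ^ 4 := by rw [← Real.exp_nat_mul]; norm_num
      have h3 := Real.exp_one_gt_d9
      have h4 : (2.7:ℝ) ^ 4 ≤ rexp 1 ^ 4 := by gcongr; linarith
      norm_num at h4
      linarith
    have h2 : rexp (4 * y) = rexp 4 * rexp (4 * (y - 1)) := by rw [← Real.exp_add]; congr 1; ring
    have h3 := Real.add_one_le_exp (4 * (y - 1))
    have h4 : 49 * y ≤ rexp (4 * y) - 1 := by rw [h2]; nlinarith
    rw [← mul_div_assoc, div_le_iff₀ (by linarith)]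
    norm_num
    linarith
  have hL : Lf (2 * y) ≤ rexp (-y) / Real.sinh y := by
    unfold Lf
    rw [show 2 * y / 2 = y by ring, ← Real.log_div (Real.cosh_pos y).ne' hs.ne']
    have h := Real.log_le_sub_one_of_pos (div_pos (Real.cosh_pos y) hs)
    have e : rexp (-y) / Real.sinh y = Real.cosh y / Real.sinh y - 1 := by
      rw [← Real.cosh_sub_sinh, sub_div, div_self hs.ne']
    rw [e]; exact h
  have key : ∀ c e : ℝ, 0 ≤ e → rexp (-y) ≤ e → 0 < c → 2 * Real.log y ≤ 3.575 - c →
      3 * y + 3 / 2 * e ≤ c * (y * (1 + y ^ 2 / 6 + y ^ 4 / 120)) →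
      3 * (y / Real.sinh y) + 3 / 2 * Lf (2 * y) + 3 * y * (2 * (50 / 49) / (rexp (4 * y) - 1)) ≤
      3.7 - 2 * Real.log y := by
    intro c e he0 he hc hlog hpoly
    have h2 : (3 * y + 3 / 2 * rexp (-y)) / Real.sinh y ≤ c := by
      rw [div_le_iff₀ hs]
      have := mul_le_mul_of_nonneg_left h1 hc.le
      linarith
    have e : (3 * y + 3 / 2 * rexp (-y)) / Real.sinh y =
      3 * (y / Real.sinh y) + 3 / 2 * (rexp (-y) / Real.sinh y) := by ring
    norm_num at hE hlog ⊢
    linarith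
  have l2 := Real.log_two_lt_d9
  have he1 : rexp (-1) ≤ 0.368 := by
    rw [Real.exp_neg, inv_le_comm₀ (exp_pos _) (by norm_num)]
    have := Real.exp_one_gt_d9
    norm_num at this ⊢
    linarith
  rcases le_total y 2 with h | h
  · have lg := log_tangent hy (by norm_num : (0:ℝ) < 3 / 2)
    have l15 : Real.log (3 / 2) ≤ 0.4055 := by
      rw [Real.log_div (by norm_num) (by norm_num)]
      have := Real.log_three_lt_d9
      have := Real.log_two_gt_d9
      norm_num at *
      linarith
    refine key (3.575 - 0.811 - 2 * (y / (3 / 2) - 1)) 0.368 (by norm_num) ?_ (by linarith) (by linarith) ?_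
    · exact (Real.exp_le_exp.mpr (by linarith)).trans he1
    · have hc : 0 ≤ 3.575 - 0.811 - 2 * (y / (3 / 2) - 1) := by norm_num; linarith
      have hp : 3 * y + 3 / 2 * 0.368 ≤ (3.575 - 0.811 - 2 * (y / (3 / 2) - 1)) * (y * (1 + y ^ 2 / 6)) := by
        norm_num
        nlinarith [mul_nonneg (by linarith : 0 ≤ y - 1) (by linarith : 0 ≤ 2 - y),
          mul_nonneg (mul_nonneg (by linarith : 0 ≤ y - 1) (by linarith : 0 ≤ 2 - y)) hy.le,
          mul_nonneg (mul_nonneg (by linarith : 0 ≤ y - 1) (by linarith : 0 ≤ 2 - y)) (sq_nonneg y)]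
      refine hp.trans (mul_le_mul_of_nonneg_left ?_ hc)
      have : 0 ≤ y ^ 5 := by positivity
      nlinarith
  · have lg := log_tangent hy (by norm_num : (0:ℝ) < 3)
    have l3 : Real.log 3 ≤ 1.09865 := by
      have := Real.log_three_lt_d9
      norm_num at *
      linarith
    refine key (3.575 - 2.1973 - 2 * (y / 3 - 1)) 0.2 (by norm_num) ?_ (by linarith) (by linarith) ?_
    · have e2 : rexp (-y) ≤ rexp (-1) * rexp (-1) := by
        rw [← Real.exp_add]; exact Real.exp_le_exp.mpr (by linarith)
      have := exp_pos (-1)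
      norm_num at he1 ⊢
      nlinarith
    · have hc : 0 ≤ 3.575 - 2.1973 - 2 * (y / 3 - 1) := by norm_num; linarith
      have hp : 3 * y + 3 / 2 * 0.2 ≤ (3.575 - 2.1973 - 2 * (y / 3 - 1)) *
          (y * (71 / 120 + 34 / 120 * y ^ 2)) := by
        norm_num
        nlinarith [mul_nonneg (by linarith : 0 ≤ y - 2) (by linarith : 0 ≤ 4 - y),
          mul_nonneg (mul_nonneg (by linarith : 0 ≤ y - 2) (by linarith : 0 ≤ 4 - y)) hy.le,
          mul_nonneg (mul_nonneg (by linarith : 0 ≤ y - 2) (by linarith : 0 ≤ 4 - y)) (sq_nonneg y)]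
      refine hp.trans (mul_le_mul_of_nonneg_left ?_ hc)
      have := mul_nonneg hy.le (sq_nonneg (y ^ 2 - 7))
      nlinarith
end Numerics

section Final

lemma Vf_bound {χ : ℕ → ℝ} (hχ : ∀ n, |χ n| ≤ 1) (h0 : χ 0 = 0) (h2 : ∀ n, χ (2 * n) = - χ n) (n : ℕ) :
    ∀ y : ℝ, 0 < y → y ≤ 4 → 1 ≤ 4 ^ n * y → 3 * y * |2 * Wf χ y| ≤ 3.7 - 2 * Real.log y := by
  have hrec : ∀ y : ℝ, 0 < y → 3 * y * |2 * Wf χ y| ≤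
      3 * (y / Real.sinh y) + 3 / 2 * Lf (2 * y) + 3 * y * |2 * Wf χ (4 * y)| := by
    intro y hy
    have h := mul_le_mul_of_nonneg_left (Vf_rec hχ h2 hy) (by positivity : 0 ≤ 3 * y)
    refine h.trans (le_of_eq ?_)
    have : 0 < Real.sinh y := Real.sinh_pos_iff.mpr hy
    field_simp
  have hbase : ∀ y : ℝ, 1 ≤ y → y ≤ 4 → 3 * y * |2 * Wf χ y| ≤ 3.7 - 2 * Real.log y := by
    intro y hy1 hy4
    have h1 := hrec y (by linarith)
    have h3 := mul_le_mul_of_nonneg_left (Vf_large hχ h0 (x := 4 * y) (by linarith))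
      (by linarith : 0 ≤ 3 * y)
    have h4 := num_base hy1 hy4
    linarith
  induction n with
  | zero =>
    intro y hy hy4 h1
    exact hbase y (by simpa using h1) hy4
  | succ n ih =>
    intro y hy hy4 h1
    rcases le_or_gt 1 y with h | h
    · exact hbase y h hy4
    · have h3 := ih (4 * y) (by positivity) (by linarith) (by rw [pow_succ] at h1; linarith)
      have h4 := hrec y hy
      have h5 := num_step hy h
      linarith
end Final

/-- Let `K` be an imaginary quadratic field with discriminant `D_K < −4`
and class number `h`.  With `C = 2` if `D_K ≡ 1 (mod 8)`, `C = 4` if `D_K ≡ 0 (mod 4)`,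
and `C = 6` if `D_K ≡ 5 (mod 8)`, we have
`h ≤ (1/(C·π)) · √|D_K| · (log|D_K| + 4.2)`. -/
theorem classNumber_le_bound
    {K : Type*} [Field K] [NumberField K]
    (hdeg : Module.finrank ℚ K = 2) (hneg : NumberField.discr K < -4)
    (C : ℝ)
    (hC : C = if NumberField.discr K % 8 = 1 then 2
          else if NumberField.discr K % 4 = 0 then 4
          else 6) :
    (NumberField.classNumber K : ℝ) ≤
      (1 / (C * Real.pi)) * Real.sqrt |(NumberField.discr K : ℝ)| *
        (Real.log |(NumberField.discr K : ℝ)| + 4.2) := by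
  obtain ⟨y, hy⟩ : ∃ y : ℝ, y = 2 * π / √|(discr K : ℝ)| := ⟨_, rfl⟩
  have hq : (5:ℝ) ≤ |(discr K : ℝ)| := by
    have h : discr K ≤ -5 := by omega
    have h' : (discr K : ℝ) ≤ -5 := by exact_mod_cast h
    rw [abs_of_neg (by linarith)]; linarith
  have hform := classNumber_eq (K := K) hdeg hneg hy
  generalize |(discr K : ℝ)| = q at *
  have hq0 : 0 < √q := Real.sqrt_pos.mpr (by linarith)
  have hy0 : 0 < y := by rw [hy]; positivity
  have hsq : √q = 2 * π / y := by rw [hy]; field_simp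
  have hlog : Real.log q = 2 * Real.log 2 + 2 * Real.log π - 2 * Real.log y := by
    have e : q = (2 * π / y) ^ 2 := by rw [← hsq, Real.sq_sqrt (by linarith)]
    rw [e, Real.log_pow, Real.log_div (by positivity) hy0.ne', Real.log_mul (by norm_num) (by positivity)]
    push_cast; ring
  have hy2 : y ≤ 2.82 := by
    rw [hy, div_le_iff₀ hq0]
    have h1 : (2.236:ℝ) ≤ √q := by
      apply Real.le_sqrt_of_sq_le; norm_num; linarith
    have := Real.pi_lt_d2
    norm_num at *
    linarith
  set χ : ℕ → ℝ := fun n => (chi K n : ℝ) with hχdef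
  have hχ : ∀ n, |χ n| ≤ 1 := fun n => by
    have := chi_abs_le (K := K) hdeg n
    simp only [hχdef]
    exact_mod_cast this
  have h0 : χ 0 = 0 := by simp [hχdef, chi_zero]
  have hform' : (classNumber K : ℝ) = 2 * Wf χ (y / 2) - 4 * Wf χ (2 * y) := hform
  have hgoal : 1 / (C * π) * √q * (Real.log q + 4.2) = 2 / (C * y) *
      (2 * Real.log 2 + 2 * Real.log π - 2 * Real.log y + 4.2) := by
    rw [hlog, hsq]
    have := Real.pi_pos.ne'
    congr 1
    field_simp
  rw [hform', hgoal]
  by_cases h8 : discr K % 8 = 1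
  · rw [if_pos h8] at hC
    subst hC
    refine (Wf_all hχ h0 hy0).trans ?_
    have h := num_split hy0 hy2
    have e1 : 2 * (2 * Real.log 2 / y) + 2 * ((1 / y) * Lf (y / 2)) =
      2 / (2 * y) * (4 * Real.log 2 + 2 * Lf (y / 2)) := by field_simp; ring
    rw [e1]
    exact mul_le_mul_of_nonneg_left h (by positivity)
  rw [if_neg h8] at hC
  by_cases h4 : discr K % 4 = 0
  · rw [if_pos h4] at hC
    subst hC
    have hc2 := chi_two_ram (K := K) hdeg (by omega) h4
    have h2 : ∀ n, χ (2 * n) = 0 := fun n => by simp [hχdef, chi_mul, hc2]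
    refine (Wf_ram_bound hχ h2 hy0).trans ?_
    have h := num_ram hy0 hy2
    have hs : 0 < Real.sinh y := Real.sinh_pos_iff.mpr hy0
    have e1 : 2 * (Real.log 2 / y) + 2 * (1 / Real.sinh y + (1 / (2 * y)) * Lf (2 * y)) =
      2 / (4 * y) * (4 * Real.log 2 + 4 * (y / Real.sinh y) + 2 * Lf (2 * y)) := by
      field_simp; ring
    rw [e1]
    exact mul_le_mul_of_nonneg_left h (by positivity)
  · rw [if_neg h4] at hC
    subst hC
    have h5 : discr K % 8 = 5 := by
      have := discr_mod_four (K := K) hdeg (by omega)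
      omega
    have hc2 := chi_two_inert (K := K) hdeg (by omega) h5
    have h2 : ∀ n, χ (2 * n) = - χ n := fun n => by simp [hχdef, chi_mul, hc2]
    refine (Wf_inert_bound hχ h2 hy0).trans ?_
    obtain ⟨n, hn⟩ := pow_unbounded_of_one_lt (1 / y) (by norm_num : (1:ℝ) < 4)
    have hV := Vf_bound hχ h0 h2 n y hy0 (by norm_num at hy2; linarith)
      (by rw [div_lt_iff₀ hy0] at hn; exact hn.le)
    have e1 : 2 * (Real.log 2 / y) + |2 * Wf χ y| =
      2 / (6 * y) * (6 * Real.log 2 + 3 * y * |2 * Wf χ y|) := by field_simp; ring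
    rw [e1]
    refine mul_le_mul_of_nonneg_left ?_ (by positivity)
    have := log_pi_ge
    norm_num at hV ⊢
    linarith
end

section
/- For every prime number ℓ, ℓ does not divide the class number of the ring of integers of the imaginary quadratic field ℚ(√−ℓ). -/
open NumberField

/-- A reduced lattice in `ℚ × ℚ` (pairs `(p, q)` standing for `p + q √-ℓ`). -/
theorem lattice_core (ℓ : ℕ) (L : AddSubgroup (ℚ × ℚ))
    (h1 : ((1 : ℚ), (0 : ℚ)) ∈ L)
    (hs : ∀ p q : ℚ, (p, q) ∈ L → (-(ℓ : ℚ) * q, p) ∈ L)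
    (hmin : ∀ p q : ℚ, (p, q) ∈ L → (p ≠ 0 ∨ q ≠ 0) → 1 ≤ p ^ 2 + ℓ * q ^ 2)
    (D : ℕ) (hD : 0 < D) (hden : ∀ p q : ℚ, (p, q) ∈ L → ∃ k : ℤ, (D : ℚ) * q = k) :
    ∃ a b : ℕ, b < a ∧ 3 * a ^ 2 ≤ 4 * ℓ ∧ a ∣ b ^ 2 + ℓ ∧
      ∀ p q : ℚ, (p, q) ∈ L ↔ ∃ m n : ℤ, p = m + n * b / a ∧ q = n / a := by
  have hint : ∀ k : ℤ, ((k : ℚ), (0 : ℚ)) ∈ L := by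
    intro k
    have := L.zsmul_mem h1 k
    simpa using this
  have hrat : ∀ p : ℚ, (p, (0 : ℚ)) ∈ L → ∃ k : ℤ, p = k := by
    intro p hp
    refine ⟨⌊p⌋, ?_⟩
    have h2 := L.sub_mem hp (hint ⌊p⌋)
    rw [Prod.mk_sub_mk, sub_zero] at h2
    by_contra hne
    have h3 := hmin _ _ h2 (Or.inl (sub_ne_zero.2 hne))
    have h4 := Int.floor_le p
    have h5 := Int.lt_floor_add_one p
    nlinarith
  have hD0 : (D : ℚ) ≠ 0 := by positivity
  have hex : ∃ m : ℕ, 0 < m ∧ ∃ p : ℚ, (p, (m : ℚ) / D) ∈ L := by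
    refine ⟨D, hD, 0, ?_⟩
    have := hs _ _ h1
    rw [div_self hD0]
    simpa using this
  classical
  obtain ⟨hm0, t, ht⟩ := Nat.find_spec hex
  have hmm := fun k => @Nat.find_min _ _ hex k
  set m := Nat.find hex with hm
  clear_value m
  have hdiv : ∀ p q : ℚ, (p, q) ∈ L → ∃ n : ℤ, (D : ℚ) * q = n * m := by
    intro p q hpq
    obtain ⟨k, hk⟩ := hden p q hpq
    have hm0' : (0 : ℤ) < m := by exact_mod_cast hm0
    have e1 := Int.emod_add_mul_ediv k m
    have e2 := Int.emod_nonneg k hm0'.ne'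
    have e3 := Int.emod_lt_of_pos k hm0'
    obtain ⟨r, hr⟩ := Int.eq_ofNat_of_zero_le e2
    refine ⟨k / m, ?_⟩
    have h2 := L.sub_mem hpq (L.zsmul_mem ht (k / m))
    rw [Prod.smul_mk, Prod.mk_sub_mk] at h2
    rw [hr] at e1 e3
    have e1' : (r : ℚ) + m * ((k / m : ℤ) : ℚ) = k := by exact_mod_cast e1
    have h3 : q - (k / m : ℤ) • ((m : ℚ) / D) = (r : ℚ) / D := by
      rw [zsmul_eq_mul, eq_div_iff hD0]
      field_simp
      linarith
    rw [h3] at h2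
    have hr0 : r = 0 := by
      by_contra hr0
      exact hmm r (by exact_mod_cast e3) ⟨Nat.pos_of_ne_zero hr0, _, h2⟩
    rw [hr0] at e1'
    rw [hk, ← e1']
    push_cast
    ring
  have h01 : ((0 : ℚ), (1 : ℚ)) ∈ L := by
    have := hs _ _ h1
    simpa using this
  obtain ⟨a', ha'⟩ := hdiv _ _ h01
  have ha'pos : 0 < a' := by
    have : (D : ℤ) = a' * m := by
      have := ha'
      rw [mul_one] at this
      exact_mod_cast this
    by_contra hneg
    push Not at hneg
    have : (0 : ℤ) < D := by exact_mod_cast hD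
    have : (0 : ℤ) < m := by exact_mod_cast hm0
    nlinarith
  obtain ⟨a, rfl⟩ := Int.eq_ofNat_of_zero_le ha'pos.le
  have hapos : 0 < a := by exact_mod_cast ha'pos
  have ha0 : (a : ℚ) ≠ 0 := by positivity
  have hm0Q : (m : ℚ) ≠ 0 := by positivity
  have hDa : (D : ℚ) = a * m := by simpa using ha'
  have hmD : (m : ℚ) / D = 1 / a := by
    rw [hDa]
    field_simp
  rw [hmD] at ht
  have hq : ∀ p q : ℚ, (p, q) ∈ L → ∃ n : ℤ, q = n / a := by
    intro p q hpq
    obtain ⟨n, hn⟩ := hdiv p q hpq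
    refine ⟨n, ?_⟩
    rw [hDa] at hn
    rw [eq_div_iff ha0]
    apply mul_right_cancel₀ hm0Q
    linarith
  have h2 := L.sub_mem (L.nsmul_mem ht a) h01
  have h3 : a • ((t : ℚ), (1 : ℚ) / a) - (0, 1) = (a * t, 0) := by
    simp [ha0]
  rw [h3] at h2
  obtain ⟨c, hc⟩ := hrat _ h2
  have hshift : ∀ k : ℤ, (((c + k * a : ℤ) : ℚ) / a, (1 : ℚ) / a) ∈ L := by
    intro k
    have := L.add_mem ht (hint k)
    rw [Prod.mk_add_mk, add_zero] at this
    convert this using 2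
    push_cast
    rw [← hc]
    field_simp
  have hemod := Int.emod_nonneg c ha'pos.ne'
  obtain ⟨b, hb⟩ := Int.eq_ofNat_of_zero_le hemod
  have hba : b < a := by
    have := Int.emod_lt_of_pos c ha'pos
    rw [hb] at this
    exact_mod_cast this
  have hbc : (b : ℤ) = c + (-(c / a)) * a := by
    have := Int.emod_add_mul_ediv c a
    rw [hb] at this
    linarith
  have hτ : ∀ k : ℤ, (((b + k * a : ℤ) : ℚ) / a, (1 : ℚ) / a) ∈ L := by
    intro k
    have := hshift (-(c / a) + k)
    convert this using 4
    rw [hbc]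
    ring
  have hτ0 : ((b : ℚ) / a, (1 : ℚ) / a) ∈ L := by simpa using hτ 0
  have hmem : ∀ p q : ℚ, (p, q) ∈ L ↔ ∃ m n : ℤ, p = m + n * b / a ∧ q = n / a := by
    intro p q
    constructor
    · intro hpq
      obtain ⟨n, hn⟩ := hq p q hpq
      have h4 := L.sub_mem hpq (L.zsmul_mem hτ0 n)
      have h5 : (p, q) - n • ((b : ℚ) / a, (1 : ℚ) / a) = (p - n * b / a, 0) := by
        ext
        · simp [mul_div_assoc]
        · simp [hn, div_eq_mul_inv]
      rw [h5] at h4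
      obtain ⟨k, hk⟩ := hrat _ h4
      exact ⟨k, n, by linarith, hn⟩
    · rintro ⟨k, n, rfl, rfl⟩
      have := L.add_mem (hint k) (L.zsmul_mem hτ0 n)
      convert this using 1
      ext
      · simp [mul_div_assoc]
      · simp [div_eq_mul_inv]
  refine ⟨a, b, hba, ?_, ?_, hmem⟩
  · have key : ∃ k : ℤ, 4 * (b + k * a) ^ 2 ≤ (a : ℤ) ^ 2 := by
      by_cases h : 2 * b ≤ a
      · refine ⟨0, ?_⟩
        have : 2 * (b : ℤ) ≤ a := by exact_mod_cast h
        have : (0 : ℤ) ≤ b := by positivity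
        nlinarith
      · refine ⟨-1, ?_⟩
        push Not at h
        have : (a : ℤ) < 2 * b := by exact_mod_cast h
        have : (b : ℤ) < a := by exact_mod_cast hba
        nlinarith
    obtain ⟨k, hk⟩ := key
    have h6 := hmin _ _ (hτ k) (Or.inr (by positivity))
    rw [div_pow, div_pow, mul_div_assoc', ← add_div, le_div_iff₀ (by positivity)] at h6
    have h7 : (a : ℤ) ^ 2 ≤ (b + k * a) ^ 2 + ℓ := by
      have : (a : ℚ) ^ 2 ≤ ((b + k * a : ℤ) : ℚ) ^ 2 + ℓ := by linarith
      exact_mod_cast this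
    zify
    linarith
  · have h8 := hs _ _ hτ0
    obtain ⟨k, n, e1, e2⟩ := (hmem _ _).1 h8
    have hn : (n : ℚ) = b := by
      field_simp at e2
      exact e2.symm
    rw [hn] at e1
    field_simp at e1
    have : (b : ℚ) ^ 2 + ℓ = a * (-k) := by linarith
    have h9 : ((b ^ 2 + ℓ : ℕ) : ℤ) = a * (-k) := by exact_mod_cast this
    exact Int.natCast_dvd_natCast.1 ⟨_, h9⟩

/-- The finite set of reduced pairs. -/
def redPairs (ℓ : ℕ) : Finset (ℕ × ℕ) :=
  ((Finset.range (ℓ + 2)).sigma (fun a => Finset.range a)).image (fun x => (x.1, x.2)) |>.filter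
    (fun x => 3 * x.1 ^ 2 ≤ 4 * ℓ ∧ x.1 ∣ x.2 ^ 2 + ℓ)

theorem mem_redPairs {ℓ a b : ℕ} (h1 : b < a) (h2 : 3 * a ^ 2 ≤ 4 * ℓ) (h3 : a ∣ b ^ 2 + ℓ) :
    (a, b) ∈ redPairs ℓ := by
  simp only [redPairs, Finset.mem_filter, Finset.mem_image, Finset.mem_sigma, Finset.mem_range]
  refine ⟨⟨⟨a, b⟩, ⟨?_, h1⟩, rfl⟩, h2, h3⟩
  simp only
  nlinarith

theorem card_redPairs_lt {ℓ : ℕ} (hℓ : 2 ≤ ℓ) : (redPairs ℓ).card < ℓ := by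
  by_cases h3 : ℓ ≤ 3
  · interval_cases ℓ <;> decide
  push Not at h3
  set A := Nat.sqrt (4 * ℓ / 3) with hA
  have hA2 : 3 * A ^ 2 ≤ 4 * ℓ := by
    have := Nat.sqrt_le' (4 * ℓ / 3)
    rw [← hA] at this
    omega
  have hsub : redPairs ℓ ⊆
      ((Finset.range (A + 1)).sigma (fun a => Finset.range a)).image (fun x => (x.1, x.2)) := by
    rintro ⟨a, b⟩ hx
    simp only [redPairs, Finset.mem_filter, Finset.mem_image, Finset.mem_sigma,
      Finset.mem_range] at hx ⊢
    obtain ⟨⟨⟨a', b'⟩, ⟨h, h'⟩, e⟩, h4, h5⟩ := hx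
    simp only [Prod.mk.injEq] at e
    obtain ⟨rfl, rfl⟩ := e
    refine ⟨⟨a', b'⟩, ⟨?_, h'⟩, rfl⟩
    have : a' ≤ A := by
      rw [hA, Nat.le_sqrt']
      omega
    simp only
    omega
  have hcard := (Finset.card_le_card hsub).trans Finset.card_image_le
  rw [Finset.card_sigma] at hcard
  simp only [Finset.card_range] at hcard
  have hg := Finset.sum_range_id_mul_two (A + 1)
  simp only [Nat.add_sub_cancel] at hg
  have hlt : 3 * A < 2 * ℓ := by
    by_contra hh
    push Not at hh
    nlinarith
  nlinarith

theorem quad_coords {ℓ : ℕ} (hℓ : ℓ.Prime) {K : Type*} [Field K] [NumberField K]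
    (hdeg : Module.finrank ℚ K = 2) (s : K) (hs : s ^ 2 = -(ℓ : K)) :
    (∀ x : K, ∃ p q : ℚ, x = p + q * s) ∧
    (∀ p q : ℚ, Algebra.norm ℚ ((p : K) + q * s) = p ^ 2 + ℓ * q ^ 2) ∧
    (∀ p q : ℚ, Algebra.trace ℚ K ((p : K) + q * s) = 2 * p) := by
  have hℓ0 : (0 : ℚ) < ℓ := by exact_mod_cast hℓ.pos
  have hli : LinearIndependent ℚ ![(1 : K), s] := by
    rw [LinearIndependent.pair_iff]
    intro p q h
    rw [Rat.smul_def, Rat.smul_def, mul_one] at h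
    have h1 : (p : K) ^ 2 + ℓ * q ^ 2 = 0 := by
      have : ((p : K) + q * s) * (p - q * s) = 0 := by rw [h, zero_mul]
      linear_combination this + q ^ 2 * hs
    have h2 : p ^ 2 + ℓ * q ^ 2 = 0 := by exact_mod_cast h1
    have h3 : q ^ 2 = 0 := by nlinarith [sq_nonneg p, sq_nonneg q]
    have h4 : p ^ 2 = 0 := by rw [h3] at h2; linarith
    exact ⟨by simpa using h4, by simpa using h3⟩
  let B := basisOfLinearIndependentOfCardEqFinrank hli (by simp [hdeg])
  have hB : (B : Fin 2 → K) = ![1, s] := by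
    simp [B]
  have hB0 : B 0 = 1 := by simp [hB]
  have hB1 : B 1 = s := by simp [hB]
  have hrep : ∀ p q : ℚ, B.repr ((p : K) + q * s) = Finsupp.single 0 p + Finsupp.single 1 q := by
    intro p q
    have : (p : K) + q * s = p • B 0 + q • B 1 := by
      rw [hB0, hB1, Rat.smul_def, Rat.smul_def, mul_one]
    rw [this]
    simp
  have hmat : ∀ p q : ℚ, Algebra.leftMulMatrix B ((p : K) + q * s) = !![p, -ℓ * q; q, p] := by
    intro p q
    have e0 : ((p : K) + q * s) * B 0 = p + q * s := by rw [hB0, mul_one]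
    have e1 : ((p : K) + q * s) * B 1 = ((-ℓ * q : ℚ) : K) + (p : ℚ) * s := by
      rw [hB1]
      push_cast
      linear_combination (q : K) * hs
    ext i j
    rw [Algebra.leftMulMatrix_eq_repr_mul]
    fin_cases j
    · simp only [Fin.zero_eta]
      rw [e0, hrep]
      fin_cases i <;> simp
    · simp only [Fin.mk_one]
      rw [e1, hrep]
      fin_cases i <;> simp
  refine ⟨?_, ?_, ?_⟩
  · intro x
    refine ⟨B.repr x 0, B.repr x 1, ?_⟩
    have := B.sum_repr x
    rw [Fin.sum_univ_two, hB0, hB1, Rat.smul_def, Rat.smul_def, mul_one] at this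
    exact this.symm
  · intro p q
    rw [Algebra.norm_eq_matrix_det B, hmat, Matrix.det_fin_two_of]
    ring
  · intro p q
    rw [Algebra.trace_eq_matrix_trace B, hmat, Matrix.trace_fin_two_of]
    ring

theorem ideal_reduced {ℓ : ℕ} (hℓ : ℓ.Prime) {K : Type*} [Field K] [NumberField K]
    (hdeg : Module.finrank ℚ K = 2) (s : K) (hs : s ^ 2 = -(ℓ : K))
    (I : Ideal (𝓞 K)) (hI : I ≠ ⊥) :
    ∃ (α : 𝓞 K) (a b : ℕ), α ≠ 0 ∧ (a, b) ∈ redPairs ℓ ∧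
      ∀ p q : ℚ, (∃ y ∈ I, (y : K) = α * (p + q * s)) ↔
        ∃ m n : ℤ, p = m + n * b / a ∧ q = n / a := by
  obtain ⟨hco, hnorm, htr⟩ := quad_coords hℓ hdeg s hs
  have hsint : IsIntegral ℤ s := by
    refine IsIntegral.of_pow (n := 2) (by norm_num) ?_
    rw [hs]
    have h := (isIntegral_algebraMap (R := ℤ) (A := K) (x := (ℓ : ℤ))).neg
    simpa using h
  obtain ⟨σ, hσ⟩ : ∃ σ : 𝓞 K, (σ : K) = s := ⟨⟨s, hsint⟩, rfl⟩
  -- element of minimal norm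
  have hex : ∃ n : ℕ, ∃ α ∈ I, α ≠ 0 ∧ (Algebra.norm ℤ α).natAbs = n := by
    obtain ⟨x, hx, hx0⟩ := Submodule.exists_mem_ne_zero_of_ne_bot hI
    exact ⟨_, x, hx, hx0, rfl⟩
  classical
  obtain ⟨α, hαI, hα0, hαn⟩ := Nat.find_spec hex
  have hαmin : ∀ y ∈ I, y ≠ 0 → (Algebra.norm ℤ α).natAbs ≤ (Algebra.norm ℤ y).natAbs := by
    intro y hy hy0
    rw [hαn]
    exact Nat.find_min' hex ⟨y, hy, hy0, rfl⟩
  have hαK : (α : K) ≠ 0 := by simpa using hα0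
  let L : AddSubgroup (ℚ × ℚ) :=
    { carrier := {x | ∃ y ∈ I, (y : K) = α * (x.1 + x.2 * s)}
      zero_mem' := ⟨0, I.zero_mem, by simp⟩
      add_mem' := by
        rintro x x' ⟨y, hy, e⟩ ⟨y', hy', e'⟩
        refine ⟨y + y', I.add_mem hy hy', ?_⟩
        simp only [map_add, e, e', Prod.fst_add, Prod.snd_add]
        push_cast
        ring
      neg_mem' := by
        rintro x ⟨y, hy, e⟩
        refine ⟨-y, I.neg_mem hy, ?_⟩
        simp only [map_neg, e, Prod.fst_neg, Prod.snd_neg]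
        push_cast
        ring }
  have hL : ∀ p q : ℚ, (p, q) ∈ L ↔ ∃ y ∈ I, (y : K) = α * (p + q * s) := fun p q => Iff.rfl
  -- a multiple of α in ℤ
  have hdvd : α ∣ (Ideal.absNorm (Ideal.span {α}) : 𝓞 K) :=
    Ideal.mem_span_singleton.1 (Ideal.absNorm_mem _)
  obtain ⟨β, hβ⟩ := hdvd
  set N := Ideal.absNorm (Ideal.span {α}) with hN
  have hN0 : 0 < N := by
    refine Nat.pos_of_ne_zero ?_
    rw [hN, Ne, Ideal.absNorm_eq_zero_iff, Ideal.span_singleton_eq_bot]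
    exact hα0
  obtain ⟨a, b, h1, h2, h3, h4⟩ := lattice_core ℓ L
    ((hL _ _).2 ⟨α, hαI, by simp⟩)
    (by
      intro p q hpq
      obtain ⟨y, hy, e⟩ := (hL _ _).1 hpq
      refine (hL _ _).2 ⟨σ * y, I.mul_mem_left _ hy, ?_⟩
      push_cast
      change (σ : K) * (y : K) = _
      rw [e, hσ]
      linear_combination (α : K) * q * hs)
    (by
      intro p q hpq hne
      obtain ⟨y, hy, e⟩ := (hL _ _).1 hpq
      have hpos : 0 < p ^ 2 + ℓ * q ^ 2 := by
        have : (0 : ℚ) < ℓ := by exact_mod_cast hℓ.pos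
        rcases hne with h | h <;> positivity
      have hy0 : y ≠ 0 := by
        rintro rfl
        have h5 : (p : K) + q * s = 0 := by
          have : (α : K) * (p + q * s) = 0 := by simpa using e.symm
          exact (mul_eq_zero.1 this).resolve_left hαK
        have := hnorm p q
        rw [h5] at this
        have hn : Module.finrank ℚ K ≠ 0 := by omega
        rw [Algebra.norm_zero] at this
        linarith
      have h6 := hαmin y hy hy0
      have h7 : (Algebra.norm ℤ y : ℚ) = Algebra.norm ℤ α * (p ^ 2 + ℓ * q ^ 2) := by
        rw [Algebra.coe_norm_int, Algebra.coe_norm_int, e, map_mul, hnorm]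
      have h8 : |(Algebra.norm ℤ α : ℚ)| ≤ |(Algebra.norm ℤ y : ℚ)| := by
        have : |Algebra.norm ℤ α| ≤ |Algebra.norm ℤ y| := by
          rw [Int.abs_eq_natAbs, Int.abs_eq_natAbs]
          exact_mod_cast h6
        exact_mod_cast this
      have h9 : 0 < |(Algebra.norm ℤ α : ℚ)| := by
        rw [abs_pos, Algebra.coe_norm_int]
        exact Algebra.norm_ne_zero_iff.2 hαK
      rw [h7, abs_mul, abs_of_pos hpos] at h8
      exact (le_mul_iff_one_le_right h9).1 h8)
    (2 * ℓ * N) (by have := hℓ.pos; positivity)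
    (by
      intro p q hpq
      obtain ⟨y, hy, e⟩ := (hL _ _).1 hpq
      refine ⟨-Algebra.trace ℤ (𝓞 K) (y * β * σ), ?_⟩
      have hβ' : (α : K) * β = N := by
        have := congrArg (algebraMap (𝓞 K) K) hβ
        simpa using this.symm
      have h5 : ((y * β * σ : 𝓞 K) : K) = ((N * (-ℓ * q) : ℚ) : K) + ((N * p : ℚ) : K) * s := by
        push_cast
        change (y : K) * (β : K) * (σ : K) = _
        rw [e, hσ]
        linear_combination (p + q * s) * s * hβ' + (N : K) * q * hs
      have h6 := Algebra.coe_trace_int (y * β * σ)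
      rw [h5, htr] at h6
      push_cast
      rw [h6]
      ring)
  exact ⟨α, a, b, hα0, mem_redPairs h1 h2 h3, fun p q => (hL p q).symm.trans (h4 p q)⟩

/-- For every prime `ℓ`, `ℓ` does not divide the class number of the
ring of integers of `ℚ(√−ℓ)` (formalised as: any number field of degree `2` over `ℚ`
containing a square root of `−ℓ`, which is necessarily `ℚ(√−ℓ)`). -/
theorem prime_not_dvd_classNumber_sqrt_neg_self
    (ℓ : ℕ) (hℓ : ℓ.Prime)
    (K : Type*) [Field K] [NumberField K]
    (hdeg : Module.finrank ℚ K = 2)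
    (hsqrt : ∃ α : K, α ^ 2 = -(ℓ : K)) :
    ¬ (ℓ ∣ NumberField.classNumber K) := by
  obtain ⟨s, hs⟩ := hsqrt
  obtain ⟨hco, -, -⟩ := quad_coords hℓ hdeg s hs
  have hrep : ∀ C : ClassGroup (𝓞 K), ∃ (I : nonZeroDivisors (Ideal (𝓞 K))) (α : 𝓞 K) (x : ℕ × ℕ),
      ClassGroup.mk0 I = C ∧ α ≠ 0 ∧ x ∈ redPairs ℓ ∧
      ∀ p q : ℚ, (∃ y ∈ (I : Ideal (𝓞 K)), (y : K) = α * (p + q * s)) ↔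
        ∃ m n : ℤ, p = m + n * x.2 / x.1 ∧ q = n / x.1 := by
    intro C
    obtain ⟨I, hI⟩ := ClassGroup.mk0_surjective C
    obtain ⟨α, a, b, h1, h2, h3⟩ := ideal_reduced hℓ hdeg s hs (I : Ideal (𝓞 K))
      (nonZeroDivisors.coe_ne_zero I)
    exact ⟨I, α, (a, b), hI, h1, h2, h3⟩
  choose I α x hIC hα hx hmem using hrep
  have hsub : ∀ C C', x C = x C' → ∀ z, z ∈ Ideal.span {α C'} * (I C : Ideal (𝓞 K)) →
      z ∈ Ideal.span {α C} * (I C' : Ideal (𝓞 K)) := by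
    intro C C' h z hz
    rw [Ideal.mem_span_singleton_mul] at hz ⊢
    obtain ⟨y, hy, rfl⟩ := hz
    have hαK : (α C : K) ≠ 0 := by simpa using hα C
    obtain ⟨p, q, hpq⟩ := hco ((y : K) / α C)
    have e1 : (y : K) = α C * (p + q * s) := by
      rw [← hpq]
      field_simp
    have h5 := (hmem C p q).1 ⟨y, hy, e1⟩
    rw [h] at h5
    obtain ⟨y', hy', e2⟩ := (hmem C' p q).2 h5
    refine ⟨y', hy', ?_⟩
    apply RingOfIntegers.coe_injective
    rw [map_mul, map_mul]
    change (α C : K) * (y' : K) = (α C' : K) * (y : K)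
    rw [e1, e2]
    ring
  have hinj : Function.Injective x := by
    intro C C' h
    rw [← hIC C, ← hIC C', ClassGroup.mk0_eq_mk0_iff]
    exact ⟨α C', α C, hα C', hα C, le_antisymm (hsub C C' h) (hsub C' C h.symm)⟩
  have hle : NumberField.classNumber K ≤ (redPairs ℓ).card := by
    have := Finset.card_le_card_of_injOn (s := Finset.univ) x (fun C _ => hx C) hinj.injOn
    rwa [Finset.card_univ] at this
  have hpos : 0 < NumberField.classNumber K := NumberField.classNumber_pos K
  intro hdvd
  have := Nat.le_of_dvd hpos hdvd
  have := card_redPairs_lt hℓ.two_le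
  omega
end

section
/- Let ℓ be a prime, K an imaginary quadratic field in which ℓ is ramified, and d ≥ 1. Assume that either ℓ = 2 and D_K ≡ 8 (mod 16), or ℓ = 3 and D_K ≡ 3 (mod 9), or ℓ ≥ 5. Then λ_d, the cokernel of the natural homomorphism (ℤ/ℓ^dℤ)ˣ → (O_K/ℓ^dO_K)ˣ, is cyclic of order ℓ^d. -/
open NumberField

theorem quad_basis {K : Type*} [Field K] [NumberField K] (hdeg : Module.finrank ℚ K = 2) :
    ∃ (w : 𝓞 K) (s t : ℤ), w * w = s + t * w ∧ NumberField.discr K = t ^ 2 + 4 * s ∧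
      (∀ z : 𝓞 K, ∃ x y : ℤ, z = x + y * w) ∧
      (∀ x y : ℤ, (x : 𝓞 K) + y * w = 0 → x = 0 ∧ y = 0) := by
  have hr : Module.finrank ℤ (𝓞 K) = 2 := by rw [RingOfIntegers.rank, hdeg]
  obtain ⟨b⟩ : Nonempty (Module.Basis (Fin 2) ℤ (𝓞 K)) := ⟨Module.finBasisOfFinrankEq ℤ (𝓞 K) hr⟩
  have hb : ∀ z : 𝓞 K, z = (b.repr z 0 : 𝓞 K) * b 0 + (b.repr z 1 : 𝓞 K) * b 1 := by
    intro z
    conv_lhs => rw [← b.sum_repr z]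
    simp [Fin.sum_univ_two]
  have hli : ∀ x y : ℤ, (x : 𝓞 K) * b 0 + y * b 1 = 0 → x = 0 ∧ y = 0 := by
    intro x y h
    have := Fintype.linearIndependent_iff.1 b.linearIndependent ![x, y]
      (by simpa [Fin.sum_univ_two] using h)
    exact ⟨this 0, this 1⟩
  obtain ⟨p, hp⟩ : ∃ p, p = b.repr 1 0 := ⟨_, rfl⟩
  obtain ⟨q, hq⟩ : ∃ q, q = b.repr 1 1 := ⟨_, rfl⟩
  have h1 := hb 1
  rw [← hp, ← hq] at h1
  have hco : IsCoprime p q := by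
    rw [Int.isCoprime_iff_gcd_eq_one]
    obtain ⟨p', hp'⟩ := Int.gcd_dvd_left p q
    obtain ⟨q', hq'⟩ := Int.gcd_dvd_right p q
    have hu : IsUnit (((Int.gcd p q : ℤ)) : 𝓞 K) := by
      refine IsUnit.of_mul_eq_one ((p' : 𝓞 K) * b 0 + q' * b 1) ?_
      rw [h1]
      nth_rewrite 2 [hp']
      nth_rewrite 3 [hq']
      push_cast; ring
    have := (hu.map (Algebra.norm ℤ))
    rw [← eq_intCast (algebraMap ℤ (𝓞 K)), Algebra.norm_algebraMap, hr, isUnit_pow_iff (by norm_num),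
      Int.isUnit_iff_natAbs_eq] at this
    simpa using this
  obtain ⟨u, v, huv⟩ := hco
  have huv' : (u : 𝓞 K) * p + v * q = 1 := by exact_mod_cast huv
  obtain ⟨w, hw⟩ : ∃ w : 𝓞 K, w = -v * b 0 + u * b 1 := ⟨_, rfl⟩
  have hb0 : b 0 = u - q * w := by
    rw [hw]; linear_combination (-b 0) * huv' + (- u : 𝓞 K) * h1
  have hb1 : b 1 = v + p * w := by
    rw [hw]; linear_combination (-b 1) * huv' + (- v : 𝓞 K) * h1
  have hspan : ∀ z : 𝓞 K, ∃ x y : ℤ, z = x + y * w := by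
    intro z
    refine ⟨b.repr z 0 * u + b.repr z 1 * v, - b.repr z 0 * q + b.repr z 1 * p, ?_⟩
    conv_lhs => rw [hb z]
    rw [hb0, hb1]; push_cast; ring
  have hind : ∀ x y : ℤ, (x : 𝓞 K) + y * w = 0 → x = 0 ∧ y = 0 := by
    intro x y h
    have := hli (x * p - y * v) (x * q + y * u) (by
      push_cast; rw [hw] at h; linear_combination h - (x : 𝓞 K) * h1)
    constructor
    · linear_combination (-x) * huv + u * this.1 + v * this.2
    · linear_combination (-y) * huv + p * this.2 - q * this.1
  obtain ⟨s, t, hst⟩ := hspan (w * w)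
  refine ⟨w, s, t, hst, ?_, hspan, hind⟩
  let c : Module.Basis (Fin 2) ℤ (𝓞 K) := Module.Basis.mk (v := ![1, w])
    (LinearIndependent.pair_iff.2 (fun x y h => hind x y (by simpa using h))) (by
      rintro z -
      obtain ⟨x, y, h⟩ := hspan z
      rw [Matrix.range_cons, Matrix.range_cons, Matrix.range_empty, Set.union_empty,
        Set.singleton_union, Submodule.mem_span_pair]
      exact ⟨x, y, by simp [h]⟩)
  have c0 : c 0 = 1 := by simp [c]
  have c1 : c 1 = w := by simp [c]
  have hrep : ∀ x y : ℤ, c.repr (x + y * w) 0 = x ∧ c.repr (x + y * w) 1 = y := by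
    intro x y
    have : (x : 𝓞 K) + y * w = x • c 0 + y • c 1 := by simp [c0, c1]
    rw [this, map_add, map_smul, map_smul, c.repr_self, c.repr_self]
    simp
  have hT1 : Algebra.trace ℤ (𝓞 K) 1 = 2 := by
    rw [← map_one (algebraMap ℤ (𝓞 K)), Algebra.trace_algebraMap, hr]; simp
  have hTw : Algebra.trace ℤ (𝓞 K) w = t := by
    rw [Algebra.trace_eq_matrix_trace c, Matrix.trace_fin_two, Algebra.leftMulMatrix_eq_repr_mul,
      Algebra.leftMulMatrix_eq_repr_mul, c0, c1, hst, (hrep s t).2]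
    have := (hrep 0 1).1
    simp at this
    simp [this]
  have hTw2 : Algebra.trace ℤ (𝓞 K) (w * w) = 2 * s + t * t := by
    have : w * w = s • (1 : 𝓞 K) + t • w := by simp [hst]
    rw [this, map_add, map_smul, map_smul, hT1, hTw]; simp [mul_comm]
  rw [← NumberField.discr_eq_discr K c, Algebra.discr_def, Matrix.det_fin_two]
  simp [Algebra.traceMatrix_apply, Algebra.traceForm_apply, c0, c1, hT1, hTw, hTw2]
  ring

theorem zs_pow (n a b : ℤ) (k : ℕ) : ∃ X Y : ℤ, (⟨a, b⟩ : ℤ√n) ^ (k + 3) =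
    ⟨a ^ (k+3) + ((k+3).choose 2 : ℕ) * a ^ (k+1) * b ^ 2 * n + n ^ 2 * X,
     (k + 3 : ℕ) * a ^ (k+2) * b + ((k+3).choose 3 : ℕ) * a ^ k * b ^ 3 * n + n ^ 2 * b * Y⟩ := by
  induction k with
  | zero =>
    refine ⟨0, 0, ?_⟩
    ext <;> simp [pow_succ, Nat.choose] <;> ring
  | succ k ih =>
    obtain ⟨X, Y, h⟩ := ih
    have e2 : (((k+1+3).choose 2 : ℕ) : ℤ) = (k+3) + ((k+3).choose 2 : ℕ) := by
      rw [show k+1+3 = (k+3)+1 by ring, Nat.choose_succ_succ']; simp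
    have e3 : (((k+1+3).choose 3 : ℕ) : ℤ) = ((k+3).choose 2 : ℕ) + ((k+3).choose 3 : ℕ) := by
      rw [show k+1+3 = (k+3)+1 by ring, Nat.choose_succ_succ']; simp
    refine ⟨a * X + b^4 * ((k+3).choose 3 : ℕ) * a ^ k + b * (n * b * Y), X + a * Y, ?_⟩
    rw [show k+1+3 = (k+3)+1 by ring, pow_succ, h, ← show k+1+3 = (k+3)+1 by ring]
    ext
    · simp only [Zsqrtd.re_mul, e2]; push_cast; ring
    · simp only [Zsqrtd.im_mul, e3]; push_cast; ring

def StepProp (ℓ : ℕ) (n : ℤ) : Prop := ∀ a b : ℤ, ¬ (ℓ : ℤ) ∣ a →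
  ∃ a' w : ℤ, (⟨a, b⟩ : ℤ√n) ^ ℓ = ⟨a', ℓ * b * w⟩ ∧ ¬ (ℓ : ℤ) ∣ a' ∧ ¬ (ℓ : ℤ) ∣ w

theorem step_two (n : ℤ) (hn : (2 : ℤ) ∣ n) : StepProp 2 n := by
  intro a b ha
  have hp : Prime (2 : ℤ) := Int.prime_two
  refine ⟨a ^ 2 + n * b ^ 2, a, ?_, ?_, ha⟩
  · ext <;> simp [pow_succ] <;> ring
  · intro h
    have := (dvd_add_left (hn.mul_right (b ^ 2))).1 h
    exact ha (hp.dvd_of_dvd_pow this)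

theorem step_three (n : ℤ) (hn : n % 9 = 3) : StepProp 3 n := by
  intro a b ha
  obtain ⟨m, hm⟩ : ∃ m, n = 9 * m + 3 := ⟨n / 9, by omega⟩
  refine ⟨a ^ 3 + 3 * a * b ^ 2 * n, a ^ 2 + b ^ 2 * (3 * m + 1), ?_, ?_, ?_⟩
  · ext <;> simp [pow_succ, hm] <;> ring
  · intro h
    have : (3 : ℤ) ∣ a ^ 3 := (dvd_add_left ⟨a * b ^ 2 * n, by ring⟩).1 h
    exact ha (Int.prime_three.dvd_of_dvd_pow this)
  · intro h
    have h2 : (3 : ℤ) ∣ a ^ 2 + b ^ 2 := by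
      have e : a ^ 2 + b ^ 2 * (3 * m + 1) = (a ^ 2 + b ^ 2) + 3 * (b ^ 2 * m) := by ring
      push_cast at h
      rw [e] at h
      exact (dvd_add_left (dvd_mul_right _ _)).1 h
    push_cast at ha
    have h3 : a % 3 = 1 ∨ a % 3 = 2 := by omega
    have h4 : b % 3 = 0 ∨ b % 3 = 1 ∨ b % 3 = 2 := by omega
    have h5 := Int.emod_eq_zero_of_dvd h2
    rcases h3 with h3 | h3 <;> rcases h4 with h4 | h4 | h4 <;>
      simp [pow_two, Int.add_emod, Int.mul_emod, h3, h4] at h5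

theorem step_ge (ℓ : ℕ) (hℓ : ℓ.Prime) (h5 : 5 ≤ ℓ) (n : ℤ) (hn : (ℓ : ℤ) ∣ n) :
    StepProp ℓ n := by
  intro a b ha
  have hp : Prime (ℓ : ℤ) := Nat.prime_iff_prime_int.1 hℓ
  obtain ⟨k, hk⟩ : ∃ k, ℓ = k + 3 := ⟨ℓ - 3, by omega⟩
  obtain ⟨X, Y, h⟩ := zs_pow n a b k
  obtain ⟨c, hc⟩ := hℓ.dvd_choose_self (k := 3) (by norm_num) (by omega)
  obtain ⟨m, hm⟩ := hn
  rw [← hk, hc] at h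
  refine ⟨a ^ ℓ + (ℓ.choose 2 : ℕ) * a ^ (k + 1) * b ^ 2 * n + n ^ 2 * X, a ^ (k + 2) + ℓ * (c * a ^ k * b ^ 2 * m + m ^ 2 * Y), h.trans ?_, ?_, ?_⟩
  · ext
    · rfl
    · simp only [hm]; push_cast; ring
  · intro h
    have : (ℓ : ℤ) ∣ a ^ ℓ := by
      rw [add_assoc] at h
      refine (dvd_add_left ?_).1 h
      exact ⟨(ℓ.choose 2 : ℕ) * a ^ (k + 1) * b ^ 2 * m + n * m * X, by rw [hm]; ring⟩
    exact ha (hp.dvd_of_dvd_pow this)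
  · intro h
    exact ha (hp.dvd_of_dvd_pow ((dvd_add_left (dvd_mul_right _ _)).1 h))

theorem step_iter (ℓ : ℕ) (hℓ : ℓ.Prime) (n : ℤ) (hs : StepProp ℓ n) (k : ℕ) :
    ∃ a w : ℤ, (⟨1, 1⟩ : ℤ√n) ^ (ℓ ^ k) = ⟨a, ℓ ^ k * w⟩ ∧ ¬ (ℓ : ℤ) ∣ a ∧ ¬ (ℓ : ℤ) ∣ w := by
  have hp : Prime (ℓ : ℤ) := Nat.prime_iff_prime_int.1 hℓ
  induction k with
  | zero => exact ⟨1, 1, by simp, hp.not_dvd_one, hp.not_dvd_one⟩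
  | succ k ih =>
    obtain ⟨a, w, h, ha, hw⟩ := ih
    obtain ⟨a', w', h', ha', hw'⟩ := hs a (ℓ ^ k * w) ha
    refine ⟨a', w * w', ?_, ha', fun h => (hp.dvd_or_dvd h).elim hw hw'⟩
    rw [pow_succ, pow_mul, h, h']
    ext
    · rfl
    · simp only; ring

theorem core {A : Type*} [CommRing A] (ℓ : ℕ) (hℓ : ℓ.Prime) (e : ℕ) (n : ℤ) (p : A)
    (hp : p * p = n) (hn : (ℓ : ℤ) ∣ n) (hs : StepProp ℓ n)
    (hsp : ∀ z : A, ∃ u v : ℤ, z = u + v * p)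
    (hind : ∀ u v : ℤ, (u : A) + v * p = 0 → (ℓ : ℤ) ^ (e + 1) ∣ u ∧ (ℓ : ℤ) ^ (e + 1) ∣ v)
    (f : ZMod (ℓ ^ (e + 1)) →+* A) :
    IsCyclic (Aˣ ⧸ (Units.map f.toMonoidHom).range) ∧
    Nat.card (Aˣ ⧸ (Units.map f.toMonoidHom).range) = ℓ ^ (e + 1) := by
  have hP : Prime (ℓ : ℤ) := Nat.prime_iff_prime_int.1 hℓ
  have : NeZero (ℓ ^ (e + 1)) := ⟨pow_ne_zero _ hℓ.ne_zero⟩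
  have : Fact ℓ.Prime := ⟨hℓ⟩
  have hll : (ℓ : ℤ) ∣ (ℓ : ℤ) ^ (e + 1) := dvd_pow_self _ (by omega)
  have hz : ∀ m : ℤ, (ℓ : ℤ) ^ (e + 1) ∣ m → (m : ZMod (ℓ ^ (e + 1))) = 0 := by
    intro m hm
    rw [ZMod.intCast_zmod_eq_zero_iff_dvd]
    exact_mod_cast hm
  have hinvZ : ∀ m : ℤ, ¬ (ℓ : ℤ) ∣ m → ∃ m' : ℤ, (m : ZMod (ℓ ^ (e + 1))) * m' = 1 := by
    intro m hm
    have hc : IsCoprime ((ℓ : ℤ) ^ (e + 1)) m := (hP.coprime_iff_not_dvd.2 hm).pow_left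
    obtain ⟨x, y, hxy⟩ := hc
    refine ⟨y, ?_⟩
    have := hz (m * y - 1) ⟨-x, by linear_combination hxy⟩
    push_cast at this
    linear_combination this
  have hinv : ∀ m : ℤ, ¬ (ℓ : ℤ) ∣ m → ∃ m' : ℤ, (m : A) * m' = 1 := by
    intro m hm
    obtain ⟨m', h⟩ := hinvZ m hm
    refine ⟨m', ?_⟩
    simpa using congrArg f h
  have hr1 : ∀ U ∈ (Units.map f.toMonoidHom).range, ∃ m : ℤ, (U : A) = m := by
    rintro U ⟨V, rfl⟩
    obtain ⟨m, hm⟩ := ZMod.intCast_surjective (V : ZMod (ℓ ^ (e + 1)))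
    refine ⟨m, ?_⟩
    simp [← hm]
  have hr2 : ∀ (U : Aˣ) (m : ℤ), ¬ (ℓ : ℤ) ∣ m → (U : A) = m →
      U ∈ (Units.map f.toMonoidHom).range := by
    intro U m hm hU
    obtain ⟨m', h⟩ := hinvZ m hm
    refine ⟨Units.mkOfMulEqOne _ _ h, ?_⟩
    ext
    simp [hU]
  have hE : ∀ v : ℤ, ∃ U : Aˣ, (U : A) = 1 + v * p := by
    intro v
    obtain ⟨m', h⟩ := hinv (1 - v ^ 2 * n) (by
      intro h
      have := (dvd_sub_left (hn.mul_left (v ^ 2))).1 h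
      exact hP.not_dvd_one this)
    push_cast at h
    refine ⟨Units.mkOfMulEqOne (1 + v * p) ((1 - v * p) * m') ?_, rfl⟩
    linear_combination h - (v : A) ^ 2 * m' * hp
  choose E hE using hE
  have hcast : ∀ x : ZMod (ℓ ^ (e + 1)), ((x.val : ℤ) : ZMod (ℓ ^ (e + 1))) = x := by
    intro x; simp
  have hbij : Function.Bijective (fun x : ZMod (ℓ ^ (e + 1)) =>
      (QuotientGroup.mk (E (x.val : ℤ)) : Aˣ ⧸ (Units.map f.toMonoidHom).range)) := by
    constructor
    · intro x y hxy
      obtain ⟨m, hm⟩ := hr1 _ (QuotientGroup.eq.1 hxy)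
      have h1 : (E (y.val : ℤ) : A) = E (x.val : ℤ) * m := by
        rw [← hm, Units.val_mul, Units.mul_inv_cancel_left]
      rw [hE, hE] at h1
      obtain ⟨ha, hb⟩ := hind (1 - m) ((y.val : ℤ) - m * (x.val : ℤ)) (by
        push_cast at h1 ⊢; linear_combination h1)
      have ha := hz _ ha
      have hb := hz _ hb
      rw [Int.cast_sub, Int.cast_mul, hcast, hcast] at hb
      rw [Int.cast_sub, Int.cast_one] at ha
      linear_combination x * ha - hb
    · intro g
      obtain ⟨U, rfl⟩ := QuotientGroup.mk_surjective g
      obtain ⟨u, v, huv⟩ := hsp U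
      obtain ⟨u', v', huv'⟩ := hsp (U⁻¹ : Aˣ)
      have hu : ¬ (ℓ : ℤ) ∣ u := by
        intro hu
        have h1 : (U : A) * (U⁻¹ : Aˣ) = 1 := Units.mul_inv U
        rw [huv, huv'] at h1
        have h2 := (hind (u * u' + v * v' * n - 1) (u * v' + v * u') (by
          push_cast; linear_combination h1 - (v : A) * v' * hp)).1
        have h3 := hll.trans h2
        have h4 : (ℓ : ℤ) ∣ u * u' + v * v' * n := dvd_add (hu.mul_right _) (hn.mul_left _)
        exact hP.not_dvd_one ((dvd_sub_right h4).1 h3)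
      obtain ⟨m, hm⟩ := hinv u hu
      refine ⟨((v * m : ℤ) : ZMod (ℓ ^ (e + 1))), ?_⟩
      refine QuotientGroup.eq.2 (hr2 _ u hu ?_)
      rw [Units.val_mul, Units.inv_mul_eq_iff_eq_mul, hE, huv]
      have h1 := congrArg f (hcast ((v * m : ℤ) : ZMod (ℓ ^ (e + 1))))
      rw [map_intCast, map_intCast] at h1
      rw [h1]
      push_cast
      linear_combination (-(v : A) * p) * hm
  have hcard : Nat.card (Aˣ ⧸ (Units.map f.toMonoidHom).range) = ℓ ^ (e + 1) := by
    rw [← Nat.card_eq_of_bijective _ hbij, Nat.card_zmod]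
  refine ⟨?_, hcard⟩
  have : Finite (Aˣ ⧸ (Units.map f.toMonoidHom).range) :=
    Nat.finite_of_card_ne_zero (by rw [hcard]; exact pow_ne_zero _ hℓ.ne_zero)
  refine isCyclic_of_orderOf_eq_card (QuotientGroup.mk (E 1)) ?_
  rw [hcard]
  refine orderOf_eq_prime_pow ?_ ?_
  · intro h
    rw [← QuotientGroup.mk_pow, QuotientGroup.eq_one_iff] at h
    obtain ⟨m, hm⟩ := hr1 _ h
    obtain ⟨a, w, haw, -, hw⟩ := step_iter ℓ hℓ n hs e
    have h1 := congrArg (Zsqrtd.lift ⟨p, hp⟩) haw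
    rw [map_pow, Zsqrtd.lift_apply_apply, Zsqrtd.lift_apply_apply] at h1
    rw [Units.val_pow_eq_pow_val, hE] at hm
    push_cast at h1 hm
    have h2 := (hind (a - m) (ℓ ^ e * w) (by push_cast; linear_combination hm - h1)).2
    rw [pow_succ] at h2
    exact hw ((mul_dvd_mul_iff_left (pow_ne_zero e hP.ne_zero)).1 h2)
  · have h := pow_card_eq_one' (x := (QuotientGroup.mk (E 1) :
      Aˣ ⧸ (Units.map f.toMonoidHom).range))
    exact (congrArg (fun k => (QuotientGroup.mk (E 1) :
      Aˣ ⧸ (Units.map f.toMonoidHom).range) ^ k) hcard).symm.trans h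

theorem core_ring {O : Type*} [CommRing O] (ℓ : ℕ) (hℓ : ℓ.Prime) (d : ℕ) (hd : 1 ≤ d)
    (n : ℤ) (p : O) (hp : p * p = n) (hn : (ℓ : ℤ) ∣ n) (hs : StepProp ℓ n)
    (hsp : ∀ z : O, ∃ u v : ℤ, ∃ r : O, z = u + v * p + ℓ ^ d * r)
    (hind : ∀ u v : ℤ, (ℓ : O) ^ d ∣ (u : O) + v * p → (ℓ : ℤ) ^ d ∣ u ∧ (ℓ : ℤ) ^ d ∣ v)
    (f : ZMod (ℓ ^ d) →+* (O ⧸ Ideal.span {(ℓ : O) ^ d})) :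
    IsCyclic ((O ⧸ Ideal.span {(ℓ : O) ^ d})ˣ ⧸ (Units.map f.toMonoidHom).range) ∧
    Nat.card ((O ⧸ Ideal.span {(ℓ : O) ^ d})ˣ ⧸ (Units.map f.toMonoidHom).range) = ℓ ^ d := by
  obtain ⟨e, rfl⟩ : ∃ e, d = e + 1 := ⟨d - 1, by omega⟩
  refine core ℓ hℓ e n (Ideal.Quotient.mk _ p) ?_ hn hs ?_ ?_ f
  · rw [← map_mul, hp, map_intCast]
  · intro z
    obtain ⟨z, rfl⟩ := Ideal.Quotient.mk_surjective z
    obtain ⟨u, v, r, h⟩ := hsp z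
    refine ⟨u, v, ?_⟩
    rw [← map_intCast (Ideal.Quotient.mk (Ideal.span {(ℓ : O) ^ (e + 1)})) u,
      ← map_intCast (Ideal.Quotient.mk (Ideal.span {(ℓ : O) ^ (e + 1)})) v, ← map_mul, ← map_add,
      Ideal.Quotient.eq, Ideal.mem_span_singleton]
    exact ⟨r, by rw [h]; ring⟩
  · intro u v h
    apply hind
    rw [← map_intCast (Ideal.Quotient.mk (Ideal.span {(ℓ : O) ^ (e + 1)})) u,
      ← map_intCast (Ideal.Quotient.mk (Ideal.span {(ℓ : O) ^ (e + 1)})) v, ← map_mul, ← map_add,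
      Ideal.Quotient.eq_zero_iff_mem, Ideal.mem_span_singleton] at h
    exact h

/-- Let `ℓ` be a prime, `K` an imaginary quadratic field in which `ℓ` is
ramified, and `d ≥ 1`.  Assume `ℓ = 2` and `D_K ≡ 8 (mod 16)`, or `ℓ = 3` and
`D_K ≡ 3 (mod 9)`, or `ℓ ≥ 5`.  Then `λ_d`, the cokernel of the natural map
`(ℤ/ℓ^dℤ)ˣ → (O_K/ℓ^dO_K)ˣ`, is cyclic of order `ℓ^d`. -/
theorem lambda_d_of_ramified_general
    {K : Type*} [Field K] [NumberField K]
    (hdeg : Module.finrank ℚ K = 2) (hneg : NumberField.discr K < 0)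
    (ℓ : ℕ) (hℓ : ℓ.Prime)
    (hram : ∃ P : Ideal (𝓞 K), P.IsPrime ∧ Ideal.span {(ℓ : 𝓞 K)} = P ^ 2)
    (hcase : (ℓ = 2 ∧ NumberField.discr K % 16 = 8) ∨
             (ℓ = 3 ∧ NumberField.discr K % 9 = 3) ∨ 5 ≤ ℓ)
    (d : ℕ) (hd : 1 ≤ d)
    (f : ZMod (ℓ ^ d) →+* (𝓞 K ⧸ Ideal.span {(ℓ : 𝓞 K) ^ d})) :
    IsCyclic ((𝓞 K ⧸ Ideal.span {(ℓ : 𝓞 K) ^ d})ˣ ⧸ (Units.map f.toMonoidHom).range) ∧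
    Nat.card ((𝓞 K ⧸ Ideal.span {(ℓ : 𝓞 K) ^ d})ˣ ⧸ (Units.map f.toMonoidHom).range) = ℓ ^ d := by
  have hP : Prime (ℓ : ℤ) := Nat.prime_iff_prime_int.1 hℓ
  obtain ⟨w, s, t, hw, hD, hspan, hli⟩ := quad_basis hdeg
  generalize NumberField.discr K = D at *
  have hdvd : ∀ (k : ℕ) (x y : ℤ), (ℓ : 𝓞 K) ^ k ∣ (x : 𝓞 K) + y * w →
      (ℓ : ℤ) ^ k ∣ x ∧ (ℓ : ℤ) ^ k ∣ y := by
    rintro k x y ⟨z, hz⟩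
    obtain ⟨x', y', rfl⟩ := hspan z
    obtain ⟨h1, h2⟩ := hli (x - ℓ ^ k * x') (y - ℓ ^ k * y') (by
      push_cast; linear_combination hz)
    exact ⟨⟨x', by linear_combination h1⟩, ⟨y', by linear_combination h2⟩⟩
  by_cases h2 : ℓ = 2
  · subst h2
    have hD16 : D % 16 = 8 := by omega
    have ht : t % 2 = 0 := by
      rcases Int.emod_two_eq_zero_or_one t with h | h
      · exact h
      · exfalso
        obtain ⟨r, hr⟩ : ∃ r, t = 2 * r + 1 := ⟨t / 2, by omega⟩
        have : D = 2 * (2 * r ^ 2 + 2 * r + 2 * s) + 1 := by rw [hD, hr]; ring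
        omega
    obtain ⟨r, hr⟩ : ∃ r, t = 2 * r := ⟨t / 2, by omega⟩
    have hDn : D = 4 * (s + r ^ 2) := by rw [hD, hr]; ring
    have hn : (2 : ℤ) ∣ s + r ^ 2 := by omega
    refine core_ring 2 hℓ d hd (s + r ^ 2) (w - r) ?_ hn (step_two _ hn) ?_ ?_ f
    · rw [hr] at hw
      push_cast at hw ⊢
      linear_combination hw
    · intro z
      obtain ⟨x, y, rfl⟩ := hspan z
      exact ⟨x + y * r, y, 0, by push_cast; ring⟩
    · intro u v h
      obtain ⟨ha, hb⟩ := hdvd d (u - v * r) v (by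
        convert h using 1; push_cast; ring)
      exact ⟨(dvd_sub_left (hb.mul_right r)).1 ha, hb⟩
  · have hl2 : ¬ (ℓ : ℤ) ∣ 2 := by
      intro h
      have : ℓ ∣ 2 := by exact_mod_cast h
      exact h2 ((Nat.prime_dvd_prime_iff_eq hℓ Nat.prime_two).1 this)
    have hco : ∀ k, IsCoprime ((ℓ : ℤ) ^ k) 2 := fun k =>
      (hP.coprime_iff_not_dvd.2 hl2).pow_left
    have hpp : (2 * w - t) * (2 * w - t) = (D : 𝓞 K) := by
      rw [hD]; push_cast; linear_combination 4 * hw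
    have hind : ∀ (k : ℕ) (u v : ℤ), (ℓ : 𝓞 K) ^ k ∣ (u : 𝓞 K) + v * (2 * w - t) →
        (ℓ : ℤ) ^ k ∣ u ∧ (ℓ : ℤ) ^ k ∣ v := by
      intro k u v h
      obtain ⟨ha, hb⟩ := hdvd k (u - v * t) (2 * v) (by
        convert h using 1; push_cast; ring)
      have hb := (hco k).dvd_of_dvd_mul_left hb
      exact ⟨(dvd_sub_left (hb.mul_right t)).1 ha, hb⟩
    have hlD : (ℓ : ℤ) ∣ D := by
      by_contra hnD
      obtain ⟨P, hPp, hPP⟩ := hram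
      have hl0 : (ℓ : 𝓞 K) ≠ 0 := by exact_mod_cast hℓ.ne_zero
      have hP0 : P ≠ 0 := by
        rintro rfl
        rw [zero_pow two_ne_zero] at hPP
        exact hl0 (Ideal.span_singleton_eq_bot.1 hPP)
      have hle : ¬ P ≤ Ideal.span {(ℓ : 𝓞 K)} := by
        intro hle
        have h1 : P * P = P * 1 := by
          rw [mul_one]
          refine le_antisymm Ideal.mul_le_left ?_
          rw [← pow_two, ← hPP]; exact hle
        exact hPp.ne_top (by simpa using mul_left_cancel₀ hP0 h1)
      obtain ⟨x, hxP, hx⟩ := Set.not_subset.1 hle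
      apply hx
      have hx2 : x * x ∈ Ideal.span {(ℓ : 𝓞 K)} := by
        rw [hPP, pow_two]; exact Ideal.mul_mem_mul hxP hxP
      obtain ⟨z, hz⟩ := Ideal.mem_span_singleton.1 hx2
      obtain ⟨a, b, rfl⟩ := hspan x
      obtain ⟨h3, h4⟩ := hind 1 ((2 * a + b * t) ^ 2 + b ^ 2 * D) (2 * ((2 * a + b * t) * b))
        ⟨4 * z, by push_cast; linear_combination 4 * hz - (b : 𝓞 K) ^ 2 * hpp⟩
      rw [pow_one] at h3 h4
      have h4 := (hP.dvd_or_dvd h4).resolve_left hl2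
      have hb : (ℓ : ℤ) ∣ b := by
        rcases hP.dvd_or_dvd h4 with h | h
        · have := (dvd_add_right (dvd_pow h two_ne_zero)).1 h3
          exact hP.dvd_of_dvd_pow ((hP.dvd_or_dvd this).resolve_right hnD)
        · exact h
      have hc : (ℓ : ℤ) ∣ 2 * a + b * t :=
        hP.dvd_of_dvd_pow ((dvd_add_left ((dvd_pow hb two_ne_zero).mul_right D)).1 h3)
      have ha := (hP.dvd_or_dvd ((dvd_add_left (hb.mul_right t)).1 hc)).resolve_left hl2
      obtain ⟨a', rfl⟩ := ha
      obtain ⟨b', rfl⟩ := hb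
      exact Ideal.mem_span_singleton.2 ⟨a' + b' * w, by push_cast; ring⟩
    have hstep : StepProp ℓ D := by
      rcases hcase with h | h | h
      · exact absurd h.1 h2
      · obtain ⟨rfl, h⟩ := h
        exact step_three D h
      · exact step_ge ℓ hℓ h D hlD
    refine core_ring ℓ hℓ d hd D (2 * w - t) hpp hlD hstep ?_ (hind d) f
    intro z
    obtain ⟨x, y, rfl⟩ := hspan z
    obtain ⟨i, j, hij⟩ := hco d
    have hij' : (i : 𝓞 K) * ℓ ^ d + j * 2 = 1 := by exact_mod_cast hij
    refine ⟨x + y * j * t, y * j, y * i * w, ?_⟩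
    push_cast
    linear_combination (-(y : 𝓞 K) * w) * hij'
end
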